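/- Fix an integer d ≥ n and a natural number j. If j is not divisible by m−n, or if j > n·(m−n), then Ext^j_S(I^d, S) = 0 (the Ext group is subsingleton). -/

import Mathlib

open MvPolynomial

set_option linter.unusedSectionVars false

section Weyl

variable {R ι κ : Type*} [Ring R] [Fintype ι] [Fintype κ] [DecidableEq ι] [DecidableEq κ]

/-- Two families of ring elements satisfying the canonical commutation relations. -/
structure IsWeylPair (x p : ι → κ → R) : Prop where
  xx : ∀ i a k b, x i a * x k b = x k b * x i a
  pp : ∀ i a k b, p i a * p k b = p k b * p i a
  px : ∀ i a k b, p i a * x k b = x k b * p i a + if i = k ∧ a = b then 1 else 0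

/-- The column polarization operators. -/
def colPol (x p : ι → κ → R) (a b : κ) : R := ∑ k, x k a * p k b

/-- The row polarization operators. -/
def rowPol (x p : ι → κ → R) (k i : ι) : R := ∑ b, x k b * p i b

/-- The second order operators lowering the degree by one. -/
def lowOp (d : ℕ) (x p : ι → κ → R) (i : ι) (a : κ) : R :=
  ∑ b, p i b * (colPol x p b a - if b = a then (d : R) else 0)

namespace IsWeylPair

variable {x p : ι → κ → R} (h : IsWeylPair x p)
include h

theorem p_colPol (i : ι) (a b c : κ) :
    p i a * colPol x p b c = colPol x p b c * p i a + if a = b then p i c else 0 := by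
  have : ∀ k, p i a * (x k b * p k c) =
      x k b * p k c * p i a + if i = k ∧ a = b then p k c else 0 := fun k => by
    rw [← mul_assoc, h.px, add_mul, mul_assoc, h.pp i a, ← mul_assoc]
    split_ifs <;> simp
  simp only [colPol, Finset.mul_sum, Finset.sum_mul, this, Finset.sum_add_distrib]
  by_cases hab : a = b <;> simp [hab]

theorem colPol_x (a b c : κ) (k : ι) :
    colPol x p a b * x k c = x k c * colPol x p a b + if b = c then x k a else 0 := by
  have : ∀ i, x i a * p i b * x k c =
      x k c * (x i a * p i b) + if i = k ∧ b = c then x i a else 0 := fun i => by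
    rw [mul_assoc, h.px, mul_add, ← mul_assoc, h.xx i a, mul_assoc]
    split_ifs <;> simp
  simp only [colPol, Finset.mul_sum, Finset.sum_mul, this, Finset.sum_add_distrib]
  by_cases hab : b = c <;> simp [hab]

theorem colPol_colPol (a b c e : κ) :
    colPol x p a b * colPol x p c e = colPol x p c e * colPol x p a b
      + (if b = c then colPol x p a e else 0) - if e = a then colPol x p c b else 0 := by
  have : ∀ k, colPol x p a b * (x k c * p k e) = x k c * p k e * colPol x p a b
      + (if b = c then x k a * p k e else 0) - if e = a then x k c * p k b else 0 := fun k => by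
    rw [← mul_assoc, h.colPol_x, add_mul, mul_assoc, mul_assoc, h.p_colPol k e a b]
    split_ifs <;> simp [mul_add] <;> abel
  conv_lhs => rw [colPol.eq_def x p c e, Finset.mul_sum]
  simp only [this, Finset.sum_add_distrib, Finset.sum_sub_distrib, ← Finset.sum_mul]
  split_ifs <;> simp [colPol]

theorem sum_p_x (k i : ι) :
    ∑ c, p i c * x k c = rowPol x p k i + if i = k then (Fintype.card κ : R) else 0 := by
  simp only [h.px, Finset.sum_add_distrib, rowPol]
  by_cases hik : i = k <;> simp [hik]

theorem lowOp_x (d : ℕ) (i : ι) (a : κ) (k : ι) (c : κ) :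
    lowOp d x p i a * x k c = x k c * lowOp d x p i a
      + (if i = k then colPol x p c a - if c = a then (d : R) else 0 else 0)
      + if a = c then ∑ b, p i b * x k b else 0 := by
  have : ∀ b, p i b * (colPol x p b a - if b = a then (d : R) else 0) * x k c =
      x k c * (p i b * (colPol x p b a - if b = a then (d : R) else 0))
      + (if i = k ∧ b = c then (colPol x p b a - if b = a then (d : R) else 0) else 0)
      + if a = c then p i b * x k b else 0 := fun b => by
    have h1 : (colPol x p b a - if b = a then (d : R) else 0) * x k c =
      x k c * (colPol x p b a - if b = a then (d : R) else 0)
        + if a = c then x k b else 0 := by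
      rw [sub_mul, h.colPol_x, mul_sub]
      have : (if b = a then (d : R) else 0) * x k c = x k c * if b = a then (d : R) else 0 := by
        split_ifs
        · exact Nat.cast_commute _ _
        · simp
      rw [this]; abel
    rw [mul_assoc, h1, mul_add, ← mul_assoc, h.px, add_mul, mul_assoc]
    split_ifs <;> simp
  simp only [lowOp, Finset.mul_sum, Finset.sum_mul, this, Finset.sum_add_distrib]
  congr 1
  · congr 1
    by_cases hik : i = k <;> simp [hik]
  · split_ifs <;> simp

omit h [DecidableEq ι] in
theorem sum_x_lowOp (d : ℕ) (b : κ) :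
    ∑ i, x i b * lowOp d x p i b =
      ∑ c, colPol x p b c * (colPol x p c b - if c = b then (d : R) else 0) := by
  simp only [lowOp, Finset.mul_sum]
  rw [Finset.sum_comm]
  refine Finset.sum_congr rfl fun c _ => ?_
  rw [colPol.eq_def x p b c, Finset.sum_mul]
  simp [mul_assoc]

omit h in
theorem sum_rowPol : ∑ i, rowPol x p i i = ∑ a, colPol x p a a := by
  simp only [rowPol, colPol]
  exact Finset.sum_comm

theorem colPol_lowOp (d : ℕ) (a : κ) (i : ι) (b : κ) :
    colPol x p a a * lowOp d x p i b =
      lowOp d x p i b * colPol x p a a - if a = b then lowOp d x p i b else 0 := by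
  have : ∀ c, colPol x p a a * (p i c * (colPol x p c b - if c = b then (d : R) else 0)) =
      p i c * (colPol x p c b - if c = b then (d : R) else 0) * colPol x p a a
      - if a = b then p i c * (colPol x p c b - if c = b then (d : R) else 0) else 0 := fun c => by
    have h1 : colPol x p a a * p i c = p i c * colPol x p a a - if c = a then p i a else 0 := by
      rw [h.p_colPol]; abel
    have h2 : colPol x p a a * (colPol x p c b - if c = b then (d : R) else 0) =
      (colPol x p c b - if c = b then (d : R) else 0) * colPol x p a a
       + (if a = c then colPol x p a b else 0) - if a = b then colPol x p c a else 0 := by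
      rw [mul_sub, h.colPol_colPol, sub_mul]
      have : (if c = b then (d : R) else 0) * colPol x p a a =
          colPol x p a a * if c = b then (d : R) else 0 := by
        split_ifs
        · exact Nat.cast_commute _ _
        · simp
      rw [this]
      simp only [eq_comm (a := b) (b := a)]
      abel
    rw [← mul_assoc, h1, sub_mul, mul_assoc, h2]
    by_cases hca : c = a
    · subst hca
      by_cases hcb : c = b
      · subst hcb; simp; noncomm_ring
      · simp [hcb]; noncomm_ring
    · by_cases hab : a = b
      · subst hab; simp [hca, Ne.symm hca]; noncomm_ring
      · simp [hca, Ne.symm hca, hab]; noncomm_ring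
  simp only [lowOp, Finset.mul_sum, Finset.sum_mul, this, Finset.sum_sub_distrib]
  congr 1
  split_ifs <;> simp

/-- The relation on which the vanishing argument for highest weight vectors rests. -/
theorem sum_lowOp_x (d : ℕ) (b : κ) :
    ∑ i, lowOp d x p i b * x i b =
      ∑ c, colPol x p b c * (colPol x p c b - if c = b then (d : R) else 0)
      + Fintype.card ι * (colPol x p b b - d) + ∑ i, rowPol x p i i
      + Fintype.card ι * Fintype.card κ := by
  simp only [h.lowOp_x, if_true, Finset.sum_add_distrib, sum_x_lowOp, h.sum_p_x]
  simp only [Finset.sum_const, Finset.card_univ, nsmul_eq_mul]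
  abel

theorem lowOp_x_self (d : ℕ) (i : ι) (b : κ) :
    lowOp d x p i b * x i b = x i b * lowOp d x p i b + (colPol x p b b - d)
      + (rowPol x p i i + Fintype.card κ) := by
  simp only [h.lowOp_x, if_true, h.sum_p_x]

end IsWeylPair

end Weyl

section Fermi

variable {R σ : Type*} [Ring R] [Fintype σ] [DecidableEq σ]

/-- Two families of ring elements satisfying the canonical anticommutation relations. -/
structure IsFermiPair (e j : σ → R) : Prop where
  ee : ∀ u v, e u * e v = - (e v * e u)
  jj : ∀ u v, j u * j v = - (j v * j u)
  je : ∀ u v, j u * e v = (if u = v then 1 else 0) - e v * j u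

namespace IsFermiPair

variable {e j : σ → R} (h : IsFermiPair e j)
include h

theorem anticomm_sum (X Y : σ → R) (hX : ∀ u v, Commute (X u) (e v))
    (hY : ∀ u v, Commute (Y u) (j v)) :
    (∑ v, X v * j v) * (∑ v, Y v * e v) + (∑ v, Y v * e v) * (∑ v, X v * j v) =
      ∑ v, X v * Y v + ∑ u, ∑ v, (Y v * X u - X u * Y v) * (e v * j u) := by
  have key : ∀ u v, X u * j u * (Y v * e v) + Y v * e v * (X u * j u) =
      (if u = v then X u * Y v else 0) + (Y v * X u - X u * Y v) * (e v * j u) := fun u v => by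
    have h1 : X u * j u * (Y v * e v) = X u * Y v * (j u * e v) := by
      rw [mul_assoc, ← mul_assoc (j u), ← (hY v u).eq]; simp only [mul_assoc]
    have h2 : Y v * e v * (X u * j u) = Y v * X u * (e v * j u) := by
      rw [mul_assoc, ← mul_assoc (e v), ← (hX u v).eq]; simp only [mul_assoc]
    rw [h1, h2, h.je]
    split_ifs <;> noncomm_ring
  rw [Finset.sum_mul_sum, Finset.sum_mul_sum, Finset.sum_comm (γ := σ) (s := Finset.univ)
    (f := fun i j_1 => Y i * e i * (X j_1 * j j_1)), ← Finset.sum_add_distrib]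
  simp only [← Finset.sum_add_distrib, key]
  simp [Finset.sum_add_distrib]

theorem sq_eq_zero [Module ℚ R] (X : σ → R) (hX : ∀ u v, Commute (X u) (j v))
    (hXX : ∀ u v, Commute (X u) (X v)) : (∑ v, X v * j v) * (∑ v, X v * j v) = 0 := by
  have h1 : (∑ v, X v * j v) * (∑ v, X v * j v) = - ((∑ v, X v * j v) * (∑ v, X v * j v)) := by
    conv_lhs => rw [Finset.sum_mul_sum, Finset.sum_comm]
    rw [Finset.sum_mul_sum, ← Finset.sum_neg_distrib]
    refine Finset.sum_congr rfl fun u _ => ?_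
    rw [← Finset.sum_neg_distrib]
    refine Finset.sum_congr rfl fun v _ => ?_
    calc X v * j v * (X u * j u) = X v * X u * (j v * j u) := by
          rw [mul_assoc, ← mul_assoc (j v), ← (hX u v).eq]; simp only [mul_assoc]
      _ = - (X u * X v * (j u * j v)) := by rw [h.jj, (hXX v u).eq]; simp
      _ = - (X u * j u * (X v * j v)) := by
          rw [mul_assoc (X u) (j u), ← mul_assoc (j u), ← (hX v u).eq]; simp only [mul_assoc]
  have : IsAddTorsionFree R := .of_module_rat R
  exact self_eq_neg.mp h1

theorem ej_j (u v w : σ) : e u * j v * j w = j w * (e u * j v) - if w = u then j v else 0 := by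
  rw [← mul_assoc (j w), h.je, sub_mul, mul_assoc (e u), mul_assoc (e u), h.jj v w]
  split_ifs <;> simp

theorem ej_e (u v w : σ) : e u * j v * e w = e w * (e u * j v) + if v = w then e u else 0 := by
  rw [← mul_assoc (e w), h.ee w u, mul_assoc (e u), h.je]
  split_ifs <;> simp [mul_sub, mul_assoc]
  abel

end IsFermiPair

end Fermi

section Fock

variable {σ : Type*} [Fintype σ] [DecidableEq σ]

/-- The sign attached to inserting `v` in the finite set `A`. -/
noncomputable def fockSign (v : σ) (A : Finset σ) : ℤ :=
  (-1) ^ (A.filter fun u => Fintype.equivFin σ u < Fintype.equivFin σ v).card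

theorem fockSign_mul_self (v : σ) (A : Finset σ) : fockSign v A * fockSign v A = 1 := by
  rw [fockSign, ← mul_pow]; simp

theorem fockSign_insert {u v : σ} {A : Finset σ} (hu : u ∉ A) :
    fockSign v (insert u A) =
      (if Fintype.equivFin σ u < Fintype.equivFin σ v then -1 else 1) * fockSign v A := by
  rw [fockSign, fockSign, Finset.filter_insert]
  split_ifs
  · rw [Finset.card_insert_of_notMem (by simp [hu]), pow_succ, mul_comm]
  · simp

theorem fockSign_erase {u v : σ} {A : Finset σ} (hu : u ∈ A) :
    fockSign v (A.erase u) =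
      (if Fintype.equivFin σ u < Fintype.equivFin σ v then -1 else 1) * fockSign v A := by
  conv_rhs => rw [← Finset.insert_erase hu, fockSign_insert (Finset.notMem_erase u A)]
  split_ifs <;> simp

theorem equivFin_lt_or {u v : σ} (h : u ≠ v) :
    (Fintype.equivFin σ u < Fintype.equivFin σ v ∧
      ¬ Fintype.equivFin σ v < Fintype.equivFin σ u) ∨
    (Fintype.equivFin σ v < Fintype.equivFin σ u ∧
      ¬ Fintype.equivFin σ u < Fintype.equivFin σ v) := by
  have : Fintype.equivFin σ u ≠ Fintype.equivFin σ v := fun h' => h (by simpa using h')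
  rcases lt_or_gt_of_ne this with h | h
  · exact Or.inl ⟨h, h.not_gt⟩
  · exact Or.inr ⟨h, h.not_gt⟩

variable (k : Type*) [Semiring k] {V : Type*} [AddCommGroup V] [Module k V]

/-- Exterior multiplication by a basis vector, on functions on finite sets. -/
noncomputable def fockE (v : σ) : Module.End k (Finset σ → V) where
  toFun f A := if v ∈ A then fockSign v A • f (A.erase v) else 0
  map_add' f g := by ext A; by_cases h : v ∈ A <;> simp [h]
  map_smul' c f := by ext A; by_cases h : v ∈ A <;> simp [h, smul_comm c]

/-- Contraction by a dual basis vector, on functions on finite sets. -/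
noncomputable def fockI (v : σ) : Module.End k (Finset σ → V) where
  toFun f A := if v ∈ A then 0 else fockSign v A • f (insert v A)
  map_add' f g := by ext A; by_cases h : v ∈ A <;> simp [h]
  map_smul' c f := by ext A; by_cases h : v ∈ A <;> simp [h, smul_comm c]

theorem fockE_apply (v : σ) (f : Finset σ → V) (A : Finset σ) :
    fockE k v f A = if v ∈ A then fockSign v A • f (A.erase v) else 0 := rfl

theorem fockI_apply (v : σ) (f : Finset σ → V) (A : Finset σ) :
    fockI k v f A = if v ∈ A then 0 else fockSign v A • f (insert v A) := rfl

theorem isFermiPair_fock :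
    IsFermiPair (R := Module.End k (Finset σ → V)) (fockE k (σ := σ)) (fockI k) where
  ee u v := by
    refine LinearMap.ext fun f => funext fun A => ?_
    simp only [Module.End.mul_apply, LinearMap.neg_apply, Pi.neg_apply, fockE_apply,
      Finset.mem_erase]
    by_cases huv : u = v
    · subst huv; simp
    by_cases hu : u ∈ A <;> by_cases hv : v ∈ A <;> simp only [hu, hv, huv, Ne.symm huv, ne_eq,
      not_false_eq_true, and_true, and_false, if_true, if_false, smul_zero, neg_zero, smul_smul]
    rw [fockSign_erase hu, fockSign_erase hv, Finset.erase_right_comm, ← neg_smul]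
    congr 1
    rcases equivFin_lt_or huv with h | h <;> simp [h.1, h.2] <;> ring
  jj u v := by
    refine LinearMap.ext fun f => funext fun A => ?_
    simp only [Module.End.mul_apply, LinearMap.neg_apply, Pi.neg_apply, fockI_apply,
      Finset.mem_insert]
    by_cases huv : u = v
    · subst huv; simp
    by_cases hu : u ∈ A <;> by_cases hv : v ∈ A <;> simp only [hu, hv, huv, Ne.symm huv, 
      or_false, or_true, if_true, if_false, smul_zero, neg_zero, smul_smul]
    rw [fockSign_insert hu, fockSign_insert hv, Finset.insert_comm, ← neg_smul]
    congr 1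
    rcases equivFin_lt_or huv with h | h <;> simp [h.1, h.2] <;> ring
  je u v := by
    refine LinearMap.ext fun f => funext fun A => ?_
    simp only [Module.End.mul_apply, LinearMap.sub_apply, Pi.sub_apply, fockI_apply, fockE_apply,
      Finset.mem_insert, Finset.mem_erase]
    by_cases huv : u = v
    · subst huv
      by_cases hu : u ∈ A
      · simp [hu, smul_smul, fockSign_erase hu, fockSign_mul_self]
      · simp [hu, smul_smul, fockSign_insert hu, fockSign_mul_self]
    by_cases hu : u ∈ A <;> by_cases hv : v ∈ A <;> simp only [hu, hv, huv, Ne.symm huv, 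
      or_false, or_true, if_true, if_false, smul_zero, smul_smul, and_true, and_false, ne_eq,
      not_false_eq_true, LinearMap.zero_apply, Pi.zero_apply, sub_zero, zero_sub]
    rw [fockSign_insert hu, fockSign_erase hv, Finset.erase_insert_of_ne huv, ← neg_smul]
    congr 1
    rcases equivFin_lt_or huv with h | h <;> simp [h.1, h.2] <;> ring

/-- Pointwise action of operators on Fock space. -/
def fockMap : Module.End k V →+* Module.End k (Finset σ → V) where
  toFun a := a.compLeft (Finset σ)
  map_one' := rfl
  map_mul' _ _ := rfl
  map_zero' := rfl
  map_add' _ _ := rfl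

theorem fockMap_apply (a : Module.End k V) (f : Finset σ → V) (A : Finset σ) :
    fockMap k a f A = a (f A) := rfl

theorem commute_fockMap_fockE (a : Module.End k V) (v : σ) :
    Commute (fockMap k a) (fockE k v) := by
  refine LinearMap.ext fun f => funext fun A => ?_
  simp only [Module.End.mul_apply, fockMap_apply, fockE_apply]
  split_ifs <;> simp [map_zsmul]

theorem commute_fockMap_fockI (a : Module.End k V) (v : σ) :
    Commute (fockMap k a) (fockI k v) := by
  refine LinearMap.ext fun f => funext fun A => ?_
  simp only [Module.End.mul_apply, fockMap_apply, fockI_apply]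
  split_ifs <;> simp [map_zsmul]

end Fock

section SuperWeyl

variable {R ι κ : Type*} [Ring R] [Fintype ι] [Fintype κ] [DecidableEq ι] [DecidableEq κ]

/-- A Weyl pair and a Fermi pair commuting with each other. -/
structure IsSuperWeyl (x p : ι → κ → R) (e j : ι × κ → R) : Prop where
  weyl : IsWeylPair x p
  fermi : IsFermiPair e j
  xe : ∀ i a v, Commute (x i a) (e v)
  xj : ∀ i a v, Commute (x i a) (j v)
  pe : ∀ i a v, Commute (p i a) (e v)
  pj : ∀ i a v, Commute (p i a) (j v)

/-- The Koszul differential. -/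
def koszul (x : ι → κ → R) (j : ι × κ → R) : R := ∑ v : ι × κ, x v.1 v.2 * j v

/-- Column polarizations of the exterior variables. -/
def extPol (e j : ι × κ → R) (a c : κ) : R := ∑ i, e (i, a) * j (i, c)

/-- Column polarizations of all variables. -/
def totPol (x p : ι → κ → R) (e j : ι × κ → R) (a c : κ) : R :=
  colPol x p a c + extPol e j a c

/-- The number operator of the exterior variables. -/
def numOp (e j : ι × κ → R) : R := ∑ v, e v * j v

/-- A contracting homotopy up to a positive operator, for the column `a`. -/
def lowHtpy (d : ℕ) (x p : ι → κ → R) (e : ι × κ → R) (a : κ) : R :=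
  ∑ i, lowOp d x p i a * e (i, a)

theorem sum_extPol (e j : ι × κ → R) : ∑ a, extPol e j a a = numOp e j := by
  simp only [extPol, numOp, Fintype.sum_prod_type]
  exact Finset.sum_comm

namespace IsFermiPair

variable {e j : ι × κ → R} (h : IsFermiPair e j)
include h

theorem extPol_e (a b c : κ) (k : ι) :
    extPol e j a b * e (k, c) = e (k, c) * extPol e j a b + if b = c then e (k, a) else 0 := by
  simp only [extPol, Finset.sum_mul, Finset.mul_sum, h.ej_e, Finset.sum_add_distrib,
    Prod.mk.injEq]
  by_cases hbc : b = c <;> simp [hbc]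

theorem extPol_j (a b c : κ) (k : ι) :
    extPol e j a b * j (k, c) = j (k, c) * extPol e j a b - if c = a then j (k, b) else 0 := by
  simp only [extPol, Finset.sum_mul, Finset.mul_sum, h.ej_j, Finset.sum_sub_distrib,
    Prod.mk.injEq]
  by_cases hbc : c = a <;> simp [hbc]

theorem extPol_extPol (a b c f : κ) :
    extPol e j a b * extPol e j c f = extPol e j c f * extPol e j a b
      + (if b = c then extPol e j a f else 0) - if f = a then extPol e j c b else 0 := by
  have : ∀ k, extPol e j a b * (e (k, c) * j (k, f)) =
      e (k, c) * j (k, f) * extPol e j a b + (if b = c then e (k, a) * j (k, f) else 0)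
       - if f = a then e (k, c) * j (k, b) else 0 := fun k => by
    rw [← mul_assoc, h.extPol_e, add_mul, mul_assoc, mul_assoc, h.extPol_j]
    split_ifs <;> simp [mul_sub]; abel
  conv_lhs => rw [extPol.eq_def e j c f, Finset.mul_sum]
  simp only [this, Finset.sum_add_distrib, Finset.sum_sub_distrib, ← Finset.sum_mul]
  split_ifs <;> simp [extPol]

theorem numOp_e (v : ι × κ) : numOp e j * e v = e v * numOp e j + e v := by
  simp [numOp, Finset.sum_mul, Finset.mul_sum, h.ej_e, Finset.sum_add_distrib]

theorem numOp_j (v : ι × κ) : numOp e j * j v = j v * numOp e j - j v := by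
  simp [numOp, Finset.sum_mul, Finset.mul_sum, h.ej_j, Finset.sum_sub_distrib]

end IsFermiPair

namespace IsSuperWeyl

variable {x p : ι → κ → R} {e j : ι × κ → R} (h : IsSuperWeyl x p e j)
include h

theorem koszul_mul_self [Module ℚ R] : koszul x j * koszul x j = 0 :=
  h.fermi.sq_eq_zero (fun v => x v.1 v.2) (fun _ _ => h.xj _ _ _) fun _ _ => h.weyl.xx _ _ _ _

theorem commute_colPol_e (a b : κ) (v : ι × κ) : Commute (colPol x p a b) (e v) :=
  Commute.sum_left _ _ _ fun _ _ => (h.xe _ _ _).mul_left (h.pe _ _ _)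

theorem commute_colPol_j (a b : κ) (v : ι × κ) : Commute (colPol x p a b) (j v) :=
  Commute.sum_left _ _ _ fun _ _ => (h.xj _ _ _).mul_left (h.pj _ _ _)

theorem commute_lowOp_e (d : ℕ) (i : ι) (b : κ) (v : ι × κ) : Commute (lowOp d x p i b) (e v) := by
  refine Commute.sum_left _ _ _ fun c _ => (h.pe _ _ _).mul_left
    ((h.commute_colPol_e _ _ _).sub_left ?_)
  split_ifs
  exacts [Nat.cast_commute _ _, Commute.zero_left _]

theorem commute_lowOp_j (d : ℕ) (i : ι) (b : κ) (v : ι × κ) : Commute (lowOp d x p i b) (j v) := by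
  refine Commute.sum_left _ _ _ fun c _ => (h.pj _ _ _).mul_left
    ((h.commute_colPol_j _ _ _).sub_left ?_)
  split_ifs
  exacts [Nat.cast_commute _ _, Commute.zero_left _]

theorem commute_x_extPol (i : ι) (b a c : κ) : Commute (x i b) (extPol e j a c) :=
  Commute.sum_right _ _ _ fun _ _ => (h.xe _ _ _).mul_right (h.xj _ _ _)

theorem commute_colPol_extPol (a b c f : κ) : Commute (colPol x p a b) (extPol e j c f) :=
  Commute.sum_right _ _ _ fun _ _ =>
    (h.commute_colPol_e _ _ _).mul_right (h.commute_colPol_j _ _ _)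

theorem commute_lowOp_extPol (d : ℕ) (i : ι) (b c f : κ) :
    Commute (lowOp d x p i b) (extPol e j c f) :=
  Commute.sum_right _ _ _ fun _ _ =>
    (h.commute_lowOp_e _ _ _ _).mul_right (h.commute_lowOp_j _ _ _ _)

theorem commute_totPol_koszul (a c : κ) : Commute (totPol x p e j a c) (koszul x j) := by
  have : ∀ v : ι × κ, totPol x p e j a c * (x v.1 v.2 * j v) =
      x v.1 v.2 * j v * totPol x p e j a c
      + (if c = v.2 then x v.1 a * j v else 0) - if v.2 = a then x v.1 v.2 * j (v.1, c) else 0 := by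
    rintro ⟨k, b⟩
    have h1 : colPol x p a c * (x k b * j (k, b)) = x k b * j (k, b) * colPol x p a c
        + if c = b then x k a * j (k, b) else 0 := by
      rw [← mul_assoc, h.weyl.colPol_x, add_mul, mul_assoc, (h.commute_colPol_j _ _ _).eq,
        ← mul_assoc]
      split_ifs <;> simp
    have h2 : extPol e j a c * (x k b * j (k, b)) = x k b * j (k, b) * extPol e j a c
        - if b = a then x k b * j (k, c) else 0 := by
      rw [← mul_assoc, ← (h.commute_x_extPol _ _ _ _).eq, mul_assoc, h.fermi.extPol_j]
      split_ifs <;> simp [mul_sub, mul_assoc]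
    simp only [totPol, add_mul, mul_add, h1, h2]
    abel
  rw [Commute, SemiconjBy, koszul, Finset.mul_sum, Finset.sum_mul]
  simp only [this, Finset.sum_add_distrib, Finset.sum_sub_distrib, Fintype.sum_prod_type]
  simp

/-- The Laplacian of the Koszul differential and the homotopy `lowHtpy`. -/
theorem koszul_lowHtpy (d : ℕ) (a : κ) :
    koszul x j * lowHtpy d x p e a + lowHtpy d x p e a * koszul x j =
      ∑ c, colPol x p a c * (colPol x p c a - if c = a then (d : R) else 0)
      + ∑ c, (colPol x p c a - if c = a then (d : R) else 0) * extPol e j a c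
      + ∑ c, (∑ i, p i c * e (i, a)) * ∑ k, x k c * j (k, a) := by
  have h0 : lowHtpy d x p e a =
      ∑ v : ι × κ, (if v.2 = a then lowOp d x p v.1 v.2 else 0) * e v := by
    rw [lowHtpy, Fintype.sum_prod_type]
    simp
  have hcomm : ∀ v w : ι × κ, Commute (if v.2 = a then lowOp d x p v.1 v.2 else 0) (j w) := by
    intro v w
    split_ifs
    exacts [h.commute_lowOp_j _ _ _ _, Commute.zero_left _]
  rw [h0, koszul, h.fermi.anticomm_sum _ _ (fun _ _ => h.xe _ _ _) hcomm, add_assoc,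
    ← IsWeylPair.sum_x_lowOp]
  congr 1
  · rw [Fintype.sum_prod_type]
    simp
  · have key : ∀ i b k c, ((if b = a then lowOp d x p i b else 0) * x k c -
        x k c * (if b = a then lowOp d x p i b else 0)) * (e (i, b) * j (k, c)) =
        if b = a then (if i = k then
          (colPol x p c a - if c = a then (d : R) else 0) * (e (i, a) * j (k, c)) else 0)
        + (if a = c then (∑ f, p i f * x k f) * (e (i, a) * j (k, c)) else 0) else 0 := by
      intro i b k c
      by_cases hb : b = a
      · subst hb
        simp only [if_true, h.weyl.lowOp_x]
        split_ifs <;> noncomm_ring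
      · simp [hb]
    simp only [Fintype.sum_prod_type, key, Finset.sum_ite_eq', Finset.mem_univ, if_true,
      Finset.sum_add_distrib]
    congr 1
    · rw [Finset.sum_comm]
      refine Finset.sum_congr rfl fun c _ => ?_
      rw [extPol, Finset.mul_sum]
    · have : ∀ c, (∑ i, p i c * e (i, a)) * ∑ k, x k c * j (k, a) =
          ∑ k, ∑ i, p i c * x k c * (e (i, a) * j (k, a)) := fun c => by
        rw [Finset.sum_mul_sum, Finset.sum_comm]
        refine Finset.sum_congr rfl fun k _ => Finset.sum_congr rfl fun i _ => ?_
        rw [mul_assoc, ← mul_assoc (e _), ← (h.xe _ _ _).eq]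
        simp only [mul_assoc]
      trans ∑ k, ∑ i, (∑ f, p i f * x k f) * (e (i, a) * j (k, a))
      · refine Finset.sum_congr rfl fun k _ => ?_
        rw [Finset.sum_comm]
        exact Finset.sum_congr rfl fun i _ => by simp
      · simp only [this, Finset.sum_mul]
        conv_rhs => rw [Finset.sum_comm]
        refine Finset.sum_congr rfl fun k _ => ?_
        rw [Finset.sum_comm]

theorem totPol_totPol (a b c f : κ) :
    totPol x p e j a b * totPol x p e j c f = totPol x p e j c f * totPol x p e j a b
      + (if b = c then totPol x p e j a f else 0) - if f = a then totPol x p e j c b else 0 := by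
  simp only [totPol, add_mul, mul_add, h.weyl.colPol_colPol a b c f,
    h.fermi.extPol_extPol a b c f, (h.commute_colPol_extPol a b c f).eq,
    (h.commute_colPol_extPol c f a b).eq]
  split_ifs <;> noncomm_ring

theorem commute_totPol_lowHtpy (d : ℕ) (b a : κ) :
    Commute (totPol x p e j b b) (lowHtpy d x p e a) := by
  refine Commute.sum_right _ _ _ fun i _ => ?_
  have h1 : colPol x p b b * (lowOp d x p i a * e (i, a)) =
      lowOp d x p i a * e (i, a) * colPol x p b b
        - if b = a then lowOp d x p i a * e (i, a) else 0 := by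
    rw [← mul_assoc, h.weyl.colPol_lowOp, sub_mul, mul_assoc, (h.commute_colPol_e _ _ _).eq,
      ← mul_assoc]
    split_ifs <;> simp
  have h2 : extPol e j b b * (lowOp d x p i a * e (i, a)) =
      lowOp d x p i a * e (i, a) * extPol e j b b
        + if b = a then lowOp d x p i a * e (i, a) else 0 := by
    rw [← mul_assoc, ← (h.commute_lowOp_extPol _ _ _ _ _).eq, mul_assoc, h.fermi.extPol_e]
    split_ifs with hb
    · subst hb; simp [mul_add, mul_assoc]
    · simp [mul_assoc]
  rw [Commute, SemiconjBy, totPol, add_mul, h1, h2, mul_add]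
  abel

theorem commute_numOp_colPol (a b : κ) : Commute (numOp e j) (colPol x p a b) :=
  Commute.sum_left _ _ _ fun _ _ =>
    ((h.commute_colPol_e _ _ _).symm.mul_left (h.commute_colPol_j _ _ _).symm)

theorem numOp_koszul : numOp e j * koszul x j = koszul x j * numOp e j - koszul x j := by
  have hx : ∀ i a, Commute (x i a) (numOp e j) := fun i a =>
    Commute.sum_right _ _ _ fun _ _ => (h.xe _ _ _).mul_right (h.xj _ _ _)
  rw [koszul, Finset.mul_sum, Finset.sum_mul, ← Finset.sum_sub_distrib]
  refine Finset.sum_congr rfl fun v _ => ?_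
  rw [← mul_assoc, ← (hx _ _).eq, mul_assoc, h.fermi.numOp_j, mul_sub, mul_assoc]

theorem numOp_lowHtpy (d : ℕ) (a : κ) :
    numOp e j * lowHtpy d x p e a = lowHtpy d x p e a * numOp e j + lowHtpy d x p e a := by
  have hx : ∀ i a, Commute (lowOp d x p i a) (numOp e j) := fun i a =>
    Commute.sum_right _ _ _ fun _ _ => (h.commute_lowOp_e _ _ _ _).mul_right (h.commute_lowOp_j _ _ _ _)
  rw [lowHtpy, Finset.mul_sum, Finset.sum_mul, ← Finset.sum_add_distrib]
  refine Finset.sum_congr rfl fun v _ => ?_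
  rw [← mul_assoc, ← (hx _ _).eq, mul_assoc, h.fermi.numOp_e, mul_add, mul_assoc]

theorem commute_numOp_totPol (a b : κ) : Commute (numOp e j) (totPol x p e j a b) := by
  refine (h.commute_numOp_colPol a b).add_right (Commute.sum_right _ _ _ fun i _ => ?_)
  rw [Commute, SemiconjBy, ← mul_assoc, h.fermi.numOp_e, add_mul, mul_assoc, h.fermi.numOp_j]
  noncomm_ring

end IsSuperWeyl

end SuperWeyl

section Minors

open scoped Pointwise

variable {ι κ : Type*} [Fintype ι] [Fintype κ] [DecidableEq ι] [DecidableEq κ]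

/-- The generic matrix. -/
noncomputable def genMat (ι κ K : Type*) [CommRing K] : Matrix ι κ (MvPolynomial (ι × κ) K) :=
  Matrix.of fun i a => MvPolynomial.X (i, a)

/-- The ideal of maximal minors of a matrix. -/
def maxMinors {A : Type*} [CommRing A] (M : Matrix ι κ A) : Ideal A :=
  Ideal.span (Set.range fun g : κ → ι => (M.submatrix g id).det)

theorem minor_mem {A : Type*} [CommRing A] (M : Matrix ι κ A) (g : κ → ι) :
    (M.submatrix g id).det ∈ maxMinors M := Ideal.subset_span ⟨g, rfl⟩

theorem derivation_det {K A : Type*} [CommRing K] [CommRing A] [Algebra K A]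
    (D : Derivation K A A) (M : Matrix κ κ A) :
    D M.det = ∑ c, (M.updateCol c fun k => D (M k c)).det := by
  have hprod : ∀ (s : Finset κ) (f : κ → A),
      D (∏ c ∈ s, f c) = ∑ c ∈ s, ∏ b ∈ s, if b = c then D (f b) else f b := by
    intro s f
    induction s using Finset.induction_on with
    | empty => simp
    | insert a s ha ih =>
      rw [Finset.prod_insert ha, D.leibniz, ih, Finset.sum_insert ha, Finset.prod_insert ha]
      have h1 : ∏ b ∈ s, (if b = a then D (f b) else f b) = ∏ b ∈ s, f b :=
        Finset.prod_congr rfl fun b hb => if_neg fun h : b = a => ha (h ▸ hb)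
      have h2 : ∀ c ∈ s, ∏ b ∈ insert a s, (if b = c then D (f b) else f b) =
          f a * ∏ b ∈ s, (if b = c then D (f b) else f b) := fun c hc => by
        rw [Finset.prod_insert ha, if_neg fun h : a = c => ha (h ▸ hc)]
      rw [h1, Finset.sum_congr rfl h2, ← Finset.mul_sum, if_pos rfl]
      simp only [smul_eq_mul]
      ring
  simp only [Matrix.det_apply, map_sum]
  rw [Finset.sum_comm]
  refine Finset.sum_congr rfl fun s _ => ?_
  rw [map_zsmul_unit, hprod, Finset.smul_sum]
  refine Finset.sum_congr rfl fun c _ => ?_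
  congr 1
  refine Finset.prod_congr rfl fun b _ => ?_
  rw [Matrix.updateCol_apply]
  split_ifs with h
  · rw [h]
  · rfl

theorem derivation_det_row {K A : Type*} [CommRing K] [CommRing A] [Algebra K A]
    (D : Derivation K A A) (M : Matrix κ κ A) :
    D M.det = ∑ c, (M.updateRow c fun k => D (M c k)).det := by
  rw [← Matrix.det_transpose, derivation_det]
  refine Finset.sum_congr rfl fun c _ => ?_
  rw [← Matrix.det_transpose, Matrix.updateCol_transpose, Matrix.transpose_transpose]
  rfl

variable {K : Type*} [CommRing K]

/-- The derivation of polarization of columns. -/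
noncomputable def colDer (K : Type*) [CommRing K] (a b : κ) :
    Derivation K (MvPolynomial (ι × κ) K) (MvPolynomial (ι × κ) K) :=
  ∑ k : ι, (X (k, a) : MvPolynomial (ι × κ) K) • pderiv (k, b)

/-- The derivation of polarization of rows. -/
noncomputable def rowDer (K : Type*) [CommRing K] (k i : ι) :
    Derivation K (MvPolynomial (ι × κ) K) (MvPolynomial (ι × κ) K) :=
  ∑ b : κ, (X (k, b) : MvPolynomial (ι × κ) K) • pderiv (i, b)

theorem colDer_apply (a b : κ) (f : MvPolynomial (ι × κ) K) :
    colDer K a b f = ∑ k, X (k, a) * pderiv (k, b) f := by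
  have := congrFun (map_sum (Derivation.coeFnAddMonoidHom (R := K) (A := MvPolynomial (ι × κ) K)
    (M := MvPolynomial (ι × κ) K)) (fun k : ι => (X (k, a) : MvPolynomial (ι × κ) K) •
      pderiv (k, b)) Finset.univ) f
  rw [Finset.sum_apply] at this
  exact this

theorem rowDer_apply (k i : ι) (f : MvPolynomial (ι × κ) K) :
    rowDer K k i f = ∑ b, X (k, b) * pderiv (i, b) f := by
  have := congrFun (map_sum (Derivation.coeFnAddMonoidHom (R := K) (A := MvPolynomial (ι × κ) K)
    (M := MvPolynomial (ι × κ) K)) (fun b : κ => (X (k, b) : MvPolynomial (ι × κ) K) •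
      pderiv (i, b)) Finset.univ) f
  rw [Finset.sum_apply] at this
  exact this

theorem colDer_X (a b c : κ) (k : ι) :
    colDer K a b (X (k, c)) = if c = b then X (k, a) else 0 := by
  simp only [colDer_apply, pderiv_X, Pi.single_apply, Prod.mk.injEq]
  by_cases h : c = b <;> simp [h]

theorem rowDer_X (k i j : ι) (c : κ) :
    rowDer K k i (X (j, c)) = if j = i then X (k, c) else 0 := by
  simp only [rowDer_apply, pderiv_X, Pi.single_apply, Prod.mk.injEq]
  by_cases h : j = i <;> simp [h]

theorem colDer_minor (a b : κ) (g : κ → ι) :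
    colDer K a b ((genMat ι κ K).submatrix g id).det =
      if a = b then ((genMat ι κ K).submatrix g id).det else 0 := by
  rw [derivation_det, Finset.sum_eq_single b]
  · have : (fun k => colDer K a b (((genMat ι κ K).submatrix g id) k b)) =
        fun k => ((genMat ι κ K).submatrix g id) k a := by
      funext k
      simp [genMat, colDer_X]
    rw [this]
    split_ifs with h
    · subst h
      rw [Matrix.updateCol_eq_self]
    · refine Matrix.det_zero_of_column_eq h fun k => ?_
      simp [h]
  · intro c _ hc
    refine Matrix.det_eq_zero_of_column_eq_zero c fun k => ?_
    simp [genMat, colDer_X, hc]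
  · simp

theorem rowDer_minor_mem (k i : ι) (g : κ → ι) :
    rowDer K k i ((genMat ι κ K).submatrix g id).det ∈ maxMinors (genMat ι κ K) := by
  rw [derivation_det_row]
  refine Ideal.sum_mem _ fun c _ => ?_
  by_cases hc : g c = i
  · convert minor_mem (genMat ι κ K) (Function.update g c k) using 2
    ext r b : 2
    by_cases hr : r = c
    · subst hr
      simp [Matrix.updateRow_apply, genMat, rowDer_X, hc]
    · simp [Matrix.updateRow_apply, genMat, hr]
  · rw [Matrix.det_eq_zero_of_row_eq_zero c]
    · exact zero_mem _
    · simp [genMat, rowDer_X, hc]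

/-- Products of `d` maximal minors. -/
def minorProducts (ι κ K : Type*) [Fintype κ] [DecidableEq κ] [CommRing K] (d : ℕ) :
    Set (MvPolynomial (ι × κ) K) :=
  (Set.range fun g : κ → ι => ((genMat ι κ K).submatrix g id).det) ^ d

theorem maxMinors_pow (d : ℕ) :
    maxMinors (genMat ι κ K) ^ d = Ideal.span (minorProducts ι κ K d) :=
  Submodule.span_pow _ _

theorem colDer_minorProducts (a b : κ) (d : ℕ) {f : MvPolynomial (ι × κ) K}
    (hf : f ∈ minorProducts ι κ K d) :
    colDer K a b f = if a = b then (d : MvPolynomial (ι × κ) K) * f else 0 := by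
  induction d generalizing f with
  | zero =>
    rw [minorProducts, pow_zero, Set.mem_one] at hf
    subst hf
    simp
  | succ d ih =>
    rw [minorProducts, pow_succ] at hf
    obtain ⟨u, hu, _, ⟨g, rfl⟩, rfl⟩ := Set.mem_mul.mp hf
    simp only [Derivation.leibniz, colDer_minor, ih hu]
    split_ifs
    · push_cast; simp only [smul_eq_mul]; ring
    · simp

theorem derivation_mem_pow {A : Type*} [CommRing A] [Algebra K A] (D : Derivation K A A)
    (I : Ideal A) (hD : ∀ f ∈ I, D f ∈ I) (d : ℕ) {f : A} (hf : f ∈ I ^ d) : D f ∈ I ^ d := by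
  induction d generalizing f with
  | zero => simp
  | succ d ih =>
    rw [pow_succ] at hf ⊢
    induction hf using Submodule.mul_induction_on' with
    | mem_mul_mem u hu v hv =>
      rw [D.leibniz]
      exact add_mem (Submodule.mul_mem_mul hu (hD v hv))
        (by rw [smul_eq_mul, mul_comm v]; exact Ideal.mul_mem_mul (ih hu) hv)
    | add u _ v _ hu hv => rw [map_add]; exact add_mem hu hv

theorem derivation_mem_span {A : Type*} [CommRing A] [Algebra K A] (D : Derivation K A A)
    (s : Set A) (hD : ∀ f ∈ s, D f ∈ Ideal.span s) {f : A} (hf : f ∈ Ideal.span s) :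
    D f ∈ Ideal.span s := by
  induction hf using Submodule.span_induction with
  | mem f hf => exact hD f hf
  | zero => simp
  | add u v _ _ hu hv => rw [map_add]; exact add_mem hu hv
  | smul c u hu hu' =>
    rw [smul_eq_mul, D.leibniz]
    exact add_mem (Ideal.mul_mem_left _ _ hu') (by rw [smul_eq_mul]; exact Ideal.mul_mem_right _ _ hu)

theorem rowDer_mem (k i : ι) (d : ℕ) {f : MvPolynomial (ι × κ) K}
    (hf : f ∈ maxMinors (genMat ι κ K) ^ d) :
    rowDer K k i f ∈ maxMinors (genMat ι κ K) ^ d := by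
  refine derivation_mem_pow _ _ (fun f hf => derivation_mem_span _ _ ?_ hf) d hf
  rintro _ ⟨g, rfl⟩
  exact rowDer_minor_mem k i g

theorem minorProducts_subset (d : ℕ) :
    minorProducts ι κ K d ⊆
      ((maxMinors (genMat ι κ K) ^ d : Ideal (MvPolynomial (ι × κ) K)) : Set _) := by
  rw [maxMinors_pow]; exact Ideal.subset_span

end Minors

section Twisted

open scoped Pointwise

variable {ι κ : Type*} [Fintype ι] [Fintype κ] [DecidableEq ι] [DecidableEq κ]
variable {K : Type*} [CommRing K] {N : Type*} [AddCommGroup N] [Module K N]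
  [Module (MvPolynomial (ι × κ) K) N] [IsScalarTower K (MvPolynomial (ι × κ) K) N]

/-- Multiplication by the variables on a module. -/
noncomputable def varMul (K N : Type*) [CommRing K] [AddCommGroup N] [Module K N]
    [Module (MvPolynomial (ι × κ) K) N] [IsScalarTower K (MvPolynomial (ι × κ) K) N] 
    (i : ι) (a : κ) : Module.End K N :=
  Algebra.lsmul K K N (X (i, a) : MvPolynomial (ι × κ) K)

theorem varMul_apply (i : ι) (a : κ) (h : N) :
    varMul K N i a h = (X (i, a) : MvPolynomial (ι × κ) K) • h := rfl

/-- Operators on a module over the polynomial ring extending the partial derivatives. -/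
def IsPartial (p : ι → κ → Module.End K N) : Prop :=
  ∀ i a (f : MvPolynomial (ι × κ) K) (h : N), p i a (f • h) = pderiv (i, a) f • h + f • p i a h

variable {p : ι → κ → Module.End K N} (hp : IsPartial p)
include hp

theorem IsPartial.colPol_smul (a b : κ) (f : MvPolynomial (ι × κ) K) (h : N) :
    colPol (varMul K N) p a b (f • h) = colDer K a b f • h + f • colPol (varMul K N) p a b h := by
  simp only [colPol, LinearMap.sum_apply, Module.End.mul_apply, varMul_apply, hp _ _ _ _,
    colDer_apply, Finset.sum_smul, Finset.smul_sum, ← Finset.sum_add_distrib, smul_add]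
  refine Finset.sum_congr rfl fun k _ => ?_
  rw [smul_smul, smul_comm f]

theorem IsPartial.rowPol_smul (k i : ι) (f : MvPolynomial (ι × κ) K) (h : N) :
    rowPol (varMul K N) p k i (f • h) = rowDer K k i f • h + f • rowPol (varMul K N) p k i h := by
  simp only [rowPol, LinearMap.sum_apply, Module.End.mul_apply, varMul_apply, hp _ _ _ _,
    rowDer_apply, Finset.sum_smul, Finset.smul_sum, ← Finset.sum_add_distrib, smul_add]
  refine Finset.sum_congr rfl fun k _ => ?_
  rw [smul_smul, smul_comm f]

/-- The submodule `I ^ d • N` for the ideal `I` of maximal minors. -/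
noncomputable def minorSub (K N : Type*) [CommRing K] [AddCommGroup N] [Module K N]
    [Module (MvPolynomial (ι × κ) K) N] (d : ℕ) : Submodule (MvPolynomial (ι × κ) K) N :=
  maxMinors (genMat ι κ K) ^ d • (⊤ : Submodule (MvPolynomial (ι × κ) K) N)

omit hp in
theorem smul_mem_minorSub (d : ℕ) {f : MvPolynomial (ι × κ) K}
    (hf : f ∈ maxMinors (genMat ι κ K) ^ d) (h : N) : f • h ∈ minorSub (ι := ι) (κ := κ) K N d :=
  Submodule.smul_mem_smul hf trivial

omit hp in
theorem minorSub_induction (d : ℕ) {P : N → Prop} (hz : P 0)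
    (hs : ∀ f ∈ minorProducts ι κ K d, ∀ h, P (f • h)) (hadd : ∀ u v, P u → P v → P (u + v))
    {h : N} (hh : h ∈ minorSub (ι := ι) (κ := κ) K N d) : P h := by
  have h0 : ∀ f ∈ maxMinors (genMat ι κ K) ^ d, ∀ h, P (f • h) := by
    intro f hf
    rw [maxMinors_pow] at hf
    induction hf using Submodule.span_induction with
    | mem f hf => exact hs f hf
    | zero => intro h; rwa [zero_smul]
    | add u v _ _ hu hv => intro h; rw [add_smul]; exact hadd _ _ (hu h) (hv h)
    | smul c u _ hu => intro h; rw [smul_eq_mul, mul_comm, mul_smul]; exact hu _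
  exact Submodule.smul_induction_on hh (fun f hf h _ => h0 f hf h) hadd

theorem IsPartial.colPol_mem (a b : κ) (d : ℕ) {h : N}
    (hh : h ∈ minorSub (ι := ι) (κ := κ) K N d) :
    colPol (varMul K N) p a b h ∈ minorSub (ι := ι) (κ := κ) K N d := by
  refine minorSub_induction (P := fun h => colPol (varMul K N) p a b h ∈ minorSub (ι := ι) (κ := κ) K N d) d
    ?_ (fun f hf h => ?_) (fun u v hu hv => ?_) hh
  · rw [map_zero]; exact zero_mem _
  · rw [hp.colPol_smul, colDer_minorProducts a b d hf]
    refine add_mem (smul_mem_minorSub d ?_ _) (smul_mem_minorSub d (minorProducts_subset d hf) _)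
    split_ifs
    exacts [Ideal.mul_mem_left _ _ (minorProducts_subset d hf), zero_mem _]
  · rw [map_add]; exact add_mem hu hv

theorem IsPartial.rowPol_mem (k i : ι) (d : ℕ) {h : N}
    (hh : h ∈ minorSub (ι := ι) (κ := κ) K N d) :
    rowPol (varMul K N) p k i h ∈ minorSub (ι := ι) (κ := κ) K N d := by
  refine minorSub_induction (P := fun h => rowPol (varMul K N) p k i h ∈ minorSub (ι := ι) (κ := κ) K N d) d
    ?_ (fun f hf h => ?_) (fun u v hu hv => ?_) hh
  · rw [map_zero]; exact zero_mem _
  · rw [hp.rowPol_smul]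
    exact add_mem (smul_mem_minorSub d (rowDer_mem k i d (minorProducts_subset d hf)) _)
      (smul_mem_minorSub d (minorProducts_subset d hf) _)
  · rw [map_add]; exact add_mem hu hv

theorem IsPartial.lowOp_mem (i : ι) (a : κ) (d : ℕ) {h : N}
    (hh : h ∈ minorSub (ι := ι) (κ := κ) K N d) :
    lowOp d (varMul K N) p i a h ∈ minorSub (ι := ι) (κ := κ) K N d := by
  refine minorSub_induction (P := fun h => lowOp d (varMul K N) p i a h ∈ minorSub (ι := ι) (κ := κ) K N d) d
    ?_ (fun f hf h => ?_) (fun u v hu hv => ?_) hh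
  · rw [map_zero]; exact zero_mem _
  · have h1 : ∀ b, (colPol (varMul K N) p b a - if b = a then (d : Module.End K N) else 0) (f • h) =
        f • colPol (varMul K N) p b a h := fun b => by
      rw [LinearMap.sub_apply, hp.colPol_smul, colDer_minorProducts b a d hf]
      split_ifs
      · simp [← nsmul_eq_mul, smul_assoc]
      · simp
    simp only [lowOp, LinearMap.sum_apply, Module.End.mul_apply, h1, hp _ _ _ _,
      Finset.sum_add_distrib]
    refine add_mem ?_ (sum_mem fun b _ => smul_mem_minorSub d (minorProducts_subset d hf) _)
    have h2 : ∑ b, pderiv (i, b) f • colPol (varMul K N) p b a h =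
        ∑ k, rowDer K k i f • p k a h := by
      simp only [colPol, LinearMap.sum_apply, Module.End.mul_apply, varMul_apply,
        Finset.smul_sum, smul_smul, rowDer_apply, Finset.sum_smul]
      rw [Finset.sum_comm]
      simp only [mul_comm]
    rw [h2]
    exact sum_mem fun k _ => smul_mem_minorSub d (rowDer_mem k i d (minorProducts_subset d hf)) _
  · rw [map_add]; exact add_mem hu hv

theorem IsPartial.isWeylPair (hpp : ∀ i a k b, p i a * p k b = p k b * p i a) :
    IsWeylPair (varMul K N) p where
  xx i a k b := by
    ext h
    simp only [Module.End.mul_apply, varMul_apply]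
    rw [smul_comm]
  pp := hpp
  px i a k b := by
    ext h
    simp only [Module.End.mul_apply, LinearMap.add_apply, varMul_apply, hp _ _ _ _, pderiv_X,
      Pi.single_apply, Prod.mk.injEq]
    rw [add_comm]
    by_cases hh : i = k ∧ a = b
    · simp [hh]
    · rw [if_neg hh, if_neg (fun h => hh ⟨h.1.symm, h.2.symm⟩)]; simp

end Twisted

section Fischer

variable {σ : Type*} [Fintype σ] [DecidableEq σ]

/-- The factorial of a multi-index. -/
def multiFact (α : σ →₀ ℕ) : ℕ := ∏ v, (α v).factorial

theorem multiFact_pos (α : σ →₀ ℕ) : 0 < multiFact α :=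
  Finset.prod_pos fun _ _ => Nat.factorial_pos _

theorem multiFact_add_single (α : σ →₀ ℕ) (v : σ) :
    multiFact (α + Finsupp.single v 1) = multiFact α * (α v + 1) := by
  simp only [multiFact]
  rw [← Finset.mul_prod_erase _ _ (Finset.mem_univ v),
    ← Finset.mul_prod_erase Finset.univ (fun v => (α v).factorial) (Finset.mem_univ v)]
  have : ∀ u ∈ Finset.univ.erase v,
      ((α + Finsupp.single v 1 : σ →₀ ℕ) u).factorial = (α u).factorial := fun u hu => by
    have : v ≠ u := (Finset.ne_of_mem_erase hu).symm
    simp [this]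
  rw [Finset.prod_congr rfl this]
  simp [Nat.factorial_succ]
  ring

/-- The Fischer inner product on polynomials. -/
noncomputable def fischer (σ : Type*) [Fintype σ] : LinearMap.BilinForm ℚ (MvPolynomial σ ℚ) :=
  (basisMonomials σ ℚ).constr ℚ fun α => (multiFact α : ℚ) • lcoeff ℚ α

theorem fischer_monomial (α : σ →₀ ℕ) (c : ℚ) (g : MvPolynomial σ ℚ) :
    fischer σ (monomial α c) g = multiFact α * c * coeff α g := by
  have h1 : monomial α c = c • (basisMonomials σ ℚ α) := by simp [smul_monomial]
  rw [h1, map_smul, fischer, Module.Basis.constr_basis]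
  simp [lcoeff]
  ring

theorem fischer_eq_sum (f g : MvPolynomial σ ℚ) :
    fischer σ f g = ∑ α ∈ f.support, multiFact α * coeff α f * coeff α g := by
  conv_lhs => rw [f.as_sum]
  simp only [map_sum, LinearMap.sum_apply, fischer_monomial]

theorem fischer_comm (f g : MvPolynomial σ ℚ) : fischer σ f g = fischer σ g f := by
  have h : ∀ f g : MvPolynomial σ ℚ, fischer σ f g =
      ∑ α ∈ f.support ∪ g.support, multiFact α * coeff α f * coeff α g := fun f g => by
    rw [fischer_eq_sum]
    refine Finset.sum_subset Finset.subset_union_left fun α _ h => ?_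
    rw [notMem_support_iff.mp h]
    ring
  rw [h f g, h g f, Finset.union_comm]
  exact Finset.sum_congr rfl fun α _ => by ring

theorem fischer_self_nonneg (f : MvPolynomial σ ℚ) : 0 ≤ fischer σ f f := by
  rw [fischer_eq_sum]
  exact Finset.sum_nonneg fun α _ => by
    rw [mul_assoc]; exact mul_nonneg (Nat.cast_nonneg _) (mul_self_nonneg _)

theorem fischer_self_eq_zero {f : MvPolynomial σ ℚ} (h : fischer σ f f = 0) : f = 0 := by
  by_contra hf
  refine absurd h (ne_of_gt ?_)
  rw [fischer_eq_sum]
  refine Finset.sum_pos (fun α hα => ?_) (support_nonempty.mpr hf)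
  rw [mul_assoc]
  exact mul_pos (Nat.cast_pos.mpr (multiFact_pos α)) (mul_self_pos.mpr (mem_support_iff.mp hα))

theorem fischer_X_mul (v : σ) (f g : MvPolynomial σ ℚ) :
    fischer σ (X v * f) g = fischer σ f (pderiv v g) := by
  induction f using MvPolynomial.induction_on' with
  | monomial α c =>
    rw [X, monomial_mul, one_mul, fischer_monomial, fischer_monomial, coeff_pderiv,
      add_comm (Finsupp.single v 1), multiFact_add_single]
    push_cast
    ring
  | add p q hp hq => rw [mul_add, map_add, map_add, LinearMap.add_apply, LinearMap.add_apply, hp, hq]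

/-- The Fischer inner product on the Fock space of polynomials. -/
noncomputable def fockForm (σ : Type*) [Fintype σ] :
    LinearMap.BilinForm ℚ (Finset σ → MvPolynomial σ ℚ) :=
  ∑ A, (fischer σ).compl₁₂ (LinearMap.proj A) (LinearMap.proj A)

theorem fockForm_apply (f g : Finset σ → MvPolynomial σ ℚ) :
    fockForm σ f g = ∑ A, fischer σ (f A) (g A) := by
  simp [fockForm, LinearMap.sum_apply]

theorem fockForm_comm (f g : Finset σ → MvPolynomial σ ℚ) :
    fockForm σ f g = fockForm σ g f := by
  simp only [fockForm_apply, fischer_comm]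

theorem fockForm_self_nonneg (f : Finset σ → MvPolynomial σ ℚ) : 0 ≤ fockForm σ f f := by
  rw [fockForm_apply]; exact Finset.sum_nonneg fun A _ => fischer_self_nonneg _

theorem fockForm_self_eq_zero {f : Finset σ → MvPolynomial σ ℚ} (h : fockForm σ f f = 0) :
    f = 0 := by
  rw [fockForm_apply, Finset.sum_eq_zero_iff_of_nonneg fun A _ => fischer_self_nonneg _] at h
  exact funext fun A => fischer_self_eq_zero (h A (Finset.mem_univ _))

/-- Adjoint operators for the Fischer inner product. -/
def FockAdj (a b : Module.End ℚ (Finset σ → MvPolynomial σ ℚ)) : Prop :=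
  ∀ f g, fockForm σ (a f) g = fockForm σ f (b g)

namespace FockAdj

variable {a b a' b' : Module.End ℚ (Finset σ → MvPolynomial σ ℚ)}

theorem symm (h : FockAdj a b) : FockAdj b a := fun f g => by
  rw [fockForm_comm, ← h, fockForm_comm]

theorem mul (h : FockAdj a b) (h' : FockAdj a' b') : FockAdj (a * a') (b' * b) := fun f g => by
  rw [Module.End.mul_apply, Module.End.mul_apply, h, h']

theorem add (h : FockAdj a b) (h' : FockAdj a' b') : FockAdj (a + a') (b + b') := fun f g => by
  simp only [LinearMap.add_apply, map_add, h f g, h' f g]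

theorem sum {τ : Type*} {s : Finset τ} {a b : τ → Module.End ℚ (Finset σ → MvPolynomial σ ℚ)}
    (h : ∀ t, FockAdj (a t) (b t)) : FockAdj (∑ t ∈ s, a t) (∑ t ∈ s, b t) := fun f g => by
  simp only [LinearMap.sum_apply, map_sum]
  exact Finset.sum_congr rfl fun t _ => h t f g

end FockAdj

theorem fockAdj_fockE (v : σ) :
    FockAdj (fockE ℚ (V := MvPolynomial σ ℚ) v) (fockI ℚ v) := fun f g => by
  simp only [fockForm_apply, fockE_apply, fockI_apply]
  rw [← Finset.sum_filter_add_sum_filter_not Finset.univ (v ∈ ·),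
    ← Finset.sum_filter_add_sum_filter_not Finset.univ (v ∈ ·) (fun A => fischer σ (f A) _)]
  have h1 : ∑ A : Finset σ with v ∉ A, fischer σ (if v ∈ A then fockSign v A • f (A.erase v) else 0)
      (g A) = 0 := Finset.sum_eq_zero fun A hA => by simp [(Finset.mem_filter.mp hA).2]
  have h2 : ∑ A : Finset σ with v ∈ A, fischer σ (f A)
      (if v ∈ A then 0 else fockSign v A • g (insert v A)) = 0 :=
    Finset.sum_eq_zero fun A hA => by simp [(Finset.mem_filter.mp hA).2]
  rw [h1, h2, add_zero, zero_add]
  refine Finset.sum_bij' (fun A _ => A.erase v) (fun A _ => insert v A) ?_ ?_ ?_ ?_ ?_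
  · simp
  · simp
  · intro A hA; exact Finset.insert_erase (Finset.mem_filter.mp hA).2
  · intro A hA; exact Finset.erase_insert (Finset.mem_filter.mp hA).2
  · intro A hA
    have hA' := (Finset.mem_filter.mp hA).2
    simp [hA', fockSign_erase hA', Finset.insert_erase hA', ← Int.cast_smul_eq_zsmul ℚ]

theorem fockAdj_fockMap {a b : Module.End ℚ (MvPolynomial σ ℚ)}
    (h : ∀ f g, fischer σ (a f) g = fischer σ f (b g)) : 
    FockAdj (fockMap ℚ a) (fockMap ℚ b) := fun f g => by
  simp only [fockForm_apply, fockMap_apply, h]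

end Fischer

section ColDeg

variable {ι κ : Type*} [Fintype ι] [Fintype κ] [DecidableEq ι] [DecidableEq κ]

/-- The degree of a monomial in the variables of a column. -/
def colDeg (a : κ) (α : ι × κ →₀ ℕ) : ℕ := ∑ i, α (i, a)

theorem colDeg_add (a : κ) (α β : ι × κ →₀ ℕ) :
    colDeg a (α + β) = colDeg a α + colDeg a β := by
  simp [colDeg, Finset.sum_add_distrib]

variable {K : Type*} [CommRing K]

/-- The ideal of polynomials of degree at least `k` in the variables of a column. -/
def colIdeal (ι K : Type*) [Fintype ι] [CommRing K] (a : κ) (k : ℕ) :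
    Ideal (MvPolynomial (ι × κ) K) where
  carrier := {f | ∀ α, coeff α f ≠ 0 → k ≤ colDeg a α}
  zero_mem' α h := absurd (coeff_zero α) h
  add_mem' {f g} hf hg α h := by
    by_contra hk
    exact h (by rw [coeff_add, not_not.mp (mt (hf α) hk), not_not.mp (mt (hg α) hk), add_zero])
  smul_mem' c f hf α h := by
    classical
    rw [smul_eq_mul, coeff_mul] at h
    obtain ⟨⟨β, γ⟩, hβ, hne⟩ := Finset.exists_ne_zero_of_sum_ne_zero h
    rw [← Finset.HasAntidiagonal.mem_antidiagonal.mp hβ, colDeg_add]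
    exact le_add_left (hf γ (right_ne_zero_of_mul hne))

theorem mul_mem_colIdeal (a : κ) {k l : ℕ} {f g : MvPolynomial (ι × κ) K}
    (hf : f ∈ colIdeal ι K a k) (hg : g ∈ colIdeal ι K a l) : f * g ∈ colIdeal ι K a (k + l) := by
  intro α h
  rw [coeff_mul] at h
  obtain ⟨⟨β, γ⟩, hβ, hne⟩ := Finset.exists_ne_zero_of_sum_ne_zero h
  rw [← Finset.HasAntidiagonal.mem_antidiagonal.mp hβ, colDeg_add]
  exact add_le_add (hf β (left_ne_zero_of_mul hne)) (hg γ (right_ne_zero_of_mul hne))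

theorem maxMinors_le_colIdeal (a : κ) : maxMinors (genMat ι κ K) ≤ colIdeal ι K a 1 := by
  refine Ideal.span_le.mpr ?_
  rintro _ ⟨g, rfl⟩
  simp only [SetLike.mem_coe]
  rw [Matrix.det_apply]
  refine Ideal.sum_mem _ fun s _ => ?_
  rw [Units.smul_def, zsmul_eq_mul]
  refine Ideal.mul_mem_left _ _ ?_
  rw [← Finset.mul_prod_erase _ _ (Finset.mem_univ a)]
  refine Ideal.mul_mem_right _ _ ?_
  intro α h
  simp only [Matrix.submatrix_apply, genMat, Matrix.of_apply, id, coeff_X] at h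
  obtain rfl := (ite_ne_right_iff.mp h).1
  refine le_trans ?_ (Finset.single_le_sum (f := fun i => (Finsupp.single (g (s a), a) 1) (i, a))
    (fun _ _ => Nat.zero_le _) (Finset.mem_univ (g (s a))))
  simp

theorem maxMinors_pow_le_colIdeal (a : κ) (d : ℕ) :
    maxMinors (genMat ι κ K) ^ d ≤ colIdeal ι K a d := by
  induction d with
  | zero => exact fun f _ α _ => Nat.zero_le _
  | succ d ih =>
    rw [pow_succ]
    exact Ideal.mul_le.mpr fun f hf g hg =>
      mul_mem_colIdeal a (ih hf) (maxMinors_le_colIdeal a hg)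

end ColDeg

section FockSub

variable {σ : Type*} [Fintype σ] [DecidableEq σ] {k : Type*} [Ring k] {V : Type*}
  [AddCommGroup V] [Module k V]

/-- Functions with values in a submodule. -/
def fockSub (σ : Type*) (M : Submodule k V) : Submodule k (Finset σ → V) :=
  Submodule.pi Set.univ fun _ => M

theorem mem_fockSub {M : Submodule k V} {f : Finset σ → V} : f ∈ fockSub σ M ↔ ∀ A, f A ∈ M := by
  simp [fockSub, Submodule.mem_pi]

theorem fockMap_mem {M : Submodule k V} {a : Module.End k V} (ha : ∀ v ∈ M, a v ∈ M)
    {f : Finset σ → V} (hf : f ∈ fockSub σ M) : fockMap k a f ∈ fockSub σ M :=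
  mem_fockSub.mpr fun A => ha _ (mem_fockSub.mp hf A)

theorem fockE_mem {M : Submodule k V} (v : σ) {f : Finset σ → V} (hf : f ∈ fockSub σ M) :
    fockE k v f ∈ fockSub σ M :=
  mem_fockSub.mpr fun A => by
    rw [fockE_apply]
    split_ifs
    exacts [zsmul_mem (mem_fockSub.mp hf _) _, zero_mem _]

theorem fockI_mem {M : Submodule k V} (v : σ) {f : Finset σ → V} (hf : f ∈ fockSub σ M) :
    fockI k v f ∈ fockSub σ M :=
  mem_fockSub.mpr fun A => by
    rw [fockI_apply]
    split_ifs
    exacts [zero_mem _, zsmul_mem (mem_fockSub.mp hf _) _]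

theorem fockE_fockI_apply (v : σ) (f : Finset σ → V) (A : Finset σ) :
    fockE k v (fockI k v f) A = if v ∈ A then f A else 0 := by
  rw [fockE_apply]
  split_ifs with h
  · simp [fockI_apply, smul_smul, fockSign_erase h, fockSign_mul_self, h]
  · rfl

/-- Restriction of a function to the sets of size `q` relative to a counting function. -/
def fockCut (k : Type*) [Ring k] {V : Type*} [AddCommGroup V] [Module k V] (s : Set σ)
    [DecidablePred (· ∈ s)] (q : ℤ) :
    Module.End k (Finset σ → V) where
  toFun f A := if ((A.filter (· ∈ s)).card : ℤ) = q then f A else 0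
  map_add' f g := by ext A; by_cases h : ((A.filter (· ∈ s)).card : ℤ) = q <;> simp [h]
  map_smul' c f := by ext A; by_cases h : ((A.filter (· ∈ s)).card : ℤ) = q <;> simp [h]

variable (s : Set σ) [DecidablePred (· ∈ s)]

theorem fockCut_apply (q : ℤ) (f : Finset σ → V) (A : Finset σ) :
    fockCut k s q f A = if ((A.filter (· ∈ s)).card : ℤ) = q then f A else 0 := rfl

theorem fockCut_mem (q : ℤ) {M : Submodule k V} {f : Finset σ → V} (hf : f ∈ fockSub σ M) :
    fockCut k s q f ∈ fockSub σ M :=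
  mem_fockSub.mpr fun A => by
    rw [fockCut_apply]
    split_ifs
    exacts [mem_fockSub.mp hf A, zero_mem _]

theorem fockCut_fockMap (q : ℤ) (a : Module.End k V) (f : Finset σ → V) :
    fockCut k s q (fockMap k a f) = fockMap k a (fockCut k s q f) := by
  funext A
  simp only [fockCut_apply, fockMap_apply]
  split_ifs <;> simp

theorem fockCut_fockI (q : ℤ) (v : σ) (f : Finset σ → V) :
    fockCut k s q (fockI k v f) = fockI k v (fockCut k s (if v ∈ s then q + 1 else q) f) := by
  funext A
  simp only [fockCut_apply, fockI_apply, Finset.filter_insert]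
  by_cases hv : v ∈ A
  · simp [hv]
  · by_cases hs : v ∈ s
    · have : v ∉ A.filter (· ∈ s) := fun h => hv (Finset.mem_filter.mp h).1
      simp [hv, hs, this]
    · simp [hv, hs]

theorem fockCut_fockE (q : ℤ) (v : σ) (f : Finset σ → V) :
    fockCut k s q (fockE k v f) = fockE k v (fockCut k s (if v ∈ s then q - 1 else q) f) := by
  funext A
  simp only [fockCut_apply, fockE_apply, Finset.filter_erase]
  by_cases hv : v ∈ A
  · by_cases hs : v ∈ s
    · have : v ∈ A.filter (· ∈ s) := Finset.mem_filter.mpr ⟨hv, hs⟩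
      have h1 : (((A.filter (· ∈ s)).card - 1 : ℕ) : ℤ) = (A.filter (· ∈ s)).card - 1 := by
        rw [Nat.cast_sub (Finset.card_pos.mpr ⟨v, this⟩), Nat.cast_one]
      simp [hv, hs, h1]
    · simp [hv, hs]
  · simp [hv]

theorem fockCut_eq_zero {f : Finset σ → V} (h : ∀ q : ℕ, fockCut k s q f = 0) : f = 0 := by
  funext A
  simpa [fockCut_apply] using congrFun (h (A.filter (· ∈ s)).card) A

theorem sum_fockE_fockI_cut (q : ℤ) (f : Finset σ → V) :
    ∑ v with v ∈ s, fockE k v (fockI k v (fockCut k s q f)) = q • fockCut k s q f := by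
  funext A
  simp only [Finset.sum_apply, fockE_fockI_apply, Pi.smul_apply, Finset.sum_ite, Finset.sum_const_zero,
    add_zero, Finset.sum_const]
  rw [Finset.filter_filter]
  by_cases h : ((A.filter (· ∈ s)).card : ℤ) = q
  · subst h
    rw [natCast_zsmul]
    congr 2
    ext v
    simp [and_comm]
  · simp [fockCut_apply, h]

end FockSub

section FockLift

variable {ι κ : Type*} [Fintype ι] [Fintype κ] [DecidableEq ι] [DecidableEq κ]
variable {k : Type*} [Ring k] {V : Type*} [AddCommGroup V] [Module k V]

/-- Pointwise action of a family of operators on Fock space. -/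
def fockLift (k : Type*) [Ring k] {V : Type*} [AddCommGroup V] [Module k V]
    (σ : Type*) [Fintype σ] [DecidableEq σ] (x : ι → κ → Module.End k V) (i : ι) (a : κ) :
    Module.End k (Finset σ → V) := fockMap k (x i a)

theorem colPol_fockLift (x p : ι → κ → Module.End k V) (a b : κ) :
    colPol (fockLift k (ι × κ) x) (fockLift k (ι × κ) p) a b = fockMap k (colPol x p a b) := by
  simp [colPol, fockLift]

theorem lowOp_fockLift (d : ℕ) (x p : ι → κ → Module.End k V) (i : ι) (a : κ) :
    lowOp d (fockLift k (ι × κ) x) (fockLift k (ι × κ) p) i a = fockMap k (lowOp d x p i a) := by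
  simp only [lowOp, colPol_fockLift]
  rw [map_sum]
  refine Finset.sum_congr rfl fun b _ => ?_
  rw [map_mul, map_sub]
  congr 2
  split_ifs <;> simp

theorem IsWeylPair.fockLift {x p : ι → κ → Module.End k V} (h : IsWeylPair x p) :
    IsSuperWeyl (fockLift k (ι × κ) x) (fockLift k (ι × κ) p) (fockE k) (fockI k) where
  weyl :=
    { xx := fun i a j b => by simp only [_root_.fockLift, ← map_mul, h.xx i a j b]
      pp := fun i a j b => by simp only [_root_.fockLift, ← map_mul, h.pp i a j b]
      px := fun i a j b => by
        simp only [_root_.fockLift, ← map_mul, h.px i a j b, map_add]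
        congr 1
        split_ifs <;> simp }
  fermi := isFermiPair_fock k
  xe i a v := commute_fockMap_fockE k _ v
  xj i a v := commute_fockMap_fockI k _ v
  pe i a v := commute_fockMap_fockE k _ v
  pj i a v := commute_fockMap_fockI k _ v

end FockLift

section Harmonic

variable {ι κ : Type*} [Fintype ι] [Fintype κ] [DecidableEq ι] [DecidableEq κ]

/-- Multiplication by variables on the Fock space of polynomials. -/
noncomputable abbrev fX (i : ι) (a : κ) : Module.End ℚ (Finset (ι × κ) → MvPolynomial (ι × κ) ℚ) :=
  fockLift ℚ (ι × κ) (varMul ℚ (MvPolynomial (ι × κ) ℚ)) i a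

/-- Partial derivatives as linear operators. -/
noncomputable def polyDer (K : Type*) [CommRing K] (i : ι) (a : κ) :
    Module.End K (MvPolynomial (ι × κ) K) :=
  (pderiv (i, a)).toLinearMap

theorem polyDer_apply {K : Type*} [CommRing K] (i : ι) (a : κ) (f : MvPolynomial (ι × κ) K) :
    polyDer K i a f = pderiv (i, a) f := rfl

/-- Partial derivatives on the Fock space of polynomials. -/
noncomputable abbrev fP (i : ι) (a : κ) : Module.End ℚ (Finset (ι × κ) → MvPolynomial (ι × κ) ℚ) :=
  fockLift ℚ (ι × κ) (polyDer ℚ) i a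

theorem isPartial_polyDer (K : Type*) [CommRing K] :
    IsPartial (ι := ι) (κ := κ) (polyDer K) := fun i a f h => by
  simp only [polyDer_apply, smul_eq_mul, Derivation.leibniz]
  ring

theorem isWeylPair_polyDer (K : Type*) [CommRing K] :
    IsWeylPair (ι := ι) (κ := κ) (varMul K (MvPolynomial (ι × κ) K)) (polyDer K) := by
  refine (isPartial_polyDer K).isWeylPair fun i a k b => LinearMap.ext fun f => ?_
  ext α
  simp only [polyDer_apply, Module.End.mul_apply, coeff_pderiv, Finsupp.add_apply, Nat.cast_add]
  rw [add_right_comm]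
  by_cases h : (i, a) = (k, b)
  · rw [h]
  · rw [Finsupp.single_eq_of_ne' h, Finsupp.single_eq_of_ne h]
    simp only [Nat.cast_zero, add_zero]
    ring

theorem superWeyl_poly : IsSuperWeyl (R := Module.End ℚ (Finset (ι × κ) → MvPolynomial (ι × κ) ℚ))
    fX fP (fockE ℚ) (fockI ℚ) := (isWeylPair_polyDer ℚ).fockLift

/-- The `d`-th power of the ideal of maximal minors as a rational vector space. -/
noncomputable def minorQ (ι κ : Type*) [Fintype ι] [Fintype κ] [DecidableEq ι] [DecidableEq κ]
    (d : ℕ) : Submodule ℚ (MvPolynomial (ι × κ) ℚ) :=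
  (minorSub (ι := ι) (κ := κ) ℚ (MvPolynomial (ι × κ) ℚ) d).restrictScalars ℚ

theorem mem_minorQ {d : ℕ} {f : MvPolynomial (ι × κ) ℚ} :
    f ∈ minorQ ι κ d ↔ f ∈ maxMinors (genMat ι κ ℚ) ^ d := by
  rw [minorQ, Submodule.restrictScalars_mem, minorSub, smul_eq_mul, Ideal.mul_top]

/-- The submodule of Fock space of functions with values in the `d`-th power of the ideal of
maximal minors. -/
noncomputable def fockMinor (ι κ : Type*) [Fintype ι] [Fintype κ] [DecidableEq ι] [DecidableEq κ]
    (d : ℕ) : Submodule ℚ (Finset (ι × κ) → MvPolynomial (ι × κ) ℚ) :=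
  fockSub (ι × κ) (minorQ ι κ d)

local notation "𝓓" => koszul fX (fockI ℚ)
local notation "𝓣" => totPol fX fP (fockE ℚ) (fockI ℚ)
local notation "𝓗" => fun d => lowHtpy d fX fP (fockE ℚ)
local notation "𝓐" => extPol (R := Module.End ℚ (Finset (ι × κ) → MvPolynomial (ι × κ) ℚ)) (fockE ℚ) (fockI ℚ)
local notation "𝓒" => colPol fX fP

theorem fX_mem (d : ℕ) (i : ι) (a : κ) {f : Finset (ι × κ) → MvPolynomial (ι × κ) ℚ}
    (hf : f ∈ fockMinor ι κ d) : fX i a f ∈ fockMinor ι κ d :=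
  fockMap_mem (M := minorQ ι κ d) (fun _ hv => Submodule.smul_mem (minorSub ℚ _ d) _ hv) hf

theorem koszul_mem (d : ℕ) {f : Finset (ι × κ) → MvPolynomial (ι × κ) ℚ}
    (hf : f ∈ fockMinor ι κ d) : 𝓓 f ∈ fockMinor ι κ d := by
  rw [koszul, LinearMap.sum_apply]
  exact sum_mem fun v _ => fX_mem d _ _ (fockI_mem (M := minorQ ι κ d) v hf)

theorem totPol_mem (d : ℕ) (a b : κ) {f : Finset (ι × κ) → MvPolynomial (ι × κ) ℚ}
    (hf : f ∈ fockMinor ι κ d) : 𝓣 a b f ∈ fockMinor ι κ d := by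
  rw [totPol, colPol_fockLift, LinearMap.add_apply, extPol, LinearMap.sum_apply]
  exact add_mem (fockMap_mem (M := minorQ ι κ d) (fun _ hv => (isPartial_polyDer ℚ).colPol_mem a b d hv) hf)
    (sum_mem fun i _ => fockE_mem (M := minorQ ι κ d) _ (fockI_mem (M := minorQ ι κ d) _ hf))

theorem lowHtpy_mem (d : ℕ) (a : κ) {f : Finset (ι × κ) → MvPolynomial (ι × κ) ℚ}
    (hf : f ∈ fockMinor ι κ d) : 𝓗 d a f ∈ fockMinor ι κ d := by
  simp only [lowHtpy, LinearMap.sum_apply]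
  refine sum_mem fun i _ => ?_
  rw [lowOp_fockLift]
  exact fockMap_mem (M := minorQ ι κ d) (fun _ hv => (isPartial_polyDer ℚ).lowOp_mem i a d hv) (fockE_mem (M := minorQ ι κ d) _ hf)

theorem fockAdj_fX (i : ι) (a : κ) : FockAdj (fX i a) (fP i a) :=
  fockAdj_fockMap fun f g => fischer_X_mul (i, a) f g

theorem fockAdj_colPol (a b : κ) : FockAdj (𝓒 a b : Module.End ℚ (Finset (ι × κ) → _)) (𝓒 b a) :=
  FockAdj.sum fun i => (fockAdj_fX i a).mul (fockAdj_fX i b).symm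

theorem fockAdj_totPol (a b : κ) : FockAdj (𝓣 a b : Module.End ℚ (Finset (ι × κ) → _)) (𝓣 b a) :=
  (fockAdj_colPol a b).add
    (FockAdj.sum fun i => (fockAdj_fockE (i, a)).mul (fockAdj_fockE (i, b)).symm)

theorem fockAdj_sum_X_fockI (a c : κ) :
    FockAdj (∑ i : ι, fP i c * fockE ℚ (i, a)) (∑ i : ι, fX i c * fockI ℚ (i, a)) :=
  FockAdj.sum fun i => by
    rw [(superWeyl_poly.xj i c (i, a)).eq]
    exact (fockAdj_fX i c).symm.mul (fockAdj_fockE (i, a))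

/-- The number of elements of a set of matrix positions in a column. -/
def colCount (a : κ) (A : Finset (ι × κ)) : ℕ := (A.filter (· ∈ {v : ι × κ | v.2 = a})).card

theorem coeff_colPol_self (a : κ) (α : ι × κ →₀ ℕ) (f : MvPolynomial (ι × κ) ℚ) :
    coeff α (colPol (varMul ℚ (MvPolynomial (ι × κ) ℚ)) (polyDer ℚ) a a f) =
      colDeg a α * coeff α f := by
  simp only [colPol, LinearMap.sum_apply, Module.End.mul_apply, varMul_apply, smul_eq_mul,
    coeff_sum, colDeg, Nat.cast_sum, Finset.sum_mul, coeff_X_mul']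
  refine Finset.sum_congr rfl fun i _ => ?_
  split_ifs with h
  · rw [polyDer_apply, coeff_pderiv]
    have h1 : Finsupp.single (i, a) 1 ≤ α := by
      rw [Finsupp.single_le_iff]
      exact Nat.one_le_iff_ne_zero.mpr (Finsupp.mem_support_iff.mp h)
    rw [tsub_add_cancel_of_le h1, mul_comm]
    congr 1
    simp only [Finsupp.tsub_apply, Finsupp.single_eq_same]
    rw [← Nat.cast_succ, Nat.succ_eq_add_one, Nat.sub_add_cancel
      (Nat.one_le_iff_ne_zero.mpr (Finsupp.mem_support_iff.mp h))]
  · rw [Finsupp.notMem_support_iff.mp h]; simp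

theorem extPol_self_cut (a : κ) (q : ℤ) (f : Finset (ι × κ) → MvPolynomial (ι × κ) ℚ) :
    𝓐 a a (fockCut ℚ {v : ι × κ | v.2 = a} q f) = (q : ℚ) • fockCut ℚ {v : ι × κ | v.2 = a} q f := by
  rw [Int.cast_smul_eq_zsmul, ← sum_fockE_fockI_cut, extPol, LinearMap.sum_apply,
    Finset.sum_filter, Fintype.sum_prod_type]
  simp

theorem extPol_self_apply (a : κ) (f : Finset (ι × κ) → MvPolynomial (ι × κ) ℚ)
    (A : Finset (ι × κ)) : 𝓐 a a f A = (colCount a A : ℚ) • f A := by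
  have h : ∀ g : Finset (ι × κ) → MvPolynomial (ι × κ) ℚ, fockCut ℚ {v : ι × κ | v.2 = a} (colCount a A) g A = g A := fun g => by
    simp [fockCut_apply, colCount]
  rw [← h (𝓐 a a f)]
  have h2 : fockCut ℚ {v : ι × κ | v.2 = a} (colCount a A) (𝓐 a a f) =
      𝓐 a a (fockCut ℚ {v : ι × κ | v.2 = a} (colCount a A) f) := by
    simp only [extPol, LinearMap.sum_apply, map_sum, Module.End.mul_apply, fockCut_fockE,
      fockCut_fockI]
    simp
  rw [h2, extPol_self_cut, Pi.smul_apply, h]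
  simp

theorem weight_of_coeff_ne_zero {a : κ} {b : ℚ} {f : Finset (ι × κ) → MvPolynomial (ι × κ) ℚ}
    (hf : 𝓣 a a f = b • f) {A : Finset (ι × κ)} {α : ι × κ →₀ ℕ} (h : coeff α (f A) ≠ 0) :
    (colDeg a α + colCount a A : ℚ) = b := by
  have h1 := congrArg (coeff α) (congrFun hf A)
  rw [totPol, colPol_fockLift, LinearMap.add_apply, Pi.add_apply, fockMap_apply, coeff_add,
    coeff_colPol_self, extPol_self_apply, Pi.smul_apply, coeff_smul, coeff_smul, smul_eq_mul,
    smul_eq_mul, ← add_mul] at h1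
  exact mul_right_cancel₀ h h1

theorem le_colDeg_of_mem {d : ℕ} {f : Finset (ι × κ) → MvPolynomial (ι × κ) ℚ}
    (hf : f ∈ fockMinor ι κ d) {A : Finset (ι × κ)} {α : ι × κ →₀ ℕ} (h : coeff α (f A) ≠ 0)
    (a : κ) : d ≤ colDeg a α := by
  exact maxMinors_pow_le_colIdeal a d (mem_minorQ.mp (mem_fockSub.mp hf A)) α h

end Harmonic

section Cramer

variable {ι κ : Type*} [Fintype ι] [Fintype κ] [DecidableEq ι] [DecidableEq κ]

theorem minor_ne_zero {K : Type*} [CommRing K] [Nontrivial K] {g : κ → ι}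
    (hg : Function.Injective g) : ((genMat ι κ K).submatrix g id).det ≠ 0 := by
  intro h
  have h1 := congrArg (MvPolynomial.eval fun v : ι × κ => if v.1 = g v.2 then (1 : K) else 0) h
  rw [RingHom.map_det, map_zero] at h1
  have h2 : (MvPolynomial.eval fun v : ι × κ => if v.1 = g v.2 then (1 : K) else 0).mapMatrix
      ((genMat ι κ K).submatrix g id) = 1 := by
    ext a b
    simp [genMat, Matrix.one_apply, hg.eq_iff]
  rw [h2, Matrix.det_one] at h1
  exact one_ne_zero h1

theorem colCount_add_card_le {g : κ → ι} (hg : Function.Injective g) (a : κ) {A : Finset (ι × κ)}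
    (hA : ∀ k, (g k, a) ∉ A) : colCount a A + Fintype.card κ ≤ Fintype.card ι := by
  have h1 : colCount a A = ((A.filter (· ∈ {v : ι × κ | v.2 = a})).image Prod.fst).card := by
    rw [Finset.card_image_of_injOn, colCount]
    intro v hv w hw h
    have h1 : v.2 = a := (Finset.mem_filter.mp hv).2
    have h2 : w.2 = a := (Finset.mem_filter.mp hw).2
    exact Prod.ext h (h1.trans h2.symm)
  have h2 : Fintype.card κ = (Finset.univ.image g).card := by
    rw [Finset.card_image_of_injective _ hg, Finset.card_univ]
  rw [h1, h2, ← Finset.card_union_of_disjoint]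
  · exact Finset.card_le_univ _
  · rw [Finset.disjoint_left]
    intro i hi hi'
    obtain ⟨v, hv, rfl⟩ := Finset.mem_image.mp hi
    obtain ⟨k, -, hk⟩ := Finset.mem_image.mp hi'
    refine hA k ?_
    have h3 : v.2 = a := (Finset.mem_filter.mp hv).2
    rw [hk, ← h3]
    exact (Finset.mem_filter.mp hv).1

/-- The contraction of the exterior variables of column `a` with the variables of column `c`. -/
noncomputable abbrev colContr (ι : Type*) {κ : Type*} [Fintype ι] [Fintype κ] [DecidableEq ι]
    [DecidableEq κ] (c a : κ) : Module.End ℚ (Finset (ι × κ) → MvPolynomial (ι × κ) ℚ) :=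
  ∑ i : ι, fX i c * fockI ℚ (i, a)

theorem eq_zero_of_sum_X_fockI {a : κ} {z : Finset (ι × κ) → MvPolynomial (ι × κ) ℚ}
    (hZ : ∀ c, colContr ι c a z = 0)
    (hq : ∀ A, z A ≠ 0 → Fintype.card ι < colCount a A + Fintype.card κ)
    (hc : Fintype.card κ ≤ Fintype.card ι) : z = 0 := by
  obtain ⟨g⟩ := Function.Embedding.nonempty_of_card_le hc
  by_contra hz
  obtain ⟨A₀, hA₀⟩ := Function.ne_iff.mp hz
  classical
  obtain ⟨A, hA, hmin⟩ := Finset.exists_min_image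
    (Finset.univ.filter fun A : Finset (ι × κ) => z A ≠ 0)
    (fun A => (Finset.univ.filter fun k : κ => (g k, a) ∈ A).card) ⟨A₀, by simpa using hA₀⟩
  have hzA : z A ≠ 0 := (Finset.mem_filter.mp hA).2
  obtain ⟨k, hk⟩ : ∃ k, (g k, a) ∈ A := by
    by_contra! h
    exact absurd (hq A hzA) (not_lt.mpr (colCount_add_card_le g.injective a h))
  set B := A.erase (g k, a) with hB
  set w : ι → MvPolynomial (ι × κ) ℚ := fun i => fockI ℚ (i, a) z B with hw
  set G := (genMat ι κ ℚ).submatrix g id with hG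
  have h1 : ∀ c, ∑ i, (X (i, c) : MvPolynomial (ι × κ) ℚ) * w i = 0 := fun c => by
    have := congrFun (hZ c) B
    rw [LinearMap.sum_apply, Finset.sum_apply] at this
    exact this
  have h2 : ∀ i, i ∉ Set.range g → w i = 0 := by
    intro i hi
    simp only [hw, fockI_apply]
    split_ifs with h
    · rfl
    · by_contra hne
      have hne' : z (insert (i, a) B) ≠ 0 := fun h0 => hne (by rw [h0, smul_zero])
      refine absurd (hmin (insert (i, a) B) (Finset.mem_filter.mpr ⟨Finset.mem_univ _, hne'⟩))
        (not_le.mpr (Finset.card_lt_card ?_))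
      refine ⟨fun k' hk' => ?_, fun hsub => ?_⟩
      · simp only [Finset.mem_filter, Finset.mem_univ, true_and, Finset.mem_insert, hB,
          Finset.mem_erase, Prod.mk.injEq, and_true] at hk' ⊢
        rcases hk' with h' | h'
        · exact absurd ⟨k', h'⟩ hi
        · exact h'.2
      · have := hsub (Finset.mem_filter.mpr ⟨Finset.mem_univ k, hk⟩)
        simp only [Finset.mem_filter, Finset.mem_univ, true_and, Finset.mem_insert, hB,
          Finset.mem_erase, Prod.mk.injEq, and_true] at this
        rcases this with h' | h'
        · exact hi ⟨k, h'⟩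
        · exact h'.1 rfl
  have h3 : ∑ i, (∑ c, (X (i, c) : MvPolynomial (ι × κ) ℚ) * G.adjugate c k) * w i = 0 := by
    simp only [Finset.sum_mul]
    rw [Finset.sum_comm]
    refine Finset.sum_eq_zero fun c _ => ?_
    calc _ = G.adjugate c k * ∑ i, (X (i, c) : MvPolynomial (ι × κ) ℚ) * w i := by
          rw [Finset.mul_sum]; exact Finset.sum_congr rfl fun i _ => by ring
      _ = 0 := by rw [h1, mul_zero]
  rw [Finset.sum_eq_single (g k)] at h3
  · have h4 : ∑ c, (X (g k, c) : MvPolynomial (ι × κ) ℚ) * G.adjugate c k = G.det := by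
      have := congrFun (congrFun (Matrix.mul_adjugate G) k) k
      rw [Matrix.mul_apply] at this
      simpa [hG, genMat] using this
    rw [h4] at h3
    have h5 : w (g k) = 0 := (mul_eq_zero.mp h3).resolve_left (minor_ne_zero g.injective)
    simp only [hw, fockI_apply, hB, Finset.notMem_erase, if_false, Finset.insert_erase hk] at h5
    refine hzA ?_
    rw [← one_smul ℤ (z A), ← fockSign_mul_self (g k, a) (A.erase (g k, a)), mul_smul, h5, smul_zero]
  · intro i _ hi
    by_cases hir : i ∈ Set.range g
    · obtain ⟨k', rfl⟩ := hir
      have h4 : ∑ c, (X (g k', c) : MvPolynomial (ι × κ) ℚ) * G.adjugate c k = 0 := by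
        have := congrFun (congrFun (Matrix.mul_adjugate G) k') k
        rw [Matrix.mul_apply] at this
        have hkk : k' ≠ k := fun h => hi (h ▸ rfl)
        simpa [hG, genMat, Matrix.one_apply, hkk] using this
      rw [h4, zero_mul]
    · rw [h2 i hir, mul_zero]
  · simp

end Cramer

section Exactness

variable {ι κ : Type*} [Fintype ι] [Fintype κ] [DecidableEq ι] [DecidableEq κ]

local notation "𝓓" => koszul fX (fockI ℚ)
local notation "𝓣" => totPol fX fP (fockE ℚ) (fockI ℚ)
local notation "𝓐" => extPol (R := Module.End ℚ (Finset (ι × κ) → MvPolynomial (ι × κ) ℚ)) (fockE ℚ) (fockI ℚ)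
local notation "𝓒" => colPol (R := Module.End ℚ (Finset (ι × κ) → MvPolynomial (ι × κ) ℚ)) fX fP
local notation "𝓦" => Finset (ι × κ) → MvPolynomial (ι × κ) ℚ

/-- The Laplacian of the Koszul differential and `lowHtpy`. -/
noncomputable def fockLap (ι : Type*) {κ : Type*} [Fintype ι] [Fintype κ] [DecidableEq ι]
    [DecidableEq κ] (d : ℕ) (a : κ) : Module.End ℚ (Finset (ι × κ) → MvPolynomial (ι × κ) ℚ) :=
  𝓓 * lowHtpy d fX fP (fockE ℚ) a + lowHtpy d fX fP (fockE ℚ) a * 𝓓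

theorem fockLap_eq (d : ℕ) (a : κ) : fockLap ι d a =
    ∑ c, 𝓒 a c * (𝓒 c a - if c = a then (d : Module.End ℚ 𝓦) else 0)
      + ∑ c, (𝓒 c a - if c = a then (d : Module.End ℚ 𝓦) else 0) * 𝓐 a c
      + ∑ c, (∑ i, fP i c * fockE ℚ (i, a)) * colContr ι c a :=
  superWeyl_poly.koszul_lowHtpy d a

/-- Restriction to the sets with a given number of elements in a column. -/
noncomputable abbrev colCut (ι : Type*) {κ : Type*} [Fintype ι] [Fintype κ] [DecidableEq ι]
    [DecidableEq κ] (a : κ) (q : ℤ) : Module.End ℚ (Finset (ι × κ) → MvPolynomial (ι × κ) ℚ) :=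
  fockCut ℚ {v : ι × κ | v.2 = a} q

theorem cut_colPol (a : κ) (q : ℤ) (b c : κ) (f : 𝓦) :
    colCut ι a q (𝓒 b c f) = 𝓒 b c (colCut ι a q f) := by
  rw [colPol_fockLift]; exact fockCut_fockMap _ _ _ _

theorem cut_extPol (a : κ) (q : ℤ) (c : κ) (f : 𝓦) :
    colCut ι a q (𝓐 a c f) = 𝓐 a c (colCut ι a (if c = a then q else q - 1) f) := by
  simp only [extPol, LinearMap.sum_apply, map_sum, Module.End.mul_apply, fockCut_fockE,
    fockCut_fockI]
  by_cases h : c = a <;> simp [h]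

theorem cut_colContr (a : κ) (q : ℤ) (c : κ) (f : 𝓦) :
    colCut ι a q (colContr ι c a f) = colContr ι c a (colCut ι a (q + 1) f) := by
  simp only [LinearMap.sum_apply, map_sum, Module.End.mul_apply, fockLift, fockCut_fockMap,
    fockCut_fockI]
  simp

theorem cut_colContr_adj (a : κ) (q : ℤ) (c : κ) (f : 𝓦) :
    colCut ι a q ((∑ i, (fP i c * fockE ℚ (i, a) : Module.End ℚ 𝓦)) f) =
      (∑ i, (fP i c * fockE ℚ (i, a) : Module.End ℚ 𝓦)) (colCut ι a (q - 1) f) := by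
  simp only [LinearMap.sum_apply, map_sum, Module.End.mul_apply, fockLift, fockCut_fockMap,
    fockCut_fockE]
  simp

theorem fockForm_self_pos {f : 𝓦} (hf : f ≠ 0) : 0 < fockForm (ι × κ) f f :=
  (fockForm_self_nonneg f).lt_of_ne fun h => hf (fockForm_self_eq_zero h.symm)

theorem cut_eq_zero_of_lap {d : ℕ} {a : κ} {b : ℚ} {z : 𝓦} (hz : z ∈ fockMinor ι κ d)
    (hw : 𝓣 a a z = b • z) (hc : Fintype.card κ ≤ Fintype.card ι)
    (hb : (d + Fintype.card ι : ℚ) < b + Fintype.card κ) (hL : fockLap ι d a z = 0) (q : ℤ)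
    (hq : colCut ι a (q - 1) z = 0) : colCut ι a q z = 0 := by
  by_contra hu
  set u := colCut ι a q z with hu_def
  have hum : u ∈ fockMinor ι κ d := fockCut_mem (M := minorQ ι κ d) _ _ hz
  have hA : 𝓐 a a u = (q : ℚ) • u := extPol_self_cut a q z
  have hD : 𝓒 a a u = (b - q) • u := by
    have h1 := congrArg (colCut ι a q) hw
    rw [totPol, LinearMap.add_apply, map_add, cut_colPol, cut_extPol, if_pos rfl, map_smul] at h1
    rw [sub_smul, ← h1, ← hu_def, hA, add_sub_cancel_right]
  have hwu : 𝓣 a a u = b • u := by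
    rw [totPol, LinearMap.add_apply, hD, hA, ← add_smul, sub_add_cancel]
  have hcount : ∀ A, u A ≠ 0 → (colCount a A : ℤ) = q := fun A h => by
    by_contra h'
    exact h (by rw [hu_def]; exact if_neg h')
  have hdeg : (d : ℚ) ≤ b - q := by
    obtain ⟨A, hA0⟩ := Function.ne_iff.mp hu
    obtain ⟨α, hα⟩ := MvPolynomial.ne_zero_iff.mp hA0
    have h1 := weight_of_coeff_ne_zero hwu hα
    have h2 : (d : ℚ) ≤ colDeg a α := Nat.cast_le.mpr (le_colDeg_of_mem hum hα a)
    have h3 : (colCount a A : ℚ) = q := by exact_mod_cast hcount A hA0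
    linarith
  have hbpos : 0 < b := by
    have : (Fintype.card κ : ℚ) ≤ Fintype.card ι := Nat.cast_le.mpr hc
    have : (0 : ℚ) ≤ d := Nat.cast_nonneg d
    linarith
  have key : ∑ c ∈ Finset.univ.erase a, fockForm _ (𝓒 c a u) (𝓒 c a u)
      + (b - q - d) * b * fockForm _ u u
      + ∑ c, fockForm _ (colContr ι c a u) (colContr ι c a u) = 0 := by
    have h1 : fockForm _ u (colCut ι a q (fockLap ι d a z)) = 0 := by rw [hL, map_zero, map_zero]
    rw [fockLap_eq] at h1
    simp only [LinearMap.add_apply, LinearMap.sum_apply, map_add, map_sum] at h1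
    have e1 : ∀ c, fockForm _ u (colCut ι a q ((𝓒 a c * (𝓒 c a - if c = a then (d : Module.End ℚ 𝓦) else 0)) z))
        = if c = a then (b - q - d) * (b - q) * fockForm _ u u
          else fockForm _ (𝓒 c a u) (𝓒 c a u) := fun c => by
      rw [Module.End.mul_apply, cut_colPol, LinearMap.sub_apply, map_sub, cut_colPol, ← hu_def]
      split_ifs with h
      · subst h
        have : colCut ι c q ((d : Module.End ℚ 𝓦) z) = (d : ℚ) • u := by
          rw [Module.End.natCast_apply, map_nsmul, ← Nat.cast_smul_eq_nsmul ℚ]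
        rw [this, hD, ← sub_smul, map_smul, hD, smul_smul, map_smul, smul_eq_mul]
      · rw [LinearMap.zero_apply, map_zero, sub_zero, ← fockAdj_colPol]
    have e2 : ∀ c, fockForm _ u (colCut ι a q (((𝓒 c a - if c = a then (d : Module.End ℚ 𝓦) else 0) * 𝓐 a c) z))
        = if c = a then (b - q - d) * q * fockForm _ u u else 0 := fun c => by
      rw [Module.End.mul_apply, LinearMap.sub_apply, map_sub, cut_colPol, cut_extPol]
      split_ifs with h
      · subst h
        have : colCut ι c q ((d : Module.End ℚ 𝓦) (𝓐 c c z)) = (d : ℚ) • ((q : ℚ) • u) := by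
          rw [Module.End.natCast_apply, map_nsmul, ← Nat.cast_smul_eq_nsmul ℚ, cut_extPol,
            if_pos rfl, hA]
        rw [this, ← hu_def, hA, map_smul, hD, smul_smul, smul_smul, ← sub_smul, map_smul,
          smul_eq_mul]
        ring
      · simp [hq]
    have e3 : ∀ c, fockForm _ u (colCut ι a q (((∑ i, fP i c * fockE ℚ (i, a)) * colContr ι c a) z))
        = fockForm _ (colContr ι c a u) (colContr ι c a u) := fun c => by
      rw [Module.End.mul_apply, cut_colContr_adj, cut_colContr, sub_add_cancel,
        (fockAdj_sum_X_fockI a c).symm.symm.symm u _]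
    simp only [e1, e2, e3] at h1
    rw [← Finset.add_sum_erase _ _ (Finset.mem_univ a), if_pos rfl, Finset.sum_ite_eq' Finset.univ a,
      if_pos (Finset.mem_univ a)] at h1
    rw [← h1, Finset.sum_congr rfl fun c hc => if_neg (Finset.ne_of_mem_erase hc)]
    ring
  have p1 : 0 ≤ ∑ c ∈ Finset.univ.erase a, fockForm _ (𝓒 c a u) (𝓒 c a u) :=
    Finset.sum_nonneg fun c _ => fockForm_self_nonneg _
  have p2 : 0 ≤ (b - q - d) * b * fockForm _ u u :=
    mul_nonneg (mul_nonneg (by linarith) hbpos.le) (fockForm_self_nonneg _)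
  have p3 : 0 ≤ ∑ c, fockForm _ (colContr ι c a u) (colContr ι c a u) :=
    Finset.sum_nonneg fun c _ => fockForm_self_nonneg _
  have z2 : (b - q - d) * b * fockForm _ u u = 0 := by linarith
  have z3 : ∑ c, fockForm _ (colContr ι c a u) (colContr ι c a u) = 0 := by linarith
  rw [Finset.sum_eq_zero_iff_of_nonneg fun c _ => fockForm_self_nonneg _] at z3
  have hqd : b - q - d = 0 := by
    rcases mul_eq_zero.mp z2 with h | h
    · exact (mul_eq_zero.mp h).resolve_right hbpos.ne'
    · exact absurd (fockForm_self_eq_zero h) hu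
  refine hu (eq_zero_of_sum_X_fockI (a := a)
    (fun c => fockForm_self_eq_zero (z3 c (Finset.mem_univ c))) (fun A h => ?_) hc)
  have h3 : (colCount a A : ℚ) = q := by exact_mod_cast hcount A h
  have : (Fintype.card ι : ℚ) < colCount a A + Fintype.card κ := by rw [h3]; linarith
  exact_mod_cast this

theorem eq_zero_of_lap {d : ℕ} {a : κ} {b : ℚ} {z : 𝓦} (hz : z ∈ fockMinor ι κ d)
    (hw : 𝓣 a a z = b • z) (hc : Fintype.card κ ≤ Fintype.card ι)
    (hb : (d + Fintype.card ι : ℚ) < b + Fintype.card κ) (hL : fockLap ι d a z = 0) : z = 0 := by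
  refine fockCut_eq_zero (k := ℚ) {v : ι × κ | v.2 = a} fun q => ?_
  induction q with
  | zero =>
    refine cut_eq_zero_of_lap hz hw hc hb hL _ (_root_.funext fun A => ?_)
    rw [fockCut_apply, if_neg, Pi.zero_apply]
    intro h
    have : (0 : ℤ) ≤ ((A.filter (· ∈ {v : ι × κ | v.2 = a})).card : ℤ) := Int.natCast_nonneg _
    rw [h] at this
    simp at this
  | succ q ih =>
    refine cut_eq_zero_of_lap hz hw hc hb hL _ ?_
    simpa using ih

end Exactness

section WeightSpaces

variable {ι κ : Type*} [Fintype ι] [Fintype κ] [DecidableEq ι] [DecidableEq κ]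

local notation "𝓦" => Finset (ι × κ) → MvPolynomial (ι × κ) ℚ
local notation "𝓓" => koszul (R := Module.End ℚ 𝓦) fX (fockI ℚ)
local notation "𝓣" => totPol (R := Module.End ℚ 𝓦) fX fP (fockE ℚ) (fockI ℚ)
local notation "𝓐" => extPol (R := Module.End ℚ 𝓦) (fockE ℚ) (fockI ℚ)
local notation "𝓒" => colPol (R := Module.End ℚ 𝓦) fX fP
local notation "𝓝" => numOp (R := Module.End ℚ 𝓦) (fockE ℚ) (fockI ℚ)

/-- Elements of Fock space of a given multidegree. -/
noncomputable def fockWt (b : κ → ℚ) : Submodule ℚ 𝓦 :=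
  ⨅ a, LinearMap.ker (𝓣 a a - b a • (1 : Module.End ℚ 𝓦))

theorem mem_fockWt {b : κ → ℚ} {z : 𝓦} : z ∈ fockWt b ↔ ∀ a, 𝓣 a a z = b a • z := by
  simp [fockWt, Submodule.mem_iInf, sub_eq_zero]

theorem totalDegree_le_of_mem_fockWt {b : κ → ℚ} {z : 𝓦} (hz : z ∈ fockWt b) (A : Finset (ι × κ)) :
    (z A).totalDegree ≤ ⌊∑ a, b a⌋₊ := by
  refine Finset.sup_le fun α hα => Nat.le_floor ?_
  have h1 : ∀ a, (colDeg a α : ℚ) ≤ b a := fun a => by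
    have := weight_of_coeff_ne_zero (mem_fockWt.mp hz a) (mem_support_iff.mp hα)
    have : (0 : ℚ) ≤ colCount a A := Nat.cast_nonneg _
    linarith
  refine le_trans (le_of_eq ?_) (Finset.sum_le_sum fun a (_ : a ∈ Finset.univ) => h1 a)
  rw [Finsupp.sum_fintype _ _ fun _ => rfl, Fintype.sum_prod_type_right, ← Nat.cast_sum]
  rfl

theorem finite_of_le_fockWt {b : κ → ℚ} {V : Submodule ℚ 𝓦} (hV : V ≤ fockWt b) :
    Module.Finite ℚ V := by
  let N := ⌊∑ a, b a⌋₊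
  let f : V →ₗ[ℚ] Finset (ι × κ) → restrictTotalDegree (ι × κ) ℚ N :=
    LinearMap.pi fun A => ((LinearMap.proj A).domRestrict V).codRestrict _ fun z =>
      (mem_restrictTotalDegree _ _ _).mpr (totalDegree_le_of_mem_fockWt (hV z.2) A)
  refine Module.Finite.of_injective f fun z w h => Subtype.ext (_root_.funext fun A => ?_)
  exact congrArg Subtype.val (congrFun h A)

theorem sum_colPol_add_numOp (z : 𝓦) : ∑ a, 𝓣 a a z = (∑ a, 𝓒 a a z) + 𝓝 z := by
  rw [← sum_extPol, LinearMap.sum_apply, ← Finset.sum_add_distrib]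
  rfl

theorem koszul_koszul_apply (z : 𝓦) : 𝓓 (𝓓 z) = 0 := by
  rw [← Module.End.mul_apply, superWeyl_poly.koszul_mul_self, LinearMap.zero_apply]

/-- Multihomogeneous cycles with values in a power of the ideal of maximal minors. -/
noncomputable def fockCyc (d : ℕ) (b : κ → ℚ) : Submodule ℚ 𝓦 :=
  fockMinor ι κ d ⊓ LinearMap.ker 𝓓 ⊓ fockWt b

theorem mem_fockCyc {d : ℕ} {b : κ → ℚ} {z : 𝓦} :
    z ∈ fockCyc d b ↔ z ∈ fockMinor ι κ d ∧ 𝓓 z = 0 ∧ ∀ a, 𝓣 a a z = b a • z := by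
  rw [fockCyc, Submodule.mem_inf, Submodule.mem_inf, mem_fockWt, LinearMap.mem_ker, and_assoc]

theorem lowHtpy_mem_fockWt (d : ℕ) (a : κ) {b : κ → ℚ} {z : 𝓦} (hz : z ∈ fockWt b) :
    lowHtpy d fX fP (fockE ℚ) a z ∈ fockWt b :=
  mem_fockWt.mpr fun c => by
    rw [← Module.End.mul_apply, (superWeyl_poly.commute_totPol_lowHtpy d c a).eq,
      Module.End.mul_apply, mem_fockWt.mp hz, map_smul]

theorem fockLap_apply (d : ℕ) (a : κ) {z : 𝓦} (hz : 𝓓 z = 0) :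
    fockLap ι d a z = 𝓓 (lowHtpy d fX fP (fockE ℚ) a z) := by
  rw [fockLap, LinearMap.add_apply, Module.End.mul_apply, Module.End.mul_apply, hz, map_zero,
    add_zero]

theorem koszul_mem_fockWt {b : κ → ℚ} {z : 𝓦} (hz : z ∈ fockWt b) : 𝓓 z ∈ fockWt b :=
  mem_fockWt.mpr fun c => by
    rw [← Module.End.mul_apply, (superWeyl_poly.commute_totPol_koszul c c).eq,
      Module.End.mul_apply, mem_fockWt.mp hz, map_smul]

theorem fockLap_mem_fockCyc (d : ℕ) (a : κ) {b : κ → ℚ} {z : 𝓦} (hz : z ∈ fockCyc d b) :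
    fockLap ι d a z ∈ fockCyc d b := by
  have h := mem_fockCyc.mp hz
  rw [fockLap_apply d a h.2.1]
  exact mem_fockCyc.mpr ⟨koszul_mem d (lowHtpy_mem d a h.1), koszul_koszul_apply _,
    mem_fockWt.mp (koszul_mem_fockWt (lowHtpy_mem_fockWt d a (mem_fockWt.mpr h.2.2)))⟩

theorem exists_koszul_eq_of_weight {d : ℕ} {b : κ → ℚ} {z : 𝓦} (hz : z ∈ fockCyc d b)
    (hc : Fintype.card κ ≤ Fintype.card ι) {a : κ}
    (hb : (d + Fintype.card ι : ℚ) < b a + Fintype.card κ) :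
    ∃ y ∈ fockMinor ι κ d ⊓ fockWt b, 𝓓 y = z := by
  have : Module.Finite ℚ (fockCyc (ι := ι) d b) := finite_of_le_fockWt inf_le_right
  let L : Module.End ℚ (fockCyc (ι := ι) d b) :=
    (fockLap ι d a).restrict fun z hz => fockLap_mem_fockCyc d a hz
  have hL : Function.Injective L := by
    rw [← LinearMap.ker_eq_bot, LinearMap.ker_eq_bot']
    intro z hz
    have h := mem_fockCyc.mp z.2
    exact Subtype.ext (eq_zero_of_lap h.1 (h.2.2 a) hc hb (congrArg Subtype.val hz))
  obtain ⟨y, hy⟩ := (LinearMap.injective_iff_surjective.mp hL) ⟨z, hz⟩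
  have h := mem_fockCyc.mp y.2
  refine ⟨lowHtpy d fX fP (fockE ℚ) a y, ⟨lowHtpy_mem d a h.1,
    lowHtpy_mem_fockWt d a (mem_fockWt.mpr h.2.2)⟩, ?_⟩
  rw [← fockLap_apply d a h.2.1]
  exact congrArg Subtype.val hy

theorem sum_fockLap (d : ℕ) : ∑ a, fockLap ι d a =
    ∑ a : κ, ∑ c, (𝓒 c a - if c = a then (d : Module.End ℚ 𝓦) else 0) * 𝓣 a c
      + ∑ a, ∑ c, (∑ i, fP i c * fockE ℚ (i, a)) * colContr ι c a := by
  simp only [fockLap_eq, Finset.sum_add_distrib, totPol, mul_add]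
  congr 2
  have h1 : ∀ a c : κ, 𝓒 a c * (𝓒 c a - if c = a then (d : Module.End ℚ 𝓦) else 0) =
      𝓒 a c * 𝓒 c a - if c = a then (d : Module.End ℚ 𝓦) * 𝓒 a a else 0 := fun a c => by
    rw [mul_sub]
    split_ifs with h
    · rw [h, (Nat.cast_commute d _).eq]
    · rw [mul_zero]
  have h2 : ∀ a c : κ, (𝓒 c a - if c = a then (d : Module.End ℚ 𝓦) else 0) * 𝓒 a c =
      𝓒 c a * 𝓒 a c - if c = a then (d : Module.End ℚ 𝓦) * 𝓒 a a else 0 := fun a c => by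
    rw [sub_mul]
    split_ifs with h
    · rw [h]
    · rw [zero_mul]
  simp only [h1, h2, Finset.sum_sub_distrib]
  rw [Finset.sum_comm]

end WeightSpaces

section OrthogonalDecomposition

variable {ι κ : Type*} [Fintype ι] [Fintype κ] [DecidableEq ι] [DecidableEq κ]

local notation "𝓦" => Finset (ι × κ) → MvPolynomial (ι × κ) ℚ
local notation "𝓓" => koszul (R := Module.End ℚ 𝓦) fX (fockI ℚ)
local notation "𝓣" => totPol (R := Module.End ℚ 𝓦) fX fP (fockE ℚ) (fockI ℚ)
local notation "𝓐" => extPol (R := Module.End ℚ 𝓦) (fockE ℚ) (fockI ℚ)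
local notation "𝓒" => colPol (R := Module.End ℚ 𝓦) fX fP
local notation "𝓝" => numOp (R := Module.End ℚ 𝓦) (fockE ℚ) (fockI ℚ)

theorem totPol_mem_fockWt {b : κ → ℚ} {z : 𝓦} (hz : z ∈ fockWt b) (c a : κ) :
    𝓣 c a z ∈ fockWt fun e => b e + (if e = c then 1 else 0) - if e = a then 1 else 0 := by
  refine mem_fockWt.mpr fun e => ?_
  rw [← Module.End.mul_apply, superWeyl_poly.totPol_totPol e e c a, LinearMap.sub_apply,
    LinearMap.add_apply, Module.End.mul_apply, mem_fockWt.mp hz, map_smul, sub_smul, add_smul]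
  congr 1
  · congr 1
    split_ifs with h <;> simp [h]
  · by_cases h : e = a
    · subst h; simp
    · rw [if_neg h, if_neg (Ne.symm h)]; simp

theorem exists_orthogonal_decomp {B : Submodule ℚ 𝓦} [Module.Finite ℚ B] (z : 𝓦) :
    ∃ b ∈ B, ∀ b' ∈ B, fockForm _ (z - b) b' = 0 := by
  let φ : B →ₗ[ℚ] Module.Dual ℚ B := (fockForm (ι × κ)).domRestrict₁₂ B B
  have hφ : Function.Injective φ := by
    rw [← LinearMap.ker_eq_bot, LinearMap.ker_eq_bot']
    intro b hb
    exact Subtype.ext (fockForm_self_eq_zero (LinearMap.congr_fun hb b))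
  obtain ⟨b, hb⟩ := (LinearMap.injective_iff_surjective_of_finrank_eq_finrank
    (Subspace.dual_finrank_eq (K := ℚ) (V := B)).symm).mp hφ ((fockForm _ z).domRestrict B)
  refine ⟨b, b.2, fun b' hb' => ?_⟩
  have h1 : fockForm _ (b : 𝓦) b' = fockForm _ z b' := LinearMap.congr_fun hb ⟨b', hb'⟩
  rw [map_sub, LinearMap.sub_apply, h1, sub_self]

theorem exists_koszul_eq_of_numOp {d δ j : ℕ} {z : 𝓦}
    (hz : z ∈ fockCyc d fun _ => (d + δ : ℚ)) (hδ : Fintype.card ι = Fintype.card κ + δ)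
    (hd : 0 < d) (hj : j ≠ Fintype.card κ * δ) (hN : 𝓝 z = (j : ℚ) • z) :
    ∃ y ∈ fockMinor ι κ d ⊓ fockWt fun _ => (d + δ : ℚ), 𝓓 y = z := by
  set b : κ → ℚ := fun _ => (d + δ : ℚ) with hb
  have hc : Fintype.card κ ≤ Fintype.card ι := by omega
  set V : Submodule ℚ 𝓦 := fockCyc d b ⊓ LinearMap.ker (𝓝 - (j : ℚ) • (1 : Module.End ℚ 𝓦)) with hV
  have memV : ∀ w, w ∈ V ↔ w ∈ fockCyc d b ∧ 𝓝 w = (j : ℚ) • w := fun w => by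
    simp [hV, sub_eq_zero]
  set B : Submodule ℚ 𝓦 := V ⊓ (fockMinor ι κ d ⊓ fockWt b).map 𝓓 with hB
  have : Module.Finite ℚ B := finite_of_le_fockWt (b := b)
    (inf_le_left.trans (inf_le_left.trans inf_le_right))
  have hcomm : ∀ a c w, 𝓓 (𝓣 a c w) = 𝓣 a c (𝓓 w) := fun a c w => by
    rw [← Module.End.mul_apply, ← (superWeyl_poly.commute_totPol_koszul a c).eq,
      Module.End.mul_apply]
  have hNcomm : ∀ a c w, 𝓝 (𝓣 a c w) = 𝓣 a c (𝓝 w) := fun a c w => by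
    rw [← Module.End.mul_apply, (superWeyl_poly.commute_numOp_totPol a c).eq,
      Module.End.mul_apply]
  obtain ⟨v, hvB, hv⟩ := exists_orthogonal_decomp (B := B) z
  set u := z - v with hu
  have huV : u ∈ V := sub_mem ((memV z).mpr ⟨hz, hN⟩) hvB.1
  obtain ⟨⟨hum, hu0, huw⟩, huN⟩ : (u ∈ fockMinor ι κ d ∧ 𝓓 u = 0 ∧ ∀ a, 𝓣 a a u = b a • u) ∧
      𝓝 u = (j : ℚ) • u := ⟨mem_fockCyc.mp ((memV u).mp huV).1, ((memV u).mp huV).2⟩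
  have hoff : ∀ a c, a ≠ c → 𝓣 a c u = 0 := by
    intro a c hac
    obtain ⟨y, ⟨hy1, hy2⟩, hy3⟩ := exists_koszul_eq_of_weight (d := d) (a := a)
      (b := fun e => b e + (if e = a then 1 else 0) - if e = c then 1 else 0) (z := 𝓣 a c u)
      (mem_fockCyc.mpr ⟨totPol_mem d a c hum, by rw [hcomm, hu0, map_zero],
        mem_fockWt.mp (totPol_mem_fockWt (mem_fockWt.mpr huw) a c)⟩) hc (by
          simp only [hb, if_true, if_neg hac]
          rw [hδ]; push_cast; linarith)
    have hmem : 𝓣 c a (𝓣 a c u) ∈ B := by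
      refine ⟨(memV _).mpr ⟨mem_fockCyc.mpr ⟨totPol_mem d c a (totPol_mem d a c hum), ?_, ?_⟩, ?_⟩,
        𝓣 c a y, ⟨totPol_mem d c a hy1, ?_⟩, ?_⟩
      · rw [hcomm, hcomm, hu0, map_zero, map_zero]
      · refine mem_fockWt.mp ?_
        convert totPol_mem_fockWt (totPol_mem_fockWt (mem_fockWt.mpr huw) a c) c a using 2
        funext e
        ring
      · rw [hNcomm, hNcomm, huN, map_smul, map_smul]
      · have h := totPol_mem_fockWt hy2 c a
        have hfun : (fun e => b e + (if e = a then 1 else 0) - (if e = c then 1 else 0)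
            + (if e = c then 1 else 0) - if e = a then 1 else 0) = b := by
          funext e
          ring
        rwa [hfun] at h
      · rw [hcomm, hy3]
    refine fockForm_self_eq_zero ?_
    rw [fockAdj_totPol a c]
    exact hv _ hmem
  have hLmem : ∑ a, fockLap ι d a u ∈ B := by
    refine sum_mem fun a _ => ⟨(memV _).mpr ⟨fockLap_mem_fockCyc d a ((memV u).mp huV).1, ?_⟩, ?_⟩
    · rw [fockLap_apply d a hu0, ← Module.End.mul_apply, superWeyl_poly.numOp_koszul,
        LinearMap.sub_apply, Module.End.mul_apply, ← Module.End.mul_apply 𝓝,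
        superWeyl_poly.numOp_lowHtpy, LinearMap.add_apply, map_add, add_sub_cancel_right,
        Module.End.mul_apply, huN, map_smul, map_smul]
    · exact ⟨lowHtpy d fX fP (fockE ℚ) a u, ⟨lowHtpy_mem d a hum,
        lowHtpy_mem_fockWt d a (mem_fockWt.mpr huw)⟩, (fockLap_apply d a hu0).symm⟩
  have hsumD : ∑ a, 𝓒 a a u = (Fintype.card κ * (d + δ) - j : ℚ) • u := by
    have h := sum_colPol_add_numOp u
    simp only [huw, huN, hb] at h
    rw [Finset.sum_const, Finset.card_univ, ← Nat.cast_smul_eq_nsmul ℚ, smul_smul] at h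
    rw [sub_smul, h, add_sub_cancel_right]
  have key : (d + δ : ℚ) * (Fintype.card κ * δ - j) * fockForm _ u u
      + ∑ a, ∑ c, fockForm _ (colContr ι c a u) (colContr ι c a u) = 0 := by
    have h0 := hv _ hLmem
    rw [← LinearMap.sum_apply, sum_fockLap, LinearMap.add_apply, map_add] at h0
    simp only [LinearMap.sum_apply, map_sum] at h0
    have e1 : ∀ a c, fockForm _ u (((𝓒 c a - if c = a then (d : Module.End ℚ 𝓦) else 0) * 𝓣 a c) u)
        = if c = a then (d + δ : ℚ) * (fockForm _ u (𝓒 a a u) - d * fockForm _ u u) else 0 :=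
      fun a c => by
        rw [Module.End.mul_apply]
        split_ifs with h
        · subst h
          rw [huw, map_smul, map_smul, smul_eq_mul, LinearMap.sub_apply, map_sub,
            Module.End.natCast_apply, ← Nat.cast_smul_eq_nsmul ℚ, map_smul, smul_eq_mul]
        · rw [hoff a c (Ne.symm h), map_zero, map_zero]
    have e2 : ∀ a c, fockForm _ u (((∑ i, fP i c * fockE ℚ (i, a)) * colContr ι c a) u)
        = fockForm _ (colContr ι c a u) (colContr ι c a u) := fun a c => by
      rw [Module.End.mul_apply, (fockAdj_sum_X_fockI a c).symm u _]
    have e3 : ∑ a, fockForm _ u (𝓒 a a u) = (Fintype.card κ * (d + δ) - j : ℚ) * fockForm _ u u := by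
      rw [← map_sum, hsumD, map_smul, smul_eq_mul]
    simp only [e1, e2, Finset.sum_ite_eq', Finset.mem_univ, if_true] at h0
    rw [← Finset.mul_sum, Finset.sum_sub_distrib, e3, Finset.sum_const, Finset.card_univ,
      nsmul_eq_mul] at h0
    rw [← h0]
    ring
  have p3 : 0 ≤ ∑ a : κ, ∑ c, fockForm _ (colContr ι c a u) (colContr ι c a u) :=
    Finset.sum_nonneg fun a _ => Finset.sum_nonneg fun c _ => fockForm_self_nonneg _
  have hdpos : (0 : ℚ) < d + δ := by positivity
  have hu_zero : u = 0 := by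
    by_contra hne
    rcases lt_or_gt_of_ne hj with hlt | hgt
    · have h1 : (0 : ℚ) < Fintype.card κ * δ - j := by
        rw [sub_pos]; exact_mod_cast hlt
      have := mul_pos (mul_pos hdpos h1) (fockForm_self_pos hne)
      linarith
    · obtain ⟨A, hA⟩ := Function.ne_iff.mp hne
      obtain ⟨α, hα⟩ := MvPolynomial.ne_zero_iff.mp hA
      have h1 := congrArg (coeff α) (congrFun hsumD A)
      rw [Finset.sum_apply, coeff_sum, Pi.smul_apply, coeff_smul, smul_eq_mul] at h1
      simp only [colPol_fockLift, fockMap_apply, coeff_colPol_self] at h1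
      rw [← Finset.sum_mul] at h1
      have h2 := mul_right_cancel₀ hα h1
      have h3 : (Fintype.card κ * d : ℚ) ≤ ∑ a, (colDeg a α : ℚ) := by
        rw [← nsmul_eq_mul, ← Finset.card_univ, ← Finset.sum_const]
        exact Finset.sum_le_sum fun a _ => Nat.cast_le.mpr (le_colDeg_of_mem hum hα a)
      have h4 : (Fintype.card κ * δ : ℚ) < j := by exact_mod_cast hgt
      rw [h2] at h3
      linarith
  obtain ⟨y, hy, hy'⟩ := hvB.2
  exact ⟨y, hy, by rw [hy', ← sub_eq_zero, ← neg_sub, ← hu, hu_zero, neg_zero]⟩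

end OrthogonalDecomposition

section Chain

variable {ι κ : Type*} [Fintype ι] [Fintype κ] [DecidableEq ι] [DecidableEq κ]

theorem exists_lex_maximal {A : Set (κ → ℤ)} {D₀ : ℤ} (hA : A.Nonempty)
    (hle : ∀ w ∈ A, ∀ a, w a ≤ D₀) (hlt : ∀ w ∈ A, ∃ a, w a < D₀) :
    ∃ w ∈ A, ∃ b, w b < D₀ ∧ ∀ w' ∈ A, (∀ c, w c = D₀ → c ≠ b → w' c = D₀) → ¬ w b < w' b := by
  let f : (κ → ℤ) × κ → ℕ ×ₗ ℕ := fun q =>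
    toLex (Finset.card {c | q.1 c ≠ D₀}, (D₀ - q.1 q.2).toNat)
  obtain ⟨w₀, hw₀⟩ := hA
  obtain ⟨b₀, hb₀⟩ := hlt w₀ hw₀
  obtain ⟨⟨w, b⟩, ⟨hw, hb⟩, hmin⟩ := WellFounded.has_min (InvImage.wf f wellFounded_lt)
    {q | q.1 ∈ A ∧ q.1 q.2 < D₀} ⟨(w₀, b₀), hw₀, hb₀⟩
  refine ⟨w, hw, b, hb, fun w' hw' hc hbb => ?_⟩
  have hb : w b < D₀ := hb
  have hsub : Finset.univ.filter (fun c => w' c ≠ D₀) ⊆ Finset.univ.filter (fun c => w c ≠ D₀) := by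
    intro c
    simp only [Finset.mem_filter, Finset.mem_univ, true_and]
    intro h1 h2
    refine h1 (hc c h2 ?_)
    rintro rfl
    exact hb.ne h2
  by_cases h : w' b < D₀
  · refine hmin (w', b) ⟨hw', h⟩ (Prod.Lex.toLex_lt_toLex.mpr ?_)
    rcases (Finset.card_le_card hsub).lt_or_eq with h1 | h1
    · exact Or.inl h1
    · refine Or.inr ⟨h1, ?_⟩
      dsimp only
      omega
  · obtain ⟨b', hb'⟩ := hlt w' hw'
    refine hmin (w', b') ⟨hw', hb'⟩ (Prod.Lex.toLex_lt_toLex.mpr (Or.inl ?_))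
    refine Finset.card_lt_card (Finset.ssubset_iff_subset_ne.mpr ⟨hsub, fun h3 => ?_⟩)
    have h4 : b ∈ Finset.univ.filter (fun c => w' c ≠ D₀) := by
      rw [h3]
      simpa using hb.ne
    exact (Finset.mem_filter.mp h4).2 (le_antisymm (hle w' hw' b) (not_lt.mp h))

variable {W : Type*} [AddCommGroup W] [Module ℚ W] {x p : ι → κ → Module.End ℚ W}

/-- A filtered weight structure on a subquotient `Z / B` of a module over the Weyl algebra, on
which the variables, the polarizations and the lowering operators act. -/
structure WeightData (d : ℕ) (x p : ι → κ → Module.End ℚ W) (Z B : Submodule ℚ W) where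
  wt : (κ → ℤ) → (ι → ℤ) → Submodule ℚ W
  xB : ∀ i b, ∀ h ∈ B, x i b h ∈ B
  lowB : ∀ i b, ∀ h ∈ B, lowOp d x p i b h ∈ B
  colB : ∀ a b, ∀ h ∈ B, colPol x p a b h ∈ B
  xZ : ∀ i b, ∀ h ∈ Z, x i b h ∈ Z
  lowZ : ∀ i b, ∀ h ∈ Z, lowOp d x p i b h ∈ Z
  colZ : ∀ a b, ∀ h ∈ Z, colPol x p a b h ∈ Z
  x_wt : ∀ i b w r, ∀ h ∈ wt w r, x i b h ∈ wt (w + Pi.single b 1) (r + Pi.single i 1)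
  low_wt : ∀ i b w r, ∀ h ∈ wt w r, lowOp d x p i b h ∈ wt (w - Pi.single b 1) (r - Pi.single i 1)
  col_wt : ∀ a b w r, ∀ h ∈ wt w r, colPol x p a b h ∈ wt (w + Pi.single a 1 - Pi.single b 1) r
  col_self : ∀ a w r, ∀ h ∈ wt w r, h ∈ Z → colPol x p a a h - (w a : ℚ) • h ∈ B
  row_self : ∀ i w r, ∀ h ∈ wt w r, h ∈ Z → rowPol x p i i h - (r i : ℚ) • h ∈ B

namespace WeightData

variable {d : ℕ} {Z B : Submodule ℚ W} (D : WeightData d x p Z B) (hx : IsWeylPair x p)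
include D

theorem sum_eq {w : κ → ℤ} {r : ι → ℤ} {h : W} (hw : h ∈ D.wt w r) (hZ : h ∈ Z) (hB : h ∉ B) :
    ∑ i, r i = ∑ a, w a := by
  have h1 : ∑ i, (rowPol x p i i h - (r i : ℚ) • h) ∈ B :=
    sum_mem fun i _ => D.row_self i w r h hw hZ
  have h2 : ∑ a, (colPol x p a a h - (w a : ℚ) • h) ∈ B :=
    sum_mem fun i _ => D.col_self i w r h hw hZ
  have h3 := congrArg (fun T : Module.End ℚ W => T h) (IsWeylPair.sum_rowPol (x := x) (p := p))
  simp only [LinearMap.sum_apply] at h3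
  have h4 := B.sub_mem h2 h1
  rw [Finset.sum_sub_distrib, Finset.sum_sub_distrib, ← h3, ← Finset.sum_smul, ← Finset.sum_smul,
    sub_sub_sub_cancel_left, ← sub_smul] at h4
  by_contra hne
  refine hB ((B.smul_mem_iff (sub_ne_zero.mpr ?_)).mp h4)
  exact_mod_cast hne

include hx

/-- Raising after lowering a vector killed by the raising operator. -/
theorem x_low_pow {w : κ → ℤ} {r : ι → ℤ} {h : W} (hw : h ∈ D.wt w r) (hZ : h ∈ Z) (i : ι) (b : κ)
    (hxh : x i b h ∈ B) (k : ℕ) :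
    x i b ((lowOp d x p i b ^ (k + 1)) h)
      + ((k + 1) * ((w b - d + r i + Fintype.card κ) - k) : ℚ) • (lowOp d x p i b ^ k) h ∈ B := by
  set T := lowOp d x p i b
  set μ : ℚ := w b - d + r i + Fintype.card κ with hμ
  have hk : ∀ k : ℕ, (T ^ k) h ∈ Z ∧
      (T ^ k) h ∈ D.wt (w - k • Pi.single b 1) (r - k • Pi.single i 1) := by
    intro k
    induction k with
    | zero => simpa using ⟨hZ, hw⟩
    | succ k ih =>
      rw [pow_succ', Module.End.mul_apply]
      refine ⟨D.lowZ i b _ ih.1, ?_⟩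
      have := D.low_wt i b _ _ _ ih.2
      rwa [sub_sub, sub_sub, ← succ_nsmul, ← succ_nsmul] at this
  have step : ∀ k : ℕ, x i b ((T ^ (k + 1)) h) - T (x i b ((T ^ k) h))
      + (μ - 2 * k) • (T ^ k) h ∈ B := by
    intro k
    have h1 := D.col_self b _ _ _ (hk k).2 (hk k).1
    have h2 := D.row_self i _ _ _ (hk k).2 (hk k).1
    have h3 := LinearMap.congr_fun (hx.lowOp_x_self d i b) ((T ^ k) h)
    simp only [LinearMap.add_apply, Module.End.mul_apply, LinearMap.sub_apply,
      Module.End.natCast_apply] at h3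
    have h4 := B.neg_mem (B.add_mem h1 h2)
    convert h4 using 1
    rw [pow_succ', Module.End.mul_apply, h3, ← Nat.cast_smul_eq_nsmul ℚ, ← Nat.cast_smul_eq_nsmul ℚ]
    simp only [Pi.sub_apply, Pi.smul_apply, Pi.single_eq_same, nsmul_one, hμ]
    push_cast
    module
  induction k with
  | zero =>
    have h0 : T (x i b h) ∈ B := D.lowB i b _ hxh
    convert B.add_mem (step 0) h0 using 1
    simp only [zero_add, pow_one, pow_zero, Module.End.one_apply, Nat.cast_zero]
    module
  | succ k ih =>
    have h1 := B.add_mem (step (k + 1)) (D.lowB i b _ ih)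
    convert h1 using 1
    rw [map_add, map_smul, ← Module.End.mul_apply T (T ^ k), ← pow_succ']
    push_cast
    module

theorem le_of_nilpotent {w : κ → ℤ} {r : ι → ℤ} {h : W} (hw : h ∈ D.wt w r) (hZ : h ∈ Z)
    (hB : h ∉ B) (i : ι) (b : κ) (hxh : x i b h ∈ B) {k : ℕ}
    (hk : ∀ h ∈ Z, (x i b ^ k) h ∈ B) : 0 ≤ w b - d + r i + Fintype.card κ := by
  set T := lowOp d x p i b
  have hTZ : ∀ l : ℕ, (T ^ l) h ∈ Z := by
    intro l
    induction l with
    | zero => simpa using hZ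
    | succ l ih =>
      rw [pow_succ', Module.End.mul_apply]
      exact D.lowZ i b _ ih
  by_contra! hneg
  have hxB : ∀ l : ℕ, ∀ u ∈ B, (x i b ^ l) u ∈ B := by
    intro l u hu
    induction l with
    | zero => simpa using hu
    | succ l ih =>
      rw [pow_succ', Module.End.mul_apply]
      exact D.xB i b _ ih
  have key : ∀ l : ℕ, (x i b ^ l) ((T ^ l) h) ∉ B := by
    intro l hl
    induction l with
    | zero => exact hB (by simpa using hl)
    | succ l ih =>
      have h1 := hxB l _ (D.x_low_pow hx hw hZ i b hxh l)
      rw [map_add, map_smul, ← Module.End.mul_apply, ← pow_succ] at h1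
      refine ih ((B.smul_mem_iff ?_).mp ((B.add_mem_iff_right hl).mp h1))
      have h2 : (w b - d + r i + Fintype.card κ : ℚ) < 0 := by exact_mod_cast hneg
      have h3 : (0 : ℚ) ≤ l := l.cast_nonneg
      refine mul_ne_zero (by positivity) (by linarith)
  exact key k (hk _ (hTZ k))

/-- A subquotient with bounded weights on which the variables are nilpotent is trivial. -/
theorem wt_inf_le (hcard : Fintype.card κ < Fintype.card ι) (hd : Fintype.card κ ≤ d)
    (hbd : ∀ w r, ∀ h ∈ D.wt w r, h ∈ Z → (∃ a, (d : ℤ) - Fintype.card κ < w a) → h ∈ B)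
    (htop : ∀ w r, ∀ h ∈ D.wt w r, h ∈ Z → (∀ a, w a = d - Fintype.card κ) → h ∈ B)
    (hnil : ∀ i b, ∃ k, ∀ h ∈ Z, (x i b ^ k) h ∈ B) (w : κ → ℤ) (r : ι → ℤ) :
    D.wt w r ⊓ Z ≤ B := by
  set D₀ : ℤ := d - Fintype.card κ with hD₀
  by_contra hcon
  let A : Set (κ → ℤ) := {w | ∃ r, ∃ h ∈ D.wt w r, h ∈ Z ∧ h ∉ B}
  have hA : A.Nonempty := by
    obtain ⟨h, ⟨h1, h2⟩, h3⟩ := Set.not_subset.mp hcon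
    exact ⟨w, r, h, h1, h2, h3⟩
  have hle : ∀ w ∈ A, ∀ a, w a ≤ D₀ := by
    rintro w ⟨r, h, h1, h2, h3⟩ a
    by_contra! h4
    exact h3 (hbd w r h h1 h2 ⟨a, h4⟩)
  have hlt : ∀ w ∈ A, ∃ a, w a < D₀ := by
    intro w hw
    by_contra! h4
    obtain ⟨r, h, h1, h2, h3⟩ := id hw
    exact h3 (htop w r h h1 h2 fun a => le_antisymm (hle w hw a) (h4 a))
  clear w r hcon
  obtain ⟨w, hwA, b, hb, hmax⟩ := exists_lex_maximal hA hle hlt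
  obtain ⟨r, h, hw, hZ, hB⟩ := id hwA
  have hxh : ∀ i, x i b h ∈ B := by
    intro i
    by_contra hne
    refine hmax _ ⟨_, _, D.x_wt i b w r h hw, D.xZ i b h hZ, hne⟩ (fun c hc hcb => ?_) ?_
    · simp [hcb, hc]
    · simp
  have hbc : ∀ c, c ≠ b → w c ≠ D₀ → colPol x p b c h ∈ B := by
    intro c hcb hc
    by_contra hne
    refine hmax _ ⟨_, _, D.col_wt b c w r h hw, D.colZ b c h hZ, hne⟩ (fun e he heb => ?_) ?_
    · have hec : e ≠ c := by rintro rfl; exact hc he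
      simp [heb, he, hec]
    · simp [hcb.symm]
  have hcb : ∀ c, c ≠ b → w c = D₀ → colPol x p c b h ∈ B := by
    intro c hcb hc
    by_contra hne
    have := hle _ ⟨_, _, D.col_wt c b w r h hw, D.colZ c b h hZ, hne⟩ c
    simp [hcb, hc] at this
  have hself : ∀ c, colPol x p c c h - (w c : ℚ) • h ∈ B := fun c => D.col_self c w r h hw hZ
  let f : κ → ℚ := fun c => if c = b then w b * (w b - d) else if w c = D₀ then 0 else w b - w c
  have hf : ∀ c, (colPol x p b c * (colPol x p c b - if c = b then (d : Module.End ℚ W) else 0)) h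
      - f c • h ∈ B := by
    intro c
    rw [Module.End.mul_apply]
    by_cases h1 : c = b
    · subst h1
      simp only [f, if_true, LinearMap.sub_apply, Module.End.natCast_apply]
      have h2 := B.add_mem (D.colB c c _ (hself c)) (B.smul_mem (w c - d : ℚ) (hself c))
      convert h2 using 1
      simp only [← Nat.cast_smul_eq_nsmul ℚ, map_sub, map_smul]
      module
    · simp only [f, if_neg h1, sub_zero]
      by_cases h2 : w c = D₀
      · simpa [h2] using D.colB b c _ (hcb c h1 h2)
      · rw [if_neg h2]
        have h3 := LinearMap.congr_fun (hx.colPol_colPol b c c b) h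
        simp only [if_true, LinearMap.add_apply, LinearMap.sub_apply, Module.End.mul_apply] at h3
        have h4 := B.sub_mem (B.add_mem (D.colB c b _ (hbc c h1 h2)) (hself b)) (hself c)
        rw [h3]
        convert h4 using 1
        module
  obtain ⟨s, hs⟩ : ∃ s, s = (Finset.univ.filter fun c => w c = D₀).card := ⟨_, rfl⟩
  have hsn : s < Fintype.card κ := by
    rw [hs, ← Finset.card_univ]
    refine Finset.card_lt_card (Finset.ssubset_univ_iff.mpr fun h => ?_)
    have := Finset.mem_univ b
    rw [← h, Finset.mem_filter] at this
    exact hb.ne this.2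
  have hfw : ∑ c, (f c + w c) =
      s * D₀ + (Fintype.card κ - s) * w b + w b * (w b - d) := by
    have h1 : ∀ c, f c + w c = w b + (if w c = D₀ then (D₀ - w b : ℚ) else 0)
        + if c = b then (w b * (w b - d) : ℚ) else 0 := by
      intro c
      simp only [f]
      split_ifs with h1 h2 h2
      · exact absurd (h1 ▸ h2) hb.ne
      · rw [h1]; ring
      · rw [h2]; ring
      · ring
    rw [Finset.sum_congr rfl fun c _ => h1 c, Finset.sum_add_distrib, Finset.sum_add_distrib,
      Finset.sum_ite_eq', ← Finset.sum_filter, Finset.sum_const, Finset.sum_const, ← hs,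
      Finset.card_univ]
    simp only [Finset.mem_univ, if_true, nsmul_eq_mul]
    ring
  have hq : (w b - D₀) * (w b + Fintype.card ι - s) = 0 := by
    by_contra hne
    have h1 : ∑ i, lowOp d x p i b (x i b h) ∈ B := sum_mem fun i _ => D.lowB i b _ (hxh i)
    have h2 := LinearMap.congr_fun (hx.sum_lowOp_x d b) h
    rw [IsWeylPair.sum_rowPol] at h2
    simp only [LinearMap.sum_apply, LinearMap.add_apply] at h2
    have h3 : ∑ c, ((colPol x p b c * (colPol x p c b - if c = b then (d : Module.End ℚ W) else 0)) h
      - f c • h) ∈ B := sum_mem fun c _ => hf c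
    have h4 : ∑ c, (colPol x p c c h - (w c : ℚ) • h) ∈ B := sum_mem fun c _ => hself c
    have h5 := B.sub_mem h1 (B.add_mem (B.add_mem h3 h4)
      (B.smul_mem (Fintype.card ι : ℚ) (hself b)))
    have hne' : ((w b - D₀) * (w b + Fintype.card ι - s) : ℚ) ≠ 0 := by exact_mod_cast hne
    refine hB ((B.smul_mem_iff hne').mp ?_)
    convert h5 using 1
    simp only [Module.End.mul_apply (lowOp d x p _ b) (x _ b)] at h2
    rw [h2, Finset.sum_sub_distrib, Finset.sum_sub_distrib, ← Finset.sum_smul, ← Finset.sum_smul]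
    simp only [Module.End.mul_apply _ (_ - (d : Module.End ℚ W)), LinearMap.sub_apply, Module.End.natCast_apply]
    have h6 : ∑ c, f c = s * D₀ + (Fintype.card κ - s) * w b + w b * (w b - d) - ∑ c, (w c : ℚ) := by
      rw [← hfw, Finset.sum_add_distrib, add_sub_cancel_right]
    rw [h6, hD₀, ← Nat.cast_mul, Module.End.natCast_apply]
    simp only [← Nat.cast_smul_eq_nsmul ℚ]
    push_cast
    module
  have hwb : w b = s - Fintype.card ι := by
    rcases mul_eq_zero.mp hq with h1 | h1
    · omega
    · omega
  have hr : ∀ i, D₀ + Fintype.card ι - s ≤ r i := by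
    intro i
    obtain ⟨k, hk⟩ := hnil i b
    have := D.le_of_nilpotent hx hw hZ hB i b (hxh i) hk
    omega
  have h1 : ∑ i : ι, (D₀ + Fintype.card ι - s : ℤ) ≤ ∑ a, w a :=
    (Finset.sum_le_sum fun i _ => hr i).trans (D.sum_eq hw hZ hB).le
  have h2 : ∑ a, w a ≤ (Fintype.card κ - 1) * D₀ + (s - Fintype.card ι) := by
    rw [← Finset.sum_erase_add _ _ (Finset.mem_univ b), hwb]
    refine add_le_add_left ((Finset.sum_le_card_nsmul _ _ D₀ fun a _ => hle w hwA a).trans ?_) _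
    rw [Finset.card_erase_of_mem (Finset.mem_univ b), Finset.card_univ, nsmul_eq_mul,
      Nat.cast_sub (by omega), Nat.cast_one]
  rw [Finset.sum_const, Finset.card_univ, nsmul_eq_mul] at h1
  have h3 : (0 : ℤ) ≤ D₀ := by omega
  have h4 : (s : ℤ) < Fintype.card κ := by exact_mod_cast hsn
  have h5 : (Fintype.card κ : ℤ) < Fintype.card ι := by exact_mod_cast hcard
  nlinarith [mul_nonneg h3 (sub_nonneg.mpr h5.le), mul_pos (show (0:ℤ) < Fintype.card ι by omega)
    (show (0:ℤ) < Fintype.card ι - s by omega)]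

end WeightData

end Chain

section Xi

variable {σ : Type*} [DecidableEq σ] {V : Type*} [AddCommGroup V] [Module ℚ V]

/-- Coefficientwise action of an operator on polynomials with coefficients in `V`. -/
noncomputable def xiMap (σ : Type*) {V : Type*} [AddCommGroup V] [Module ℚ V] :
    Module.End ℚ V →+* Module.End ℚ ((σ →₀ ℕ) →₀ V) where
  toFun a := Finsupp.mapRange.linearMap a
  map_one' := Finsupp.mapRange.linearMap_id
  map_mul' a b := Finsupp.mapRange.linearMap_comp a b
  map_zero' := by ext; simp
  map_add' a b := by ext; simp

theorem xiMap_apply (a : Module.End ℚ V) (z : (σ →₀ ℕ) →₀ V) (α : σ →₀ ℕ) :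
    xiMap σ a z α = a (z α) := by
  simp [xiMap]

theorem xiMap_single (a : Module.End ℚ V) (α : σ →₀ ℕ) (u : V) :
    xiMap σ a (Finsupp.single α u) = Finsupp.single α (a u) := by
  simp [xiMap]

/-- Multiplication by a variable on polynomials with coefficients in `V`. -/
noncomputable def xiMul (V : Type*) [AddCommGroup V] [Module ℚ V] (v : σ) :
    Module.End ℚ ((σ →₀ ℕ) →₀ V) :=
  Finsupp.lmapDomain V ℚ (· + Finsupp.single v 1)

/-- Partial derivatives on polynomials with coefficients in `V`. -/
noncomputable def xiDer (V : Type*) [AddCommGroup V] [Module ℚ V] (v : σ) :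
    Module.End ℚ ((σ →₀ ℕ) →₀ V) :=
  Finsupp.lsum ℚ fun α => (α v : ℚ) • Finsupp.lsingle (α - Finsupp.single v 1)

theorem xiMul_single (v : σ) (α : σ →₀ ℕ) (u : V) :
    xiMul V v (Finsupp.single α u) = Finsupp.single (α + Finsupp.single v 1) u := by
  simp [xiMul]

theorem xiDer_single (v : σ) (α : σ →₀ ℕ) (u : V) :
    xiDer V v (Finsupp.single α u) = Finsupp.single (α - Finsupp.single v 1) ((α v : ℚ) • u) := by
  simp [xiDer]

theorem commute_xiMap_xiMul (a : Module.End ℚ V) (v : σ) : Commute (xiMap σ a) (xiMul V v) := by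
  refine Finsupp.lhom_ext fun α u => ?_
  simp only [Module.End.mul_apply, xiMap_single, xiMul_single]

theorem commute_xiMap_xiDer (a : Module.End ℚ V) (v : σ) : Commute (xiMap σ a) (xiDer V v) := by
  refine Finsupp.lhom_ext fun α u => ?_
  simp only [Module.End.mul_apply, xiMap_single, xiDer_single, map_smul]

theorem commute_xiMul (v w : σ) : Commute (xiMul V v) (xiMul V w) := by
  refine Finsupp.lhom_ext fun α u => ?_
  simp only [Module.End.mul_apply, xiMul_single, add_right_comm]

theorem commute_xiDer (v w : σ) : Commute (xiDer V v) (xiDer V w) := by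
  refine Finsupp.lhom_ext fun α u => ?_
  simp only [Module.End.mul_apply, xiDer_single, smul_smul, tsub_right_comm]
  congr 2
  by_cases h : v = w
  · rw [h]
  · simp [Finsupp.single_eq_of_ne h, Finsupp.single_eq_of_ne' h, mul_comm]

theorem xiDer_xiMul (v w : σ) :
    xiDer V v * xiMul V w = xiMul V w * xiDer V v + if v = w then 1 else 0 := by
  refine Finsupp.lhom_ext fun α u => ?_
  simp only [Module.End.mul_apply, xiDer_single, xiMul_single, LinearMap.add_apply]
  by_cases h : v = w
  · subst h
    rw [add_tsub_cancel_right, if_pos rfl, Module.End.one_apply]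
    by_cases h0 : α v = 0
    · simp [h0]
    · rw [tsub_add_cancel_of_le, ← Finsupp.single_add]
      · congr 1
        simp [add_smul]
      · rw [Finsupp.single_le_iff]; omega
  · rw [if_neg h, LinearMap.zero_apply, add_zero]
    simp only [Finsupp.add_apply, Finsupp.single_eq_of_ne h, add_zero]
    by_cases h0 : α v = 0
    · simp [h0]
    · rw [tsub_add_eq_add_tsub]
      rw [Finsupp.single_le_iff]; omega

theorem xiDer_apply (v : σ) (z : (σ →₀ ℕ) →₀ V) (α : σ →₀ ℕ) :
    xiDer V v z α = (α v + 1 : ℚ) • z (α + Finsupp.single v 1) := by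
  induction z using Finsupp.induction_linear with
  | zero => simp
  | add f g hf hg => rw [map_add, Finsupp.add_apply, hf, hg, Finsupp.add_apply, smul_add]
  | single β u =>
    rw [xiDer_single, Finsupp.single_apply, Finsupp.single_apply]
    by_cases h : β = α + Finsupp.single v 1
    · subst h
      simp
    · rw [if_neg h, smul_zero]
      split_ifs with h1
      · have h0 : β v = 0 := by
          by_contra h0
          refine h ?_
          rw [← h1, tsub_add_cancel_of_le]
          rw [Finsupp.single_le_iff]; omega
        simp [h0]
      · rfl

theorem xiMul_xiDer_apply (v : σ) (z : (σ →₀ ℕ) →₀ V) (α : σ →₀ ℕ) :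
    (xiMul V v * xiDer V v) z α = (α v : ℚ) • z α := by
  induction z using Finsupp.induction_linear with
  | zero => simp
  | add f g hf hg => rw [map_add, Finsupp.add_apply, hf, hg, Finsupp.add_apply, smul_add]
  | single β u =>
    rw [Module.End.mul_apply, xiDer_single, xiMul_single]
    by_cases h0 : β v = 0
    · rw [h0, Nat.cast_zero, zero_smul, Finsupp.single_zero, Finsupp.zero_apply]
      by_cases h : β = α
      · rw [← h, h0]; simp
      · simp [h]
    · rw [tsub_add_cancel_of_le (by rw [Finsupp.single_le_iff]; omega)]
      by_cases h : β = α
      · rw [h]; simp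
      · simp [h]

end Xi

section Eigen

variable {W : Type*} [AddCommGroup W] [Module ℚ W]

theorem mem_of_prod_sub_eq_zero {G : Module.End ℚ W} {P Q : Submodule ℚ W}
    (hP : ∀ z ∈ P, G z ∈ P) (hQ : ∀ z ∈ P, ∀ k : ℤ, G z = (k : ℚ) • z → z ∈ Q) (F : Finset ℤ) {z : W}
    (hz : z ∈ P) (hF : (∏ k ∈ F, (Polynomial.X - Polynomial.C (k : ℚ))).aeval G z = 0) : z ∈ Q := by
  classical
  have hpol : ∀ (q : Polynomial ℚ), ∀ z ∈ P, q.aeval G z ∈ P := by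
    intro q z hz
    induction q using Polynomial.induction_on' with
    | add p q hp hq => rw [map_add, LinearMap.add_apply]; exact add_mem hp hq
    | monomial n a =>
      rw [Polynomial.aeval_monomial, Module.End.mul_apply, Module.algebraMap_end_apply]
      refine P.smul_mem _ ?_
      induction n with
      | zero => simpa using hz
      | succ n ih => rw [pow_succ', Module.End.mul_apply]; exact hP _ ih
  have heig : ∀ (q : Polynomial ℚ) (k : ℚ) (u : W), G u = k • u → q.aeval G u = q.eval k • u := by
    intro q k u hu
    exact Module.End.aeval_apply_of_mem_apply_eq_smul hu
  induction F using Finset.induction_on generalizing z with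
  | empty => simp at hF; rw [hF]; exact Q.zero_mem
  | insert k F hk ih => 
    set q : Polynomial ℚ := ∏ k ∈ F, (Polynomial.X - Polynomial.C (k : ℚ)) with hq
    rw [Finset.prod_insert hk, ← hq, map_mul, Module.End.mul_apply] at hF
    set u := q.aeval G z with hu
    have huk : G u = (k : ℚ) • u := by
      rwa [map_sub, Polynomial.aeval_X, Polynomial.aeval_C, LinearMap.sub_apply,
        Module.algebraMap_end_apply, sub_eq_zero] at hF
    have huP : u ∈ P := hpol _ _ hz
    have hc : q.eval (k : ℚ) ≠ 0 := by
      rw [hq, Polynomial.eval_prod, Finset.prod_ne_zero_iff]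
      intro l hl
      simp only [Polynomial.eval_sub, Polynomial.eval_X, Polynomial.eval_C, sub_ne_zero]
      rintro h
      exact hk (by rwa [Int.cast_injective h])
    have h1 : z - (q.eval (k : ℚ))⁻¹ • u ∈ Q := by
      refine ih (sub_mem hz (P.smul_mem _ huP)) ?_
      rw [map_sub, map_smul, heig q k u huk, smul_smul, inv_mul_cancel₀ hc, one_smul, ← hu, sub_self]
    have := add_mem h1 (Q.smul_mem (q.eval (k : ℚ))⁻¹ (hQ u huP k huk))
    rwa [sub_add_cancel] at this

theorem le_of_joint_eigenvectors {τ : Type*} {G : τ → Module.End ℚ W} (T : Finset τ)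
    (hdiag : ∀ t z, ∃ F : Finset ℤ, (∏ k ∈ F, (Polynomial.X - Polynomial.C (k : ℚ))).aeval (G t) z = 0)
    (hcomm : ∀ s t, Commute (G s) (G t)) {P Q : Submodule ℚ W} (hP : ∀ t, ∀ z ∈ P, G t z ∈ P)
    (hQ : ∀ z ∈ P, ∀ k : τ → ℤ, (∀ t ∈ T, G t z = (k t : ℚ) • z) → z ∈ Q) : P ≤ Q := by
  classical
  induction T using Finset.induction_on with
  | empty => exact fun z hz => hQ z hz 0 (by simp)
  | insert s T hs ih =>
    refine ih fun z hz k hk => ?_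
    let P' : Submodule ℚ W := P ⊓ ⨅ t ∈ T, LinearMap.ker (G t - (k t : ℚ) • (1 : Module.End ℚ W))
    have memP' : ∀ z, z ∈ P' ↔ z ∈ P ∧ ∀ t ∈ T, G t z = (k t : ℚ) • z := fun z => by
      simp [P', Submodule.mem_iInf, sub_eq_zero]
    obtain ⟨F, hF⟩ := hdiag s z
    refine mem_of_prod_sub_eq_zero (G := G s) (P := P') (fun y hy => ?_) (fun y hy l hl => ?_) F
      ((memP' z).mpr ⟨hz, hk⟩) hF
    · obtain ⟨h1, h2⟩ := (memP' y).mp hy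
      refine (memP' _).mpr ⟨hP s y h1, fun t ht => ?_⟩
      rw [← Module.End.mul_apply, (hcomm t s).eq, Module.End.mul_apply, h2 t ht, map_smul]
    · obtain ⟨h1, h2⟩ := (memP' y).mp hy
      refine hQ y h1 (Function.update k s l) fun t ht => ?_
      rcases Finset.mem_insert.mp ht with rfl | htT
      · simpa using hl
      · rw [Function.update_of_ne (fun h => hs (by rwa [← h]))]
        exact h2 t htT

/-- Operators that are diagonal with integral entries in some system of coordinates. -/
theorem exists_prod_sub_eq_zero {C : Type*} {co : C → W →ₗ[ℚ] ℚ} (hco : ∀ z, (∀ c, co c z = 0) → z = 0)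
    (hfin : ∀ z, {c | co c z ≠ 0}.Finite) {G : Module.End ℚ W} {g : C → ℤ}
    (hG : ∀ z c, co c (G z) = g c * co c z) (z : W) :
    ∃ F : Finset ℤ, (∏ k ∈ F, (Polynomial.X - Polynomial.C (k : ℚ))).aeval G z = 0 := by
  classical
  refine ⟨(hfin z).toFinset.image g, hco _ fun c => ?_⟩
  have h1 : ∀ (q : Polynomial ℚ) (z : W), co c (q.aeval G z) = q.eval (g c : ℚ) * co c z := by
    intro q z
    induction q using Polynomial.induction_on' with
    | add p q hp hq => rw [map_add, LinearMap.add_apply, map_add, hp, hq, Polynomial.eval_add, add_mul]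
    | monomial n a =>
      rw [Polynomial.aeval_monomial, Module.End.mul_apply, Module.algebraMap_end_apply, map_smul,
        Polynomial.eval_monomial, smul_eq_mul, mul_assoc]
      congr 1
      induction n with
      | zero => simp
      | succ n ih => rw [pow_succ', Module.End.mul_apply, hG, ih, pow_succ', mul_assoc]
  rw [h1, Polynomial.eval_prod]
  by_cases h : co c z = 0
  · rw [h, mul_zero]
  · rw [Finset.prod_eq_zero (i := g c), zero_mul]
    · exact Finset.mem_image_of_mem g ((hfin z).mem_toFinset.mpr h)
    · simp

theorem commute_of_diagonal {C : Type*} {co : C → W →ₗ[ℚ] ℚ} (hco : ∀ z, (∀ c, co c z = 0) → z = 0)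
    {G G' : Module.End ℚ W} {g g' : C → ℤ} (hG : ∀ z c, co c (G z) = g c * co c z)
    (hG' : ∀ z c, co c (G' z) = g' c * co c z) : Commute G G' :=
  LinearMap.ext fun z => sub_eq_zero.mp <| hco _ fun c => by
    rw [map_sub, Module.End.mul_apply, Module.End.mul_apply, hG, hG', hG', hG]
    ring

end Eigen

section XiFock

variable {ι κ : Type*} [Fintype ι] [Fintype κ] [DecidableEq ι] [DecidableEq κ]

local notation "𝓦" => Finset (ι × κ) → MvPolynomial (ι × κ) ℚ
local notation "𝓖" => (ι × κ →₀ ℕ) →₀ Finset (ι × κ) → MvPolynomial (ι × κ) ℚ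
local notation "𝓓" => koszul (R := Module.End ℚ 𝓦) fX (fockI ℚ)
local notation "𝓣" => totPol (R := Module.End ℚ 𝓦) fX fP (fockE ℚ) (fockI ℚ)

/-- Multiplication by variables on Fock space with additional polynomial variables. -/
noncomputable abbrev gX (i : ι) (a : κ) : Module.End ℚ 𝓖 := xiMap (ι × κ) (fX i a)

/-- The operators `∂ / ∂x + ξ`. -/
noncomputable abbrev gP (i : ι) (a : κ) : Module.End ℚ 𝓖 :=
  xiMap (ι × κ) (fP i a) + xiMul 𝓦 (i, a)

/-- Exterior multiplication, coefficientwise. -/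
noncomputable abbrev gE (v : ι × κ) : Module.End ℚ 𝓖 := xiMap (ι × κ) (fockE ℚ v)

/-- Contraction, coefficientwise. -/
noncomputable abbrev gI (v : ι × κ) : Module.End ℚ 𝓖 := xiMap (ι × κ) (fockI ℚ v)

/-- The operators `x + ∂ / ∂ξ`. -/
noncomputable abbrev gY (v : ι × κ) : Module.End ℚ 𝓖 := gX v.1 v.2 + xiDer 𝓦 v

theorem commute_xiMap {σ V : Type*} [AddCommGroup V] [Module ℚ V] {a b : Module.End ℚ V}
    (h : Commute a b) : Commute (xiMap σ a) (xiMap σ b) := h.map (xiMap σ)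

theorem superWeyl_g : IsSuperWeyl (R := Module.End ℚ 𝓖) gX gP gE gI where
  weyl :=
    { xx := fun i a k b => (commute_xiMap (superWeyl_poly.weyl.xx i a k b)).eq
      pp := fun i a k b => by
        have h1 := (commute_xiMap (σ := ι × κ) (superWeyl_poly.weyl.pp i a k b)).eq
        have h2 := (commute_xiMap_xiMul (fP k b) (i, a)).eq
        have h3 := (commute_xiMap_xiMul (fP i a) (k, b)).eq
        have h4 := (commute_xiMul (V := 𝓦) (i, a) (k, b)).eq
        simp only [gP, add_mul, mul_add, h1, h2, h3, h4]
        abel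
      px := fun i a k b => by
        have h1 := congrArg (xiMap (ι × κ)) (superWeyl_poly.weyl.px i a k b)
        have h2 := (commute_xiMap_xiMul (fX k b) (i, a)).eq
        rw [map_add, map_mul, map_mul] at h1
        simp only [gP, gX, add_mul, mul_add, h1, h2]
        split_ifs
        · rw [map_one]; abel
        · rw [map_zero]; abel }
  fermi :=
    { ee := fun u v => by
        simp only [gE, ← map_mul, ← map_neg, (isFermiPair_fock ℚ).ee u v]
      jj := fun u v => by
        simp only [gI, ← map_mul, ← map_neg, (isFermiPair_fock ℚ).jj u v]
      je := fun u v => by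
        simp only [gE, gI, ← map_mul, (isFermiPair_fock ℚ).je u v, map_sub]
        split_ifs
        · rw [map_one]
        · rw [map_zero] }
  xe i a v := commute_xiMap (superWeyl_poly.xe i a v)
  xj i a v := commute_xiMap (superWeyl_poly.xj i a v)
  pe i a v := (commute_xiMap (superWeyl_poly.pe i a v)).add_left (commute_xiMap_xiMul _ _).symm
  pj i a v := (commute_xiMap (superWeyl_poly.pj i a v)).add_left (commute_xiMap_xiMul _ _).symm

theorem commute_gY_gX (v : ι × κ) (i : ι) (a : κ) : Commute (gY v) (gX i a : Module.End ℚ 𝓖) :=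
  Commute.add_left (superWeyl_g.weyl.xx _ _ _ _) (commute_xiMap_xiDer _ _).symm

theorem commute_gY_gY (v w : ι × κ) : Commute (gY v) (gY w : Module.End ℚ 𝓖) :=
  (commute_gY_gX v _ _).add_right
    ((commute_xiMap_xiDer _ _).add_left (commute_xiDer _ _))

theorem commute_gY_gI (v w : ι × κ) : Commute (gY v) (gI w : Module.End ℚ 𝓖) :=
  Commute.add_left (superWeyl_g.xj _ _ _) (commute_xiMap_xiDer _ _).symm

theorem commute_gY_gE (v w : ι × κ) : Commute (gY v) (gE w : Module.End ℚ 𝓖) :=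
  Commute.add_left (superWeyl_g.xe _ _ _) (commute_xiMap_xiDer _ _).symm

theorem commute_gY_gP (v : ι × κ) (i : ι) (a : κ) : Commute (gY v) (gP i a : Module.End ℚ 𝓖) := by
  have h1 : gP i a * gX v.1 v.2 = gX v.1 v.2 * gP i a + if i = v.1 ∧ a = v.2 then 1 else 0 :=
    superWeyl_g.weyl.px i a v.1 v.2
  have h2 := xiDer_xiMul (V := 𝓦) v (i, a)
  have h3 := (commute_xiMap_xiDer (fP i a) v).eq
  have h4 : (v = (i, a)) ↔ (i = v.1 ∧ a = v.2) := by
    rw [Prod.ext_iff]; exact and_congr eq_comm eq_comm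
  simp only [h4] at h2
  rw [Commute, SemiconjBy, gY, add_mul, mul_add (gP i a) (gX v.1 v.2), h1, gP, mul_add, mul_add,
    add_mul _ _ (xiDer _ _), h2, h3]
  abel

/-- The total Koszul differential. -/
noncomputable def gDiff (ι κ : Type*) [Fintype ι] [Fintype κ] [DecidableEq ι] [DecidableEq κ] :
    Module.End ℚ ((ι × κ →₀ ℕ) →₀ Finset (ι × κ) → MvPolynomial (ι × κ) ℚ) :=
  ∑ v, gY v * gI v

theorem gDiff_mul_self : gDiff ι κ * gDiff ι κ = 0 :=
  superWeyl_g.fermi.sq_eq_zero _ commute_gY_gI commute_gY_gY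

theorem commute_gDiff_gX (i : ι) (a : κ) : Commute (gDiff ι κ) (gX i a) :=
  Commute.sum_left _ _ _ fun v _ => (commute_gY_gX v i a).mul_left (superWeyl_g.xj i a v).symm

theorem commute_gDiff_gP (i : ι) (a : κ) : Commute (gDiff ι κ) (gP i a) :=
  Commute.sum_left _ _ _ fun v _ => (commute_gY_gP v i a).mul_left (superWeyl_g.pj i a v).symm

theorem gDiff_apply (z : 𝓖) (α : ι × κ →₀ ℕ) :
    gDiff ι κ z α = 𝓓 (z α)
      + ∑ v, (α v + 1 : ℚ) • fockI ℚ v (z (α + Finsupp.single v 1)) := by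
  simp only [gDiff, LinearMap.sum_apply, Finsupp.finsetSum_apply, add_mul, LinearMap.add_apply,
    Finsupp.add_apply, Module.End.mul_apply, xiMap_apply, xiDer_apply, koszul,
    Finset.sum_add_distrib]

/-- The degree operator of a matrix position. -/
noncomputable def gDeg (v : ι × κ) : Module.End ℚ 𝓖 :=
  xiMap (ι × κ) (fX v.1 v.2 * fP v.1 v.2 + fockE ℚ v * fockI ℚ v) - xiMul 𝓦 v * xiDer 𝓦 v

theorem anticomm_aux {R : Type*} [Ring R] {y i x e c : R} (h1 : y * x = x * y + c)
    (h2 : i * e = c - e * i) (h3 : i * x = x * i) (h4 : y * e = e * y) :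
    y * i * (x * e) + x * e * (y * i) = x * y * c + c * c - c * (e * i) := by
  have e1 : y * i * (x * e) = y * x * (i * e) := by
    rw [mul_assoc, ← mul_assoc i, h3, mul_assoc, mul_assoc]
  have e2 : x * e * (y * i) = x * y * (e * i) := by
    rw [mul_assoc, ← mul_assoc e, ← h4, mul_assoc, mul_assoc]
  rw [e1, e2, h1, h2]
  simp only [add_mul, mul_sub]
  abel

theorem gDiff_htpy (w : ι × κ) :
    gDiff ι κ * (xiMul 𝓦 w * gE w) + xiMul 𝓦 w * gE w * gDiff ι κ =
      gX w.1 w.2 * gP w.1 w.2 - gDeg w + 1 := by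
  have key : ∀ v, gY v * gI v * (xiMul 𝓦 w * gE w) + xiMul 𝓦 w * gE w * (gY v * gI v)
      = if v = w then xiMul 𝓦 w * gY w + 1 - gE w * gI w else 0 := by
    intro v
    have h1 : gY v * xiMul 𝓦 w = xiMul 𝓦 w * gY v + if v = w then 1 else 0 := by
      rw [gY, add_mul, mul_add, xiDer_xiMul, (commute_xiMap_xiMul _ _).eq, add_assoc]
    have h2 : (gI v * gE w : Module.End ℚ 𝓖) = (if v = w then 1 else 0) - gE w * gI v :=
      superWeyl_g.fermi.je v w
    have h3 : gI v * xiMul 𝓦 w = xiMul 𝓦 w * gI v := (commute_xiMap_xiMul _ _).eq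
    have h4 := (commute_gY_gE v w).eq
    rw [anticomm_aux (R := Module.End ℚ 𝓖) h1 h2 h3 h4]
    rcases eq_or_ne v w with rfl | h
    · simp
    · simp [h]
  rw [gDiff, Finset.sum_mul, Finset.mul_sum, ← Finset.sum_add_distrib, Finset.sum_congr rfl fun v _ => key v,
    Finset.sum_ite_eq' Finset.univ w, if_pos (Finset.mem_univ w), gDeg, map_add, map_mul, map_mul, gY, gP,
    mul_add, mul_add, ← (commute_xiMap_xiMul (fX w.1 w.2) w).eq]
  abel

end XiFock

section Shift

variable {W : Type*} [AddCommGroup W] [Module ℚ W]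

/-- `T` shifts the eigenvalues of `G` by `u`. -/
def HasShift (G : Module.End ℚ W) (u : ℚ) (T : Module.End ℚ W) : Prop :=
  G * T = T * G + u • T

namespace HasShift

variable {G G' T T' : Module.End ℚ W} {u u' : ℚ}

theorem apply_eigenvector (h : HasShift G u T) {z : W} {c : ℚ} (hz : G z = c • z) :
    G (T z) = (c + u) • T z := by
  have := LinearMap.congr_fun h z
  simp only [LinearMap.add_apply, Module.End.mul_apply, hz, map_smul, LinearMap.smul_apply] at this
  rw [this, add_smul]

theorem of_commute (h : Commute G T) : HasShift G 0 T := by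
  rw [HasShift, h.eq, zero_smul, add_zero]

theorem commute (h : HasShift G 0 T) : Commute G T := by
  rw [HasShift, zero_smul, add_zero] at h
  exact h

theorem mul (h : HasShift G u T) (h' : HasShift G u' T') : HasShift G (u + u') (T * T') := by
  rw [HasShift] at *
  rw [← mul_assoc, h, add_mul, mul_assoc, h', mul_add, mul_assoc, add_smul, smul_mul_assoc,
    mul_smul_comm]
  abel

theorem add_left (h : HasShift G u T) (h' : HasShift G' u' T) : HasShift (G + G') (u + u') T := by
  rw [HasShift] at *
  rw [add_mul, mul_add, h, h', add_smul]
  abel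

theorem sub_left (h : HasShift G u T) (h' : HasShift G' u' T) : HasShift (G - G') (u - u') T := by
  rw [HasShift] at *
  rw [sub_mul, mul_sub, h, h', sub_smul]
  abel

theorem add_right (h : HasShift G u T) (h' : HasShift G u T') : HasShift G u (T + T') := by
  rw [HasShift] at *
  rw [add_mul, mul_add, h, h', smul_add]
  abel

theorem sub_right (h : HasShift G u T) (h' : HasShift G u T') : HasShift G u (T - T') := by
  rw [HasShift] at *
  rw [sub_mul, mul_sub, h, h', smul_sub]
  abel

theorem sum_right {τ : Type*} {s : Finset τ} {T : τ → Module.End ℚ W}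
    (h : ∀ t ∈ s, HasShift G u (T t)) : HasShift G u (∑ t ∈ s, T t) := by
  simp only [HasShift, Finset.mul_sum, Finset.sum_mul, Finset.smul_sum, ← Finset.sum_add_distrib]
  exact Finset.sum_congr rfl h

theorem sum_left {τ : Type*} {s : Finset τ} {G : τ → Module.End ℚ W} {u : τ → ℚ}
    (h : ∀ t ∈ s, HasShift (G t) (u t) T) : HasShift (∑ t ∈ s, G t) (∑ t ∈ s, u t) T := by
  simp only [HasShift, Finset.mul_sum, Finset.sum_mul, Finset.sum_smul, ← Finset.sum_add_distrib]
  exact Finset.sum_congr rfl h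

theorem map_xiMap {σ : Type*} [DecidableEq σ] (h : HasShift G u T) : HasShift (xiMap σ G) u (xiMap σ T) := by
  have := congrArg (xiMap σ) h
  rw [map_mul, map_add, map_mul] at this
  rw [HasShift, this]
  congr 1
  refine LinearMap.ext fun z => Finsupp.ext fun α => ?_
  rw [LinearMap.smul_apply, Finsupp.smul_apply, xiMap_apply, xiMap_apply]
  rfl

end HasShift

variable {ι κ : Type*} [Fintype ι] [Fintype κ] [DecidableEq ι] [DecidableEq κ]
  {x p : ι → κ → Module.End ℚ W}

theorem IsWeylPair.hasShift_x (h : IsWeylPair x p) (v w : ι × κ) :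
    HasShift (x v.1 v.2 * p v.1 v.2) (if v = w then 1 else 0) (x w.1 w.2) := by
  rw [HasShift, mul_assoc, h.px, mul_add, ← mul_assoc, h.xx v.1, mul_assoc]
  rcases eq_or_ne v w with rfl | hne
  · simp
  · rw [if_neg (fun hh => hne (Prod.ext hh.1 hh.2)), if_neg hne]; simp

theorem IsWeylPair.hasShift_p (h : IsWeylPair x p) (v w : ι × κ) :
    HasShift (x v.1 v.2 * p v.1 v.2) (-if v = w then 1 else 0) (p w.1 w.2) := by
  rw [HasShift, ← mul_assoc, h.px, add_mul, mul_assoc, h.pp v.1, ← mul_assoc]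
  rcases eq_or_ne v w with rfl | hne
  · simp
  · rw [if_neg (fun hh => hne (Prod.ext hh.1.symm hh.2.symm)), if_neg hne]; simp

theorem IsFermiPair.hasShift_j {σ : Type*} [Fintype σ] [DecidableEq σ] {e j : σ → Module.End ℚ W} (h : IsFermiPair e j)
    (v w : σ) : HasShift (e v * j v) (-if v = w then 1 else 0) (j w) := by
  rw [HasShift, h.ej_j]
  rcases eq_or_ne v w with rfl | hne
  · simp [sub_eq_add_neg]
  · simp [hne, Ne.symm hne]

end Shift

section XiFock

variable {ι κ : Type*} [Fintype ι] [Fintype κ] [DecidableEq ι] [DecidableEq κ]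

local notation "𝓦" => Finset (ι × κ) → MvPolynomial (ι × κ) ℚ
local notation "𝓖" => (ι × κ →₀ ℕ) →₀ Finset (ι × κ) → MvPolynomial (ι × κ) ℚ

theorem hasShift_xiMul (v w : ι × κ) :
    HasShift (xiMul 𝓦 v * xiDer 𝓦 v) (if v = w then 1 else 0) (xiMul 𝓦 w) := by
  rw [HasShift, mul_assoc, xiDer_xiMul, mul_add, ← mul_assoc, (commute_xiMul v w).eq, mul_assoc]
  rcases eq_or_ne v w with rfl | hne
  · simp
  · simp [hne]

theorem hasShift_xiDer (v w : ι × κ) :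
    HasShift (xiMul 𝓦 v * xiDer 𝓦 v) (-if v = w then 1 else 0) (xiDer 𝓦 w) := by
  rw [HasShift, ← mul_assoc, xiDer_xiMul, mul_assoc, (commute_xiDer v w).eq, add_mul, mul_assoc]
  rcases eq_or_ne v w with rfl | hne
  · simp only [if_true, one_mul]
    module
  · simp [hne, Ne.symm hne]

theorem hasShift_xiMap {g t : Module.End ℚ 𝓦} {u : ℚ} (v : ι × κ) (h : HasShift g u t) :
    HasShift (xiMap (ι × κ) g - xiMul 𝓦 v * xiDer 𝓦 v) u (xiMap (ι × κ) t) := by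
  have := h.map_xiMap (σ := ι × κ) |>.sub_left (HasShift.of_commute
    ((commute_xiMap_xiMul t v).symm.mul_left (commute_xiMap_xiDer t v).symm))
  rwa [sub_zero] at this

theorem gDeg_gX (v w : ι × κ) :
    HasShift (gDeg v) (if v = w then 1 else 0) (gX w.1 w.2 : Module.End ℚ 𝓖) := by
  refine hasShift_xiMap v ?_
  have := (superWeyl_poly.weyl.hasShift_x v w).add_left (HasShift.of_commute
    ((superWeyl_poly.xe w.1 w.2 v).mul_right (superWeyl_poly.xj w.1 w.2 v)).symm)
  rwa [add_zero] at this

theorem gDeg_gI (v w : ι × κ) :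
    HasShift (gDeg v) (-if v = w then 1 else 0) (gI w : Module.End ℚ 𝓖) := by
  refine hasShift_xiMap v ?_
  have := (HasShift.of_commute ((superWeyl_poly.xj v.1 v.2 w).mul_left
    (superWeyl_poly.pj v.1 v.2 w))).add_left (superWeyl_poly.fermi.hasShift_j v w)
  rwa [zero_add] at this

theorem gDeg_xiMap_fP (v w : ι × κ) :
    HasShift (gDeg v) (-if v = w then 1 else 0) (xiMap (ι × κ) (fP w.1 w.2) : Module.End ℚ 𝓖) := by
  refine hasShift_xiMap v ?_
  have := (superWeyl_poly.weyl.hasShift_p v w).add_left (HasShift.of_commute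
    ((superWeyl_poly.pe w.1 w.2 v).mul_right (superWeyl_poly.pj w.1 w.2 v)).symm)
  rwa [add_zero] at this

theorem gDeg_gP (v w : ι × κ) :
    HasShift (gDeg v) (-if v = w then 1 else 0) (gP w.1 w.2 : Module.End ℚ 𝓖) := by
  refine (gDeg_xiMap_fP v w).add_right ?_
  have := (HasShift.of_commute (commute_xiMap_xiMul (fX v.1 v.2 * fP v.1 v.2
    + fockE ℚ v * fockI ℚ v) w)).sub_left (hasShift_xiMul v w)
  rwa [zero_sub] at this

theorem gDeg_gY (v w : ι × κ) :
    HasShift (gDeg v) (if v = w then 1 else 0) (gY w : Module.End ℚ 𝓖) := by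
  refine (gDeg_gX v w).add_right ?_
  have := (HasShift.of_commute (commute_xiMap_xiDer (fX v.1 v.2 * fP v.1 v.2
    + fockE ℚ v * fockI ℚ v) w)).sub_left (hasShift_xiDer v w)
  rwa [zero_sub, neg_neg] at this

theorem commute_gDeg_gDiff (v : ι × κ) : Commute (gDeg v) (gDiff ι κ) := by
  refine HasShift.commute (HasShift.sum_right fun w _ => ?_)
  have := (gDeg_gY v w).mul (gDeg_gI v w)
  rwa [add_neg_cancel] at this

/-- The degree operator of a column. -/
noncomputable def gCol (ι : Type*) {κ : Type*} [Fintype ι] [Fintype κ] [DecidableEq ι]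
    [DecidableEq κ] (a : κ) : Module.End ℚ ((ι × κ →₀ ℕ) →₀ Finset (ι × κ) → MvPolynomial (ι × κ) ℚ) :=
  ∑ i, gDeg (i, a)

/-- The degree operator of a row. -/
noncomputable def gRow {ι : Type*} (κ : Type*) [Fintype ι] [Fintype κ] [DecidableEq ι]
    [DecidableEq κ] (i : ι) : Module.End ℚ ((ι × κ →₀ ℕ) →₀ Finset (ι × κ) → MvPolynomial (ι × κ) ℚ) :=
  ∑ a, gDeg (i, a)

theorem gCol_of_gDeg (c : κ) (a : κ) (i : ι) {T : Module.End ℚ 𝓖} {s : ℚ}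
    (h : ∀ v, HasShift (gDeg v) (s * if v = (i, a) then 1 else 0) T) :
    HasShift (gCol ι c) (s * if c = a then 1 else 0) T := by
  have := HasShift.sum_left (s := Finset.univ) fun k _ => h (k, c)
  have h2 : ∑ k : ι, (if (k, c) = (i, a) then (1 : ℚ) else 0) = if c = a then 1 else 0 := by
    simp [Prod.ext_iff, ite_and]
  rwa [← Finset.mul_sum, h2] at this

theorem gRow_of_gDeg (k : ι) (a : κ) (i : ι) {T : Module.End ℚ 𝓖} {s : ℚ}
    (h : ∀ v, HasShift (gDeg v) (s * if v = (i, a) then 1 else 0) T) :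
    HasShift (gRow κ k) (s * if k = i then 1 else 0) T := by
  have := HasShift.sum_left (s := Finset.univ) fun c _ => h (k, c)
  have h2 : ∑ c : κ, (if (k, c) = (i, a) then (1 : ℚ) else 0) = if k = i then 1 else 0 := by
    by_cases h : k = i <;> simp [Prod.ext_iff, h]
  rwa [← Finset.mul_sum, h2] at this

theorem gCol_gX (c a : κ) (i : ι) : HasShift (gCol ι c) (if c = a then 1 else 0) (gX i a) := by
  simpa using gCol_of_gDeg c a i (s := 1) fun v => by simpa using gDeg_gX v (i, a)

theorem gCol_gP (c a : κ) (i : ι) : HasShift (gCol ι c) (-if c = a then 1 else 0) (gP i a) := by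
  rw [← neg_one_mul]
  refine gCol_of_gDeg c a i fun v => ?_
  rw [neg_one_mul]
  exact gDeg_gP v (i, a)

theorem gRow_gX (k : ι) (a : κ) (i : ι) : HasShift (gRow κ k) (if k = i then 1 else 0) (gX i a) := by
  simpa using gRow_of_gDeg k a i (s := 1) fun v => by simpa using gDeg_gX v (i, a)

theorem gRow_gP (k : ι) (a : κ) (i : ι) : HasShift (gRow κ k) (-if k = i then 1 else 0) (gP i a) := by
  rw [← neg_one_mul]
  refine gRow_of_gDeg k a i fun v => ?_
  rw [neg_one_mul]
  exact gDeg_gP v (i, a)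

local notation "gD" => colPol (R := Module.End ℚ 𝓖) gX gP

theorem gCol_colPol (c a b : κ) :
    HasShift (gCol ι c) ((if c = a then 1 else 0) - if c = b then 1 else 0) (gD a b) := by
  rw [colPol, sub_eq_add_neg]
  refine HasShift.sum_right fun i _ => ?_
  exact (gCol_gX c a i).mul (gCol_gP c b i)

theorem gRow_colPol (k : ι) (a b : κ) : HasShift (gRow κ k) 0 (gD a b) := by
  rw [colPol]
  refine HasShift.sum_right fun i _ => ?_
  have := (gRow_gX k a i).mul (gRow_gP k b i)
  rwa [add_neg_cancel] at this

theorem HasShift.natCast {W : Type*} [AddCommGroup W] [Module ℚ W] {G : Module.End ℚ W} (d : ℕ) : HasShift G 0 (d : Module.End ℚ W) :=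
  HasShift.of_commute (Nat.commute_cast _ _)

theorem gCol_lowOp (d : ℕ) (c a : κ) (i : ι) :
    HasShift (gCol ι c) (-if c = a then 1 else 0) (lowOp (R := Module.End ℚ 𝓖) d gX gP i a) := by
  refine HasShift.sum_right fun b _ => ?_
  have h2 : HasShift (gCol ι c) ((if c = b then 1 else 0) - if c = a then 1 else 0)
      (gD b a - if b = a then (d : Module.End ℚ 𝓖) else 0) := by
    refine (gCol_colPol c b a).sub_right ?_
    by_cases h : b = a
    · subst h
      simpa using HasShift.natCast (G := gCol ι c) d
    · simp [HasShift, h]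
  have := (gCol_gP c b i).mul h2
  rwa [neg_add_eq_sub, sub_sub_cancel_left] at this

theorem gRow_lowOp (d : ℕ) (k : ι) (a : κ) (i : ι) :
    HasShift (gRow κ k) (-if k = i then 1 else 0) (lowOp (R := Module.End ℚ 𝓖) d gX gP i a) := by
  refine HasShift.sum_right fun b _ => ?_
  have h2 : HasShift (gRow κ k) 0 (gD b a - if b = a then (d : Module.End ℚ 𝓖) else 0) := by
    refine (gRow_colPol k b a).sub_right ?_
    split_ifs with h
    · exact HasShift.natCast d
    · simp [HasShift]
  have := (gRow_gP k b i).mul h2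
  rwa [add_zero] at this

end XiFock

section Model

variable {ι κ : Type*} [Fintype ι] [Fintype κ] [DecidableEq ι] [DecidableEq κ]

local notation "𝓦" => Finset (ι × κ) → MvPolynomial (ι × κ) ℚ
local notation "𝓖" => (ι × κ →₀ ℕ) →₀ Finset (ι × κ) → MvPolynomial (ι × κ) ℚ
local notation "𝓓" => koszul (R := Module.End ℚ 𝓦) fX (fockI ℚ)
local notation "𝓣" => totPol (R := Module.End ℚ 𝓦) fX fP (fockE ℚ) (fockI ℚ)
local notation "𝓝" => numOp (R := Module.End ℚ 𝓦) (fockE ℚ) (fockI ℚ)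

/-- The elements whose coefficients lie in the `d`-th power of the ideal of maximal minors. -/
noncomputable def gMinor (ι κ : Type*) [Fintype ι] [Fintype κ] [DecidableEq ι] [DecidableEq κ]
    (d : ℕ) : Submodule ℚ ((ι × κ →₀ ℕ) →₀ Finset (ι × κ) → MvPolynomial (ι × κ) ℚ) where
  carrier := {z | ∀ α, z α ∈ fockMinor ι κ d}
  add_mem' hz hz' _ := add_mem (hz _) (hz' _)
  zero_mem' _ := zero_mem _
  smul_mem' c _ hz α := Submodule.smul_mem _ c (hz α)

theorem mem_fockMinor {d : ℕ} {f : 𝓦} :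
    f ∈ fockMinor ι κ d ↔ ∀ A, f A ∈ maxMinors (genMat ι κ ℚ) ^ d := by
  rw [fockMinor, mem_fockSub]
  exact forall_congr' fun _ => mem_minorQ

theorem mem_gMinor_iff_mem_minorSub {d : ℕ} {z : 𝓖} :
    z ∈ gMinor ι κ d ↔ z ∈ minorSub (ι := ι) (κ := κ) ℚ 𝓖 d := by
  constructor
  · intro hz
    rw [← Finsupp.sum_single z]
    refine sum_mem fun α _ => ?_
    have : z α = ∑ A, Pi.single A (z α A) := (Finset.univ_sum_single _).symm
    rw [this, Finsupp.single_finsetSum]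
    refine sum_mem fun A _ => ?_
    have h := smul_mem_minorSub (ι := ι) (κ := κ) (K := ℚ) d (mem_fockMinor.mp (hz α) A)
      (Finsupp.single α (Pi.single A (1 : MvPolynomial (ι × κ) ℚ) : 𝓦))
    rwa [Finsupp.smul_single, ← Pi.single_smul, smul_eq_mul, mul_one] at h
  · intro hz
    refine minorSub_induction d (P := fun z => z ∈ gMinor ι κ d) (zero_mem _) ?_
      (fun u v hu hv => add_mem hu hv) hz
    intro f hf h α
    refine mem_fockMinor.mpr fun A => ?_
    exact Ideal.mul_mem_right _ _ (minorProducts_subset d hf)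

theorem varMul_eq_gX : varMul ℚ 𝓖 = gX (ι := ι) (κ := κ) := by
  funext i a
  refine LinearMap.ext fun z => Finsupp.ext fun α => funext fun A => ?_
  rw [xiMap_apply]
  rfl

theorem isPartial_gP : IsPartial (N := 𝓖) (gP (ι := ι) (κ := κ)) := fun i a f z => by
  refine Finsupp.ext fun α => _root_.funext fun A => ?_
  have h1 : ∀ z : 𝓖, gP i a z α A = pderiv (i, a) (z α A) + (xiMul 𝓦 (i, a) z) α A := fun z => by
    rw [LinearMap.add_apply, Finsupp.add_apply, xiMap_apply]
    rfl
  have h2 : (xiMul 𝓦 (i, a) (f • z)) = f • xiMul 𝓦 (i, a) z := by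
    induction z using Finsupp.induction_linear with
    | zero => simp
    | add u v hu hv => rw [smul_add, map_add, hu, hv, map_add, smul_add]
    | single β u => rw [Finsupp.smul_single, xiMul_single, xiMul_single, Finsupp.smul_single]
  rw [h1, h2, Finsupp.add_apply, Pi.add_apply]
  simp only [Finsupp.smul_apply, Pi.smul_apply, h1, smul_eq_mul, Derivation.leibniz]
  ring

theorem gX_mem (d : ℕ) (i : ι) (a : κ) {z : 𝓖} (hz : z ∈ gMinor ι κ d) :
    gX i a z ∈ gMinor ι κ d := fun α => by
  rw [xiMap_apply]
  exact fX_mem d i a (hz α)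

theorem gColPol_mem (d : ℕ) (a b : κ) {z : 𝓖} (hz : z ∈ gMinor ι κ d) :
    colPol (R := Module.End ℚ 𝓖) gX gP a b z ∈ gMinor ι κ d := by
  rw [mem_gMinor_iff_mem_minorSub] at *
  rw [← varMul_eq_gX]
  exact isPartial_gP.colPol_mem a b d hz

theorem gLowOp_mem (d : ℕ) (i : ι) (a : κ) {z : 𝓖} (hz : z ∈ gMinor ι κ d) :
    lowOp (R := Module.End ℚ 𝓖) d gX gP i a z ∈ gMinor ι κ d := by
  rw [mem_gMinor_iff_mem_minorSub] at *
  rw [← varMul_eq_gX]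
  exact isPartial_gP.lowOp_mem i a d hz

theorem gI_mem (d : ℕ) (v : ι × κ) {z : 𝓖} (hz : z ∈ gMinor ι κ d) : gI v z ∈ gMinor ι κ d :=
  fun α => by
    rw [xiMap_apply]
    exact fockI_mem v (hz α)

theorem gE_mem (d : ℕ) (v : ι × κ) {z : 𝓖} (hz : z ∈ gMinor ι κ d) : gE v z ∈ gMinor ι κ d :=
  fun α => by
    rw [xiMap_apply]
    exact fockE_mem v (hz α)

theorem xiDer_mem (d : ℕ) (v : ι × κ) {z : 𝓖} (hz : z ∈ gMinor ι κ d) :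
    xiDer 𝓦 v z ∈ gMinor ι κ d := fun α => by
  rw [xiDer_apply]
  exact Submodule.smul_mem _ _ (hz _)

theorem xiMul_mem (d : ℕ) (v : ι × κ) {z : 𝓖} (hz : z ∈ gMinor ι κ d) :
    xiMul 𝓦 v z ∈ gMinor ι κ d := by
  rw [← Finsupp.sum_single z, Finsupp.sum, map_sum]
  refine sum_mem fun α _ => ?_
  rw [xiMul_single]
  intro β
  rw [Finsupp.single_apply]
  split_ifs
  · exact hz α
  · exact zero_mem _

/-- The part of exterior degree `p`. -/
def gGr (ι κ : Type*) [Fintype ι] [Fintype κ] [DecidableEq ι] [DecidableEq κ]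
    (p : ℕ) : Submodule ℚ ((ι × κ →₀ ℕ) →₀ Finset (ι × κ) → MvPolynomial (ι × κ) ℚ) where
  carrier := {z | ∀ α A, A.card ≠ p → z α A = 0}
  add_mem' hz hz' α A hA := by simp [hz α A hA, hz' α A hA]
  zero_mem' α A _ := rfl
  smul_mem' c z hz α A hA := by simp [hz α A hA]

theorem xiMap_fockMap_mem_gGr (p : ℕ) (g : Module.End ℚ (MvPolynomial (ι × κ) ℚ)) {z : 𝓖}
    (hz : z ∈ gGr ι κ p) : xiMap (ι × κ) (fockMap ℚ g) z ∈ gGr ι κ p := fun α A hA => by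
  rw [xiMap_apply, fockMap_apply, hz α A hA, map_zero]

theorem xiDer_mem_gGr (p : ℕ) (v : ι × κ) {z : 𝓖} (hz : z ∈ gGr ι κ p) :
    xiDer 𝓦 v z ∈ gGr ι κ p := fun α A hA => by
  rw [xiDer_apply, Pi.smul_apply, hz _ A hA, smul_zero]

theorem xiMul_mem_gGr (p : ℕ) (v : ι × κ) {z : 𝓖} (hz : z ∈ gGr ι κ p) :
    xiMul 𝓦 v z ∈ gGr ι κ p := by
  rw [← Finsupp.sum_single z, Finsupp.sum, map_sum]
  refine sum_mem fun α _ => ?_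
  rw [xiMul_single]
  intro β A hA
  rw [Finsupp.single_apply]
  split_ifs
  · exact hz α A hA
  · rfl

theorem gX_mem_gGr (p : ℕ) (i : ι) (a : κ) {z : 𝓖} (hz : z ∈ gGr ι κ p) :
    gX i a z ∈ gGr ι κ p := xiMap_fockMap_mem_gGr p _ hz

theorem gP_mem_gGr (p : ℕ) (i : ι) (a : κ) {z : 𝓖} (hz : z ∈ gGr ι κ p) :
    gP i a z ∈ gGr ι κ p := add_mem (xiMap_fockMap_mem_gGr p _ hz) (xiMul_mem_gGr p _ hz)

theorem fockI_apply_eq_zero {p : ℕ} (v : ι × κ) {f : 𝓦} (hf : ∀ A : Finset (ι × κ), A.card ≠ p + 1 → f A = 0)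
    {A : Finset (ι × κ)} (hA : A.card ≠ p) : fockI ℚ v f A = 0 := by
  rw [fockI_apply]
  split_ifs with h
  · rfl
  · rw [hf _ (by rw [Finset.card_insert_of_notMem h]; omega), smul_zero]

theorem gI_mem_gGr (p : ℕ) (v : ι × κ) {z : 𝓖} (hz : z ∈ gGr ι κ (p + 1)) :
    gI v z ∈ gGr ι κ p := fun α A hA => by
  rw [xiMap_apply]
  exact fockI_apply_eq_zero v (hz α) hA

theorem gE_mem_gGr (p : ℕ) (v : ι × κ) {z : 𝓖} (hz : z ∈ gGr ι κ p) :
    gE v z ∈ gGr ι κ (p + 1) := fun α A hA => by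
  rw [xiMap_apply, fockE_apply]
  split_ifs with h
  · rw [hz α _ (by rw [Finset.card_erase_of_mem h]; have := Finset.card_pos.mpr ⟨v, h⟩; omega), smul_zero]
  · rfl

theorem gDiff_mem_gGr (p : ℕ) {z : 𝓖} (hz : z ∈ gGr ι κ (p + 1)) : gDiff ι κ z ∈ gGr ι κ p := by
  rw [gDiff, LinearMap.sum_apply]
  refine sum_mem fun v _ => ?_
  exact add_mem (gX_mem_gGr p _ _ (gI_mem_gGr p v hz)) (xiDer_mem_gGr p v (gI_mem_gGr p v hz))

theorem gColPol_mem_gGr (p : ℕ) (a b : κ) {z : 𝓖} (hz : z ∈ gGr ι κ p) :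
    colPol (R := Module.End ℚ 𝓖) gX gP a b z ∈ gGr ι κ p := by
  rw [colPol, LinearMap.sum_apply]
  refine sum_mem fun i _ => ?_
  rw [Module.End.mul_apply (gX i a)]
  exact gX_mem_gGr p i a (gP_mem_gGr p i b hz)

theorem gLowOp_mem_gGr (d p : ℕ) (i : ι) (a : κ) {z : 𝓖} (hz : z ∈ gGr ι κ p) :
    lowOp (R := Module.End ℚ 𝓖) d gX gP i a z ∈ gGr ι κ p := by
  rw [lowOp, LinearMap.sum_apply]
  refine sum_mem fun b _ => ?_
  rw [Module.End.mul_apply (gP i b)]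
  refine gP_mem_gGr p i b ?_
  rw [LinearMap.sub_apply]
  refine sub_mem (gColPol_mem_gGr p _ _ hz) ?_
  split_ifs
  · rw [Module.End.natCast_apply]
    exact nsmul_mem hz d
  · exact zero_mem _

/-- The multiplicity of a variable in a basis element of the model. -/
def multDeg (v : ι × κ) (c : (ι × κ →₀ ℕ) × Finset (ι × κ) × (ι × κ →₀ ℕ)) : ℤ :=
  c.2.2 v + (if v ∈ c.2.1 then 1 else 0) - c.1 v

/-- The coordinates of the model. -/
noncomputable def gCoord (c : (ι × κ →₀ ℕ) × Finset (ι × κ) × (ι × κ →₀ ℕ)) : 𝓖 →ₗ[ℚ] ℚ :=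
  lcoeff ℚ c.2.2 ∘ₗ LinearMap.proj c.2.1 ∘ₗ Finsupp.lapply c.1

theorem gCoord_apply (c : (ι × κ →₀ ℕ) × Finset (ι × κ) × (ι × κ →₀ ℕ)) (z : 𝓖) :
    gCoord c z = coeff c.2.2 (z c.1 c.2.1) := rfl

theorem gCoord_gDeg (v : ι × κ) (z : 𝓖) (c : (ι × κ →₀ ℕ) × Finset (ι × κ) × (ι × κ →₀ ℕ)) :
    gCoord c (gDeg v z) = multDeg v c * gCoord c z := by
  obtain ⟨α, A, β⟩ := c
  have h1 : gDeg v z α A = X v * pderiv v (z α A) + (if v ∈ A then z α A else 0)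
      - (α v : ℚ) • z α A := by
    rw [gDeg, LinearMap.sub_apply, Finsupp.sub_apply, Pi.sub_apply, xiMul_xiDer_apply, xiMap_apply,
      LinearMap.add_apply, Pi.add_apply, Module.End.mul_apply (fockE ℚ v), fockE_fockI_apply]
    rfl
  rw [gCoord_apply, gCoord_apply, h1, coeff_sub, coeff_add, coeff_smul, multDeg]
  have h2 : coeff β (X v * pderiv v (z α A)) = β v * coeff β (z α A) := by
    rw [mul_comm, X, coeff_mul_monomial', mul_one]
    split_ifs with h
    · rw [coeff_pderiv, tsub_add_cancel_of_le h]
      have : 1 ≤ β v := by simpa using h v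
      simp [Nat.cast_sub this]
      ring
    · have : β v = 0 := by
        by_contra h0
        exact h (Finsupp.single_le_iff.mpr (Nat.one_le_iff_ne_zero.mpr h0))
      simp [this]
  rw [h2]
  push_cast
  split_ifs <;> simp <;> ring

theorem gCoord_ext (z : 𝓖) (h : ∀ c, gCoord c z = 0) : z = 0 :=
  Finsupp.ext fun α => funext fun A => MvPolynomial.ext _ _ fun β => h (α, A, β)

theorem finite_gCoord (z : 𝓖) : {c | gCoord c z ≠ 0}.Finite := by
  refine ((z.support ×ˢ (Finset.univ ×ˢ z.support.biUnion fun α =>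
    Finset.univ.biUnion fun A => (z α A).support) : Finset _).finite_toSet).subset ?_
  rintro ⟨α, A, β⟩ hc
  have hc : coeff β (z α A) ≠ 0 := hc
  have h1 : α ∈ z.support := by
    rw [Finsupp.mem_support_iff]
    rintro h
    simp [h] at hc
  simp only [Finset.coe_product, Set.mem_prod, Finset.mem_coe, Finset.mem_univ, h1, true_and,
    Finset.mem_biUnion, mem_support_iff]
  exact ⟨α, h1, A, hc⟩

end Model

section Filtration

variable {ι κ : Type*} [Fintype ι] [Fintype κ] [DecidableEq ι] [DecidableEq κ]

local notation "𝓦" => Finset (ι × κ) → MvPolynomial (ι × κ) ℚ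
local notation "𝓖" => (ι × κ →₀ ℕ) →₀ Finset (ι × κ) → MvPolynomial (ι × κ) ℚ
local notation "𝓓" => koszul (R := Module.End ℚ 𝓦) fX (fockI ℚ)
local notation "𝓣" => totPol (R := Module.End ℚ 𝓦) fX fP (fockE ℚ) (fockI ℚ)
local notation "𝓝" => numOp (R := Module.End ℚ 𝓦) (fockE ℚ) (fockI ℚ)

/-- Exactness of the Koszul differential coefficientwise gives exactness of `gDiff`. -/
theorem exists_gDiff_eq {U V : (ι × κ →₀ ℕ) → Submodule ℚ 𝓦}
    (h1 : ∀ α, ∀ w ∈ U α, 𝓓 w = 0 → ∃ y ∈ V α, 𝓓 y = w) (h2 : ∀ α, ∀ y ∈ V α, 𝓓 y ∈ U α)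
    (h3 : ∀ α v, ∀ y ∈ V (α + Finsupp.single v 1), fockI ℚ v y ∈ U α) {z : 𝓖}
    (hz : ∀ α, z α ∈ U α) (h0 : gDiff ι κ z = 0) :
    ∃ Y : 𝓖, (∀ α, Y α ∈ V α) ∧ gDiff ι κ Y = z := by
  classical
  obtain ⟨N, hN⟩ : ∃ N : ℕ, ∀ α, N ≤ α.degree → z α = 0 := by
    refine ⟨(z.support.sup Finsupp.degree) + 1, fun α hα => ?_⟩
    by_contra h
    have := Finset.le_sup (f := Finsupp.degree) (Finsupp.mem_support_iff.mpr h)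
    omega
  induction N generalizing z with
  | zero =>
    refine ⟨0, fun α => zero_mem _, ?_⟩
    rw [map_zero]
    exact (Finsupp.ext fun α => hN α (Nat.zero_le _)).symm
  | succ N ih =>
    have h4 : ∀ α, α.degree = N → 𝓓 (z α) = 0 := fun α hα => by
      have := DFunLike.congr_fun h0 α
      rw [gDiff_apply, Finset.sum_eq_zero fun v _ => ?_, add_zero] at this
      · exact this
      · rw [hN _ (by simp [hα]), map_zero, smul_zero]
    have h5 : ∀ α, ∃ y : 𝓦, α.degree = N → y ∈ V α ∧ 𝓓 y = z α := fun α => by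
      by_cases hα : α.degree = N
      · obtain ⟨y, hy⟩ := h1 α _ (hz α) (h4 α hα)
        exact ⟨y, fun _ => hy⟩
      · exact ⟨0, fun h => absurd h hα⟩
    choose y hy using h5
    let Y : 𝓖 := Finsupp.onFinset z.support
      (fun α => if α.degree = N ∧ z α ≠ 0 then y α else 0) fun α hα => by
        rw [Finsupp.mem_support_iff]
        by_contra h
        simp [h] at hα
    have hY : ∀ α, Y α = if α.degree = N ∧ z α ≠ 0 then y α else 0 := fun α => rfl
    have hYV : ∀ α, Y α ∈ V α := fun α => by
      rw [hY]
      split_ifs with h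
      · exact (hy α h.1).1
      · exact zero_mem _
    have hd : ∀ α, (z - gDiff ι κ Y) α = z α - (𝓓 (Y α)
        + ∑ v, (α v + 1 : ℚ) • fockI ℚ v (Y (α + Finsupp.single v 1))) := fun α => by
      rw [Finsupp.sub_apply, gDiff_apply]
    have h6 : ∀ α, (z - gDiff ι κ Y) α ∈ U α := fun α => by
      rw [hd]
      refine sub_mem (hz α) (add_mem (h2 α _ (hYV α)) (sum_mem fun v _ => ?_))
      exact Submodule.smul_mem _ _ (h3 α v _ (hYV _))
    have h7 : ∀ α, N ≤ α.degree → (z - gDiff ι κ Y) α = 0 := fun α hα => by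
      rw [hd, Finset.sum_eq_zero fun v _ => ?_, add_zero, hY]
      · split_ifs with h
        · rw [(hy α h.1).2, sub_self]
        · rw [map_zero, sub_zero]
          by_contra h6
          exact h ⟨le_antisymm (by by_contra h7; exact h6 (hN α (by omega))) hα, h6⟩
      · have h7 : (α + Finsupp.single v 1).degree = α.degree + 1 := by simp
        rw [hY, if_neg (fun h => by omega), map_zero, smul_zero]
    obtain ⟨Y', hY'V, hY'⟩ := ih h6 (by
      rw [map_sub, h0, ← Module.End.mul_apply, gDiff_mul_self, LinearMap.zero_apply, sub_zero]) h7
    exact ⟨Y' + Y, fun α => add_mem (hY'V α) (hYV α), by rw [map_add, hY']; abel⟩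

/-- The part of exterior degree `p`. -/
def fockGr (ι κ : Type*) [Fintype ι] [Fintype κ] [DecidableEq ι] [DecidableEq κ]
    (p : ℕ) : Submodule ℚ (Finset (ι × κ) → MvPolynomial (ι × κ) ℚ) where
  carrier := {f | ∀ A, A.card ≠ p → f A = 0}
  add_mem' hz hz' A hA := by simp [hz A hA, hz' A hA]
  zero_mem' _ _ := rfl
  smul_mem' _ _ hz A hA := by simp [hz A hA]

theorem fockI_mem_fockGr {p : ℕ} (v : ι × κ) {f : 𝓦} (hf : f ∈ fockGr ι κ (p + 1)) :
    fockI ℚ v f ∈ fockGr ι κ p := fun _ hA => fockI_apply_eq_zero v hf hA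

theorem koszul_mem_fockGr {p : ℕ} {f : 𝓦} (hf : f ∈ fockGr ι κ (p + 1)) : 𝓓 f ∈ fockGr ι κ p := by
  rw [koszul, LinearMap.sum_apply]
  refine sum_mem fun v _ => fun A hA => ?_
  rw [Module.End.mul_apply (fX v.1 v.2), fX, fockLift, fockMap_apply, fockI_mem_fockGr v hf A hA, map_zero]

theorem numOp_eq_smul {p : ℕ} {f : 𝓦} (hf : f ∈ fockGr ι κ p) : 𝓝 f = (p : ℚ) • f := by
  funext A
  rw [numOp, LinearMap.sum_apply, Finset.sum_apply]
  simp_rw [Module.End.mul_apply (fockE ℚ (_ : ι × κ)), fockE_fockI_apply]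
  by_cases hA : A.card = p
  · rw [← Finset.sum_filter, Finset.sum_const, Finset.filter_mem_eq_inter, Finset.univ_inter, hA,
      Pi.smul_apply, Nat.cast_smul_eq_nsmul]
  · simp [hf A hA]

/-- A primitive may be chosen of pure exterior degree. -/
theorem exists_koszul_eq_of_fockGr {p d : ℕ} {b : κ → ℚ} {w y : 𝓦} (hw : w ∈ fockGr ι κ p)
    (hy : y ∈ fockMinor ι κ d ⊓ fockWt b) (hyw : 𝓓 y = w) :
    ∃ y ∈ fockMinor ι κ d ⊓ fockWt b ⊓ fockGr ι κ (p + 1), 𝓓 y = w := by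
  classical
  have hcut : ∀ (q : ℤ) (f : 𝓦) A, fockCut ℚ (Set.univ : Set (ι × κ)) q f A =
      if (A.card : ℤ) = q then f A else 0 := fun q f A => by simp [fockCut_apply]
  have hI : ∀ (q : ℤ) v (f : 𝓦), fockCut ℚ (Set.univ : Set (ι × κ)) q (fockI ℚ v f) =
      fockI ℚ v (fockCut ℚ Set.univ (q + 1) f) := fun q v f => by simp [fockCut_fockI]
  have hE : ∀ (q : ℤ) v (f : 𝓦), fockCut ℚ (Set.univ : Set (ι × κ)) q (fockE ℚ v f) =
      fockE ℚ v (fockCut ℚ Set.univ (q - 1) f) := fun q v f => by simp [fockCut_fockE]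
  refine ⟨fockCut ℚ Set.univ ((p + 1 : ℕ) : ℤ) y, ⟨⟨fockCut_mem _ _ hy.1, ?_⟩, fun A hA => ?_⟩, ?_⟩
  · refine mem_fockWt.mpr fun a => ?_
    rw [← map_smul, ← mem_fockWt.mp hy.2 a]
    simp only [totPol, colPol, extPol, LinearMap.add_apply, LinearMap.sum_apply, map_add, map_sum]
    congr 1
    · refine Finset.sum_congr rfl fun i _ => ?_
      rw [Module.End.mul_apply (fX i a), Module.End.mul_apply (fX i a)]
      exact (congrArg (fX i a) (fockCut_fockMap _ _ _ y).symm).trans (fockCut_fockMap _ _ _ _).symm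
    · refine Finset.sum_congr rfl fun i _ => ?_
      rw [Module.End.mul_apply (fockE ℚ (i, a)), Module.End.mul_apply (fockE ℚ (i, a)), hE, hI,
        sub_add_cancel]
  · rw [hcut, if_neg (by exact_mod_cast hA)]
  · have : fockCut ℚ Set.univ (p : ℤ) (𝓓 y) = 𝓓 (fockCut ℚ Set.univ ((p + 1 : ℕ) : ℤ) y) := by
      simp only [koszul, LinearMap.sum_apply, map_sum]
      refine Finset.sum_congr rfl fun v _ => ?_
      rw [Module.End.mul_apply (fX v.1 v.2), Module.End.mul_apply (fX v.1 v.2)]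
      refine (fockCut_fockMap _ _ _ _).trans (congrArg (fX v.1 v.2) ?_)
      rw [hI]
      push_cast
      rfl
    rw [← this, hyw]
    funext A
    rw [hcut]
    split_ifs with h
    · rfl
    · exact (hw A (by exact_mod_cast h)).symm

end Filtration

section ModelHomology

variable {ι κ : Type*} [Fintype ι] [Fintype κ] [DecidableEq ι] [DecidableEq κ]

local notation "𝓦" => Finset (ι × κ) → MvPolynomial (ι × κ) ℚ
local notation "𝓖" => (ι × κ →₀ ℕ) →₀ Finset (ι × κ) → MvPolynomial (ι × κ) ℚ
local notation "𝓓" => koszul (R := Module.End ℚ 𝓦) fX (fockI ℚ)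
local notation "𝓣" => totPol (R := Module.End ℚ 𝓦) fX fP (fockE ℚ) (fockI ℚ)
local notation "𝓝" => numOp (R := Module.End ℚ 𝓦) (fockE ℚ) (fockI ℚ)

/-- The cycles of exterior degree `j` of the model. -/
noncomputable def gCyc (ι κ : Type*) [Fintype ι] [Fintype κ] [DecidableEq ι] [DecidableEq κ]
    (d j : ℕ) : Submodule ℚ ((ι × κ →₀ ℕ) →₀ Finset (ι × κ) → MvPolynomial (ι × κ) ℚ) :=
  gMinor ι κ d ⊓ gGr ι κ j ⊓ LinearMap.ker (gDiff ι κ)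

/-- The boundaries of exterior degree `j` of the model. -/
noncomputable def gBdr (ι κ : Type*) [Fintype ι] [Fintype κ] [DecidableEq ι] [DecidableEq κ]
    (d j : ℕ) : Submodule ℚ ((ι × κ →₀ ℕ) →₀ Finset (ι × κ) → MvPolynomial (ι × κ) ℚ) :=
  (gMinor ι κ d ⊓ gGr ι κ (j + 1)).map (gDiff ι κ)

theorem mem_gCyc {d j : ℕ} {z : 𝓖} :
    z ∈ gCyc ι κ d j ↔ (z ∈ gMinor ι κ d ∧ z ∈ gGr ι κ j) ∧ gDiff ι κ z = 0 := Iff.rfl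

theorem mem_gBdr {d j : ℕ} {z : 𝓖} :
    z ∈ gBdr ι κ d j ↔ ∃ y, (y ∈ gMinor ι κ d ∧ y ∈ gGr ι κ (j + 1)) ∧ gDiff ι κ y = z := Iff.rfl

theorem gCyc_of_commute {d j : ℕ} {T : Module.End ℚ 𝓖} (hT : Commute (gDiff ι κ) T)
    (h1 : ∀ z ∈ gMinor ι κ d, T z ∈ gMinor ι κ d) (h2 : ∀ p, ∀ z ∈ gGr ι κ p, T z ∈ gGr ι κ p) :
    (∀ z ∈ gCyc ι κ d j, T z ∈ gCyc ι κ d j) ∧ ∀ z ∈ gBdr ι κ d j, T z ∈ gBdr ι κ d j := by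
  have h : ∀ z, gDiff ι κ (T z) = T (gDiff ι κ z) := LinearMap.congr_fun hT
  refine ⟨fun z hz => ⟨⟨h1 z hz.1.1, h2 j z hz.1.2⟩, ?_⟩, ?_⟩
  · exact (h z).trans ((congrArg T hz.2).trans (map_zero T))
  · rintro _ ⟨y, hy, rfl⟩
    exact ⟨T y, ⟨h1 y hy.1, h2 _ y hy.2⟩, h y⟩

theorem commute_gDiff_colPol (a b : κ) :
    Commute (gDiff ι κ) (colPol (R := Module.End ℚ 𝓖) gX gP a b) :=
  Commute.sum_right _ _ _ fun i _ => (commute_gDiff_gX i a).mul_right (commute_gDiff_gP i b)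

theorem commute_lowOp {R : Type*} [Ring R] {x p : ι → κ → R} {g : R}
    (hx : ∀ i a, Commute g (x i a)) (hp : ∀ i a, Commute g (p i a)) (d : ℕ) (i : ι) (a : κ) :
    Commute g (lowOp d x p i a) := by
  refine Commute.sum_right _ _ _ fun b _ => (hp i b).mul_right (Commute.sub_right
    (Commute.sum_right _ _ _ fun k _ => (hx k b).mul_right (hp k a)) ?_)
  split_ifs
  · exact Nat.commute_cast _ _
  · exact Commute.zero_right _

theorem commute_gDiff_lowOp (d : ℕ) (i : ι) (a : κ) :
    Commute (gDiff ι κ) (lowOp (R := Module.End ℚ 𝓖) d gX gP i a) :=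
  commute_lowOp commute_gDiff_gX commute_gDiff_gP d i a

theorem gCol_eq_sum (a : κ) (z : 𝓖) (α : ι × κ →₀ ℕ) :
    gCol ι a z α = 𝓣 a a (z α) - (colDeg a α : ℚ) • z α := by
  rw [gCol, LinearMap.sum_apply, Finsupp.finsetSum_apply]
  have : ∀ i, gDeg (i, a) z α = (fX i a * fP i a + fockE ℚ (i, a) * fockI ℚ (i, a) : Module.End ℚ 𝓦) (z α)
      - (α (i, a) : ℚ) • z α := fun i => by
    rw [gDeg, LinearMap.sub_apply, Finsupp.sub_apply, xiMul_xiDer_apply, xiMap_apply]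
  simp_rw [this]
  rw [Finset.sum_sub_distrib, ← Finset.sum_smul, ← LinearMap.sum_apply, Finset.sum_add_distrib, colDeg]
  push_cast
  rfl

/-- The joint eigenspaces of the degree operators. -/
noncomputable def gWt (w : κ → ℤ) (r : ι → ℤ) : Submodule ℚ 𝓖 where
  carrier := {z | (∀ a, gCol ι a z = (w a + Fintype.card ι : ℚ) • z) ∧
    ∀ i, gRow κ i z = (r i + Fintype.card κ : ℚ) • z}
  add_mem' hz hz' := ⟨fun a => by rw [map_add, hz.1, hz'.1, smul_add],
    fun i => by rw [map_add, hz.2, hz'.2, smul_add]⟩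
  zero_mem' := ⟨fun a => by rw [map_zero, smul_zero], fun i => by rw [map_zero, smul_zero]⟩
  smul_mem' c z hz := ⟨fun a => by rw [map_smul, hz.1, smul_comm],
    fun i => by rw [map_smul, hz.2, smul_comm]⟩

theorem HasShift.gWt {T : Module.End ℚ 𝓖} {s : κ → ℤ} {t : ι → ℤ}
    (hs : ∀ a, HasShift (gCol ι a) (s a : ℚ) T) (ht : ∀ i, HasShift (gRow κ i) (t i : ℚ) T)
    {w : κ → ℤ} {r : ι → ℤ} {z : 𝓖} (hz : z ∈ gWt w r) : T z ∈ gWt (w + s) (r + t) := by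
  refine ⟨fun a => ?_, fun i => ?_⟩
  · rw [(hs a).apply_eigenvector (hz.1 a)]
    congr 1
    push_cast [Pi.add_apply]
    ring
  · rw [(ht i).apply_eigenvector (hz.2 i)]
    congr 1
    push_cast [Pi.add_apply]
    ring

theorem mem_gBdr_of_htpy {τ : Type*} [Fintype τ] (f : τ → ι × κ) {d j : ℕ} {z : 𝓖}
    (hz : z ∈ gCyc ι κ d j) :
    ∑ t, (gX (f t).1 (f t).2 * gP (f t).1 (f t).2 : Module.End ℚ 𝓖) z - ∑ t, gDeg (f t) z
      + (Fintype.card τ : ℚ) • z ∈ gBdr ι κ d j := by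
  refine ⟨∑ t, (xiMul 𝓦 (f t)) (gE (f t) z), ⟨sum_mem fun t _ => xiMul_mem d _ (gE_mem d _ hz.1.1),
    sum_mem fun t _ => xiMul_mem_gGr _ _ (gE_mem_gGr _ _ hz.1.2)⟩, ?_⟩
  have h : ∀ t, gDiff ι κ (xiMul 𝓦 (f t) (gE (f t) z)) =
      (gX (f t).1 (f t).2 * gP (f t).1 (f t).2 : Module.End ℚ 𝓖) z - gDeg (f t) z + z := fun t => by
    have := LinearMap.congr_fun (gDiff_htpy (f t)) z
    rw [LinearMap.add_apply, Module.End.mul_apply (xiMul 𝓦 (f t) * _), show gDiff ι κ z = 0 from hz.2,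
      map_zero, add_zero] at this
    exact this
  rw [map_sum, Finset.sum_congr rfl fun t _ => h t, Finset.sum_add_distrib, Finset.sum_sub_distrib,
    Finset.sum_const, Finset.card_univ, Nat.cast_smul_eq_nsmul]

/-- The weight spaces of the model. -/
noncomputable def gWeightData (ι κ : Type*) [Fintype ι] [Fintype κ] [DecidableEq ι] [DecidableEq κ]
    (d j : ℕ) : WeightData (ι := ι) (κ := κ) d gX gP (gCyc ι κ d j) (gBdr ι κ d j) where
  wt := gWt
  xB i b := (gCyc_of_commute (commute_gDiff_gX i b) (fun _ => gX_mem d i b)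
    fun p _ => gX_mem_gGr p i b).2
  xZ i b := (gCyc_of_commute (commute_gDiff_gX i b) (fun _ => gX_mem d i b)
    fun p _ => gX_mem_gGr p i b).1
  lowB i b := (gCyc_of_commute (commute_gDiff_lowOp d i b) (fun _ => gLowOp_mem d i b)
    fun p _ => gLowOp_mem_gGr d p i b).2
  lowZ i b := (gCyc_of_commute (commute_gDiff_lowOp d i b) (fun _ => gLowOp_mem d i b)
    fun p _ => gLowOp_mem_gGr d p i b).1
  colB a b := (gCyc_of_commute (commute_gDiff_colPol a b) (fun _ => gColPol_mem d a b)
    fun p _ => gColPol_mem_gGr p a b).2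
  colZ a b := (gCyc_of_commute (commute_gDiff_colPol a b) (fun _ => gColPol_mem d a b)
    fun p _ => gColPol_mem_gGr p a b).1
  x_wt i b w r h hh := HasShift.gWt
    (fun a => by simpa [Pi.single_apply] using gCol_gX a b i)
    (fun k => by simpa [Pi.single_apply] using gRow_gX k b i) hh
  low_wt i b w r h hh := by
    rw [sub_eq_add_neg, sub_eq_add_neg]
    refine HasShift.gWt (fun a => ?_) (fun k => ?_) hh
    · have := gCol_lowOp (ι := ι) d a b i
      by_cases hab : a = b <;> simpa [Pi.single_apply, hab] using this
    · have := gRow_lowOp (κ := κ) d k b i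
      by_cases hab : k = i <;> simpa [Pi.single_apply, hab] using this
  col_wt a b w r h hh := by
    have h0 : r = r + 0 := (add_zero r).symm
    rw [h0, sub_eq_add_neg, add_assoc]
    refine HasShift.gWt (fun c => ?_) (fun k => ?_) hh
    · have := gCol_colPol (ι := ι) c a b
      convert this using 1
      simp only [Pi.add_apply, Pi.neg_apply, Pi.single_apply]
      push_cast
      ring
    · simpa using gRow_colPol k a b
  col_self a w r h hh hZ := by
    have := mem_gBdr_of_htpy (fun i : ι => (i, a)) hZ
    rw [← LinearMap.sum_apply, ← LinearMap.sum_apply] at this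
    have h1 : (∑ i : ι, gDeg (i, a) : Module.End ℚ _) h = (w a + Fintype.card ι : ℚ) • h := hh.1 a
    rw [h1] at this
    convert this using 1
    rw [add_smul, sub_add_eq_sub_sub, sub_add_cancel]
    rfl
  row_self i w r h hh hZ := by
    have := mem_gBdr_of_htpy (fun a : κ => (i, a)) hZ
    rw [← LinearMap.sum_apply, ← LinearMap.sum_apply] at this
    have h1 : (∑ a : κ, gDeg (i, a) : Module.End ℚ _) h = (r i + Fintype.card κ : ℚ) • h := hh.2 i
    rw [h1] at this
    convert this using 1
    rw [add_smul, sub_add_eq_sub_sub, sub_add_cancel]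
    rfl

theorem fockI_mem_fockWt {b : κ → ℚ} {y : 𝓦} (v : ι × κ)
    (hy : y ∈ fockWt fun a => b a + if v.2 = a then 1 else 0) : fockI ℚ v y ∈ fockWt b := by
  refine mem_fockWt.mpr fun a => ?_
  have h1 : 𝓣 a a * fockI ℚ v = fockI ℚ v * 𝓣 a a - if v.2 = a then fockI ℚ v else 0 := by
    rw [totPol, add_mul, mul_add, (superWeyl_poly.commute_colPol_j a a v).eq,
      superWeyl_poly.fermi.extPol_j a a v.2 v.1, add_sub_assoc]
    congr 2
    split_ifs with h
    · subst h
      rfl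
    · rfl
  have h2 := LinearMap.congr_fun h1 y
  rw [Module.End.mul_apply, LinearMap.sub_apply, Module.End.mul_apply, mem_fockWt.mp hy,
    map_smul, add_smul] at h2
  rw [h2]
  split_ifs <;> simp

theorem mem_gBdr_of_fockWt {d j : ℕ} {w : κ → ℤ} {r : ι → ℤ} {z : 𝓖} (hw : z ∈ gWt w r)
    (hz : z ∈ gCyc ι κ d j)
    (h : ∀ α : ι × κ →₀ ℕ, ∀ f : 𝓦, f ∈ fockCyc d (fun a => w a + Fintype.card ι + colDeg a α : κ → ℚ) →
      𝓝 f = (j : ℚ) • f →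
      ∃ y ∈ fockMinor ι κ d ⊓ fockWt (fun a => w a + Fintype.card ι + colDeg a α : κ → ℚ), 𝓓 y = f) :
    z ∈ gBdr ι κ d j := by
  let b : (ι × κ →₀ ℕ) → κ → ℚ := fun α a => w a + Fintype.card ι + colDeg a α
  have hb : ∀ α v, b (α + Finsupp.single v 1) = fun a => b α a + if v.2 = a then 1 else 0 := by
    intro α v
    funext a
    have : (colDeg a (Finsupp.single v 1) : ℚ) = if v.2 = a then 1 else 0 := by
      rw [colDeg]
      push_cast
      by_cases hv : v.2 = a <;> simp [Finsupp.single_apply, Prod.ext_iff, hv]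
    simp only [b, colDeg_add]
    push_cast
    rw [this]
    ring
  have h1 : ∀ α, ∀ f ∈ fockMinor ι κ d ⊓ fockWt (b α) ⊓ fockGr ι κ j, 𝓓 f = 0 →
      ∃ y ∈ fockMinor ι κ d ⊓ fockWt (b α) ⊓ fockGr ι κ (j + 1), 𝓓 y = f := fun α f hf hf0 => by
    obtain ⟨y, hy, hyf⟩ := h α f (mem_fockCyc.mpr ⟨hf.1.1, hf0, mem_fockWt.mp hf.1.2⟩)
      (numOp_eq_smul hf.2)
    exact exists_koszul_eq_of_fockGr hf.2 hy hyf
  have h2 : ∀ α, z α ∈ fockMinor ι κ d ⊓ fockWt (b α) ⊓ fockGr ι κ j := fun α => by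
    refine ⟨⟨hz.1.1 α, mem_fockWt.mpr fun a => ?_⟩, hz.1.2 α⟩
    have h1 := DFunLike.congr_fun (hw.1 a) α
    rw [gCol_eq_sum, sub_eq_iff_eq_add, Finsupp.smul_apply, ← add_smul] at h1
    exact h1
  obtain ⟨Y, hY, hYz⟩ := exists_gDiff_eq h1
    (fun α y hy => ⟨⟨koszul_mem d hy.1.1, koszul_mem_fockWt hy.1.2⟩, koszul_mem_fockGr hy.2⟩)
    (fun α v y hy => ⟨⟨fockI_mem v hy.1.1, fockI_mem_fockWt v (hb α v ▸ hy.1.2)⟩,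
      fockI_mem_fockGr v hy.2⟩) h2 hz.2
  exact ⟨Y, ⟨fun α => (hY α).1.1, fun α => (hY α).2⟩, hYz⟩

theorem gDeg_comm (v w : ι × κ) : Commute (gDeg v : Module.End ℚ 𝓖) (gDeg w) :=
  commute_of_diagonal (co := gCoord) gCoord_ext (fun z c => gCoord_gDeg v z c) fun z c => gCoord_gDeg w z c

theorem gDeg_sum_diagonal (T : Finset (ι × κ)) (z : 𝓖) :
    ∃ F : Finset ℤ, (∏ k ∈ F, (Polynomial.X - Polynomial.C (k : ℚ))).aeval
      (∑ v ∈ T, gDeg v : Module.End ℚ 𝓖) z = 0 :=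
  exists_prod_sub_eq_zero gCoord_ext finite_gCoord (g := fun c => ∑ v ∈ T, multDeg v c) (fun z c => by
    rw [LinearMap.sum_apply, map_sum, Finset.sum_congr rfl fun v _ => gCoord_gDeg v z c,
      ← Finset.sum_mul]
    push_cast
    rfl) z

theorem gDeg_mem_gGr (v : ι × κ) (p : ℕ) {z : 𝓖} (hz : z ∈ gGr ι κ p) : gDeg v z ∈ gGr ι κ p := by
  intro α A hA
  refine MvPolynomial.ext _ _ fun β => ?_
  have := gCoord_gDeg v z (α, A, β)
  rw [gCoord_apply, gCoord_apply] at this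
  rw [this, hz α A hA, coeff_zero, mul_zero]

/-- The row and column degree operators. -/
noncomputable def gTot (t : κ ⊕ ι) : Module.End ℚ 𝓖 := t.elim (gCol ι) (gRow κ)

theorem gTot_eq_sum (t : κ ⊕ ι) : ∃ T : Finset (ι × κ), (gTot t : Module.End ℚ 𝓖) = ∑ v ∈ T, gDeg v := by
  obtain a | i := t
  · refine ⟨Finset.univ.map ⟨fun i => (i, a), fun i j h => (Prod.ext_iff.mp h).1⟩, ?_⟩
    rw [Finset.sum_map]
    rfl
  · refine ⟨Finset.univ.map ⟨fun a => (i, a), fun i j h => (Prod.ext_iff.mp h).2⟩, ?_⟩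
    rw [Finset.sum_map]
    rfl

theorem gCol_mem_gMinor (d : ℕ) (a : κ) {z : 𝓖} (hz : z ∈ gMinor ι κ d) :
    gCol ι a z ∈ gMinor ι κ d := fun α => by
  rw [gCol_eq_sum]
  exact sub_mem (totPol_mem d a a (hz α)) (Submodule.smul_mem _ _ (hz α))

theorem gRow_mem_gMinor (d : ℕ) (i : ι) {z : 𝓖} (hz : z ∈ gMinor ι κ d) :
    gRow κ i z ∈ gMinor ι κ d := by
  have h : gRow κ i z = rowPol (R := Module.End ℚ 𝓖) gX gP i i z
      + ∑ a, gE (i, a) (gI (i, a) z) - ∑ a, xiMul 𝓦 (i, a) (gX i a z + xiDer 𝓦 (i, a) z) := by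
    rw [gRow, rowPol, LinearMap.sum_apply, LinearMap.sum_apply, ← Finset.sum_add_distrib,
      ← Finset.sum_sub_distrib]
    refine Finset.sum_congr rfl fun a _ => ?_
    have h2 := LinearMap.congr_fun (commute_xiMap_xiMul (fX i a) (i, a)).eq z
    rw [Module.End.mul_apply, Module.End.mul_apply] at h2
    rw [gDeg, Module.End.mul_apply (gX i a), LinearMap.add_apply (xiMap _ _), map_add (gX i a), h2,
      map_add (xiMul 𝓦 (i, a)), map_add, map_mul, map_mul]
    simp only [LinearMap.sub_apply, LinearMap.add_apply, Module.End.mul_apply]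
    abel
  rw [h]
  have h3 := hz
  rw [mem_gMinor_iff_mem_minorSub] at h3
  refine sub_mem (add_mem ?_ (sum_mem fun a _ => gE_mem d _ (gI_mem d _ hz)))
    (sum_mem fun a _ => xiMul_mem d _ (add_mem (gX_mem d _ _ hz) (xiDer_mem d _ hz)))
  rw [mem_gMinor_iff_mem_minorSub, ← varMul_eq_gX]
  exact isPartial_gP.rowPol_mem i i d h3

/-- If every variable acts nilpotently on the homology of the model, the homology vanishes. -/
theorem gCyc_le_gBdr {d δ j : ℕ} (hδ : Fintype.card ι = Fintype.card κ + δ) (h0 : 0 < δ)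
    (hd : Fintype.card κ ≤ d) (hd0 : 0 < d) (hj : j ≠ Fintype.card κ * δ)
    (hnil : ∀ (i : ι) (b : κ), ∃ k, ∀ h ∈ gCyc ι κ d j, (gX i b ^ k : Module.End ℚ 𝓖) h ∈ gBdr ι κ d j) :
    gCyc ι κ d j ≤ gBdr ι κ d j := by
  have hwt : ∀ w r, gWt w r ⊓ gCyc ι κ d j ≤ gBdr ι κ d j := by
    refine (gWeightData ι κ d j).wt_inf_le superWeyl_g.weyl (by omega) hd ?_ ?_ hnil
    · rintro w r h hw hZ ⟨a, ha⟩
      refine mem_gBdr_of_fockWt hw hZ fun α f hf _ =>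
        exists_koszul_eq_of_weight (a := a) hf (by omega) ?_
      have : (d : ℚ) - Fintype.card κ < w a := by exact_mod_cast ha
      have : (0 : ℚ) ≤ colDeg a α := Nat.cast_nonneg _
      linarith
    · intro w r h hw hZ hwa
      refine mem_gBdr_of_fockWt hw hZ fun α f hf hN => ?_
      have hwa' : ∀ a, (w a : ℚ) + Fintype.card ι = d + δ := fun a => by
        rw [hwa, hδ]
        push_cast
        ring
      simp only [hwa'] at hf ⊢
      rcases eq_or_ne α 0 with rfl | hα
      · have h3 : ∀ a, (colDeg a (0 : ι × κ →₀ ℕ) : ℚ) = 0 := fun a => by simp [colDeg]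
        simp only [h3, add_zero] at hf ⊢
        exact exists_koszul_eq_of_numOp hf hδ hd0 hj hN
      · obtain ⟨v, hv⟩ := Finsupp.ne_iff.mp hα
        refine exists_koszul_eq_of_weight (a := v.2) hf (by omega) ?_
        have h4 : 1 ≤ colDeg v.2 α := (Nat.one_le_iff_ne_zero.mpr hv).trans
          (Finset.single_le_sum (f := fun i => α (i, v.2)) (fun _ _ => Nat.zero_le _)
            (Finset.mem_univ v.1))
        have h5 : (1 : ℚ) ≤ colDeg v.2 α := by exact_mod_cast h4
        rw [hδ]
        push_cast
        linarith
  refine le_of_joint_eigenvectors (G := gTot) Finset.univ (fun t z => ?_) (fun s t => ?_)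
    (fun t z hz => ?_) fun z hz k hk => ?_
  · obtain ⟨T, hT⟩ := gTot_eq_sum t
    rw [hT]
    exact gDeg_sum_diagonal T z
  · obtain ⟨T, hT⟩ := gTot_eq_sum s
    obtain ⟨T', hT'⟩ := gTot_eq_sum t
    rw [hT, hT']
    exact Commute.sum_left _ _ _ fun v _ => Commute.sum_right _ _ _ fun w _ => gDeg_comm v w
  · refine ⟨⟨?_, ?_⟩, ?_⟩
    · obtain a | i := t
      · exact gCol_mem_gMinor d a hz.1.1
      · exact gRow_mem_gMinor d i hz.1.1
    · obtain ⟨T, hT⟩ := gTot_eq_sum t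
      rw [hT, LinearMap.sum_apply]
      exact sum_mem fun v _ => gDeg_mem_gGr v j hz.1.2
    · obtain ⟨T, hT⟩ := gTot_eq_sum t
      have := LinearMap.congr_fun (Commute.sum_left T _ _ fun v _ => commute_gDeg_gDiff v).eq z
      rw [Module.End.mul_apply, Module.End.mul_apply, show gDiff ι κ z = 0 from hz.2, map_zero] at this
      rw [hT]
      exact this.symm
  · refine hwt (fun a => k (.inl a) - Fintype.card ι) (fun i => k (.inr i) - Fintype.card κ)
      ⟨⟨fun a => ?_, fun i => ?_⟩, hz⟩
    · refine (hk (.inl a) (Finset.mem_univ _)).trans ?_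
      push_cast
      rw [sub_add_cancel]
    · refine (hk (.inr i) (Finset.mem_univ _)).trans ?_
      push_cast
      rw [sub_add_cancel]

end ModelHomology

section FullModel

variable {ι κ : Type*} [Fintype ι] [Fintype κ] [DecidableEq ι] [DecidableEq κ]

local notation "𝓦" => Finset (ι × κ) → MvPolynomial (ι × κ) ℚ
local notation "𝓖" => (ι × κ →₀ ℕ) →₀ Finset (ι × κ) → MvPolynomial (ι × κ) ℚ
local notation "𝓓" => koszul (R := Module.End ℚ 𝓦) fX (fockI ℚ)
local notation "𝓝" => numOp (R := Module.End ℚ 𝓦) (fockE ℚ) (fockI ℚ)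

theorem IsSuperWeyl.koszul_euler {R : Type*} [Ring R] {x p : ι → κ → R} {e j : ι × κ → R}
    (h : IsSuperWeyl x p e j) :
    koszul x j * (∑ v : ι × κ, p v.1 v.2 * e v) + (∑ v : ι × κ, p v.1 v.2 * e v) * koszul x j =
      ∑ v : ι × κ, x v.1 v.2 * p v.1 v.2 + numOp e j := by
  have key : ∀ v w : ι × κ, x v.1 v.2 * j v * (p w.1 w.2 * e w) + p w.1 w.2 * e w * (x v.1 v.2 * j v)
      = if v = w then x v.1 v.2 * p v.1 v.2 + e v * j v else 0 := fun v w => by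
    have h1 := h.weyl.px w.1 w.2 v.1 v.2
    have h2 := h.fermi.je v w
    have h3 : w.1 = v.1 ∧ w.2 = v.2 ↔ v = w := by rw [Prod.ext_iff, eq_comm, @eq_comm _ w.2]
    simp only [h3] at h1
    have h4 : x v.1 v.2 * j v * (p w.1 w.2 * e w) = x v.1 v.2 * p w.1 w.2 * (j v * e w) := by
      rw [mul_assoc, ← mul_assoc (j v), ← (h.pj w.1 w.2 v).eq]
      simp only [mul_assoc]
    have h5 : p w.1 w.2 * e w * (x v.1 v.2 * j v) = p w.1 w.2 * x v.1 v.2 * (e w * j v) := by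
      rw [mul_assoc, ← mul_assoc (e w), ← (h.xe v.1 v.2 w).eq]
      simp only [mul_assoc]
    rw [h4, h5, h1, h2]
    split_ifs with hvw
    · subst hvw
      noncomm_ring
    · noncomm_ring
  rw [koszul, Finset.sum_mul_sum, Finset.sum_mul_sum, Finset.sum_comm (s := Finset.univ) (t := Finset.univ)
      (f := fun v w => p v.1 v.2 * e v * (x w.1 w.2 * j w)), ← Finset.sum_add_distrib]
  simp_rw [← Finset.sum_add_distrib, key]
  simp [numOp, Finset.sum_add_distrib]

theorem homogeneousComponent_X_mul {σ R : Type*} [CommSemiring R] (v : σ) (n : ℕ)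
    (f : MvPolynomial σ R) :
    homogeneousComponent (n + 1) (X v * f) = X v * homogeneousComponent n f := by
  classical
  ext β
  rw [coeff_homogeneousComponent, coeff_X_mul', coeff_X_mul', coeff_homogeneousComponent]
  by_cases hv : v ∈ β.support
  · have : (β - Finsupp.single v 1).degree + 1 = β.degree := by
      have h1 : Finsupp.single v 1 ≤ β := by
        rw [Finsupp.single_le_iff]
        exact Nat.one_le_iff_ne_zero.mpr (Finsupp.mem_support_iff.mp hv)
      conv_rhs => rw [← tsub_add_cancel_of_le h1, map_add]
      simp
    rw [if_pos hv, if_pos hv, ← this]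
    simp
  · simp [hv]

theorem fockE_mem_fockGr {p : ℕ} (v : ι × κ) {f : 𝓦} (hf : f ∈ fockGr ι κ p) :
    fockE ℚ v f ∈ fockGr ι κ (p + 1) := fun A hA => by
  rw [fockE_apply]
  split_ifs with h
  · rw [hf _ fun h1 => hA ?_, smul_zero]
    have := Finset.card_pos.mpr ⟨v, h⟩
    rw [Finset.card_erase_of_mem h] at h1
    omega
  · rfl

theorem koszul_apply (f : 𝓦) (A : Finset (ι × κ)) :
    𝓓 f A = ∑ v, X v * fockI ℚ v f A := by
  rw [koszul, LinearMap.sum_apply, Finset.sum_apply]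
  rfl

/-- The Koszul complex of the variables is exact in positive degrees. -/
theorem exists_koszul_eq {p : ℕ} {w : 𝓦} (hw : w ∈ fockGr ι κ (p + 1)) (h0 : 𝓓 w = 0) :
    ∃ y ∈ fockGr ι κ (p + 2), 𝓓 y = w := by
  set H : Module.End ℚ 𝓦 := ∑ v : ι × κ, fP v.1 v.2 * fockE ℚ v with hH
  let co : ℕ → 𝓦 := fun n A => homogeneousComponent n (w A)
  have hco : ∀ n, co n ∈ fockGr ι κ (p + 1) := fun n A hA => by
    simp only [co, hw A hA, map_zero]
  have hH' : ∀ {f : 𝓦}, f ∈ fockGr ι κ (p + 1) → H f ∈ fockGr ι κ (p + 2) := fun {f} hf => by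
    rw [hH, LinearMap.sum_apply]
    refine sum_mem fun v _ => fun A hA => ?_
    rw [Module.End.mul_apply (fP v.1 v.2), fP, fockLift, fockMap_apply, fockE_mem_fockGr v hf A hA, map_zero]
  have hz : ∀ n, 𝓓 (co n) = 0 := fun n => funext fun A => by
    have h1 := congrArg (homogeneousComponent (n + 1)) (congrFun h0 A)
    rw [koszul_apply, map_sum] at h1
    rw [koszul_apply]
    refine Eq.trans (Finset.sum_congr rfl fun v _ => ?_) (h1.trans (map_zero _))
    rw [homogeneousComponent_X_mul, fockI_apply, fockI_apply]
    split_ifs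
    · simp
    · rw [map_zsmul]
  have he : ∀ n, 𝓓 (H (co n)) = ((n + (p + 1) : ℕ) : ℚ) • co n := fun n => by
    have h1 := LinearMap.congr_fun (superWeyl_poly (ι := ι) (κ := κ)).koszul_euler (co n)
    rw [LinearMap.add_apply, Module.End.mul_apply, Module.End.mul_apply _ 𝓓, hz, map_zero, add_zero,
      LinearMap.add_apply, numOp_eq_smul (hco n)] at h1
    rw [h1, Nat.cast_add n, add_smul]
    congr 1
    funext A
    rw [LinearMap.sum_apply, Finset.sum_apply]
    have h2 := (homogeneousComponent_isHomogeneous n (w A)).sum_X_mul_pderiv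
    rw [Pi.smul_apply, Nat.cast_smul_eq_nsmul]
    exact h2
  obtain ⟨N, hN⟩ : ∃ N, ∀ A, (w A).totalDegree < N :=
    ⟨(Finset.univ.sup fun A => (w A).totalDegree) + 1, fun A => Nat.lt_succ_of_le
      (Finset.le_sup (f := fun A => (w A).totalDegree) (Finset.mem_univ A))⟩
  refine ⟨∑ n ∈ Finset.range N, ((n + (p + 1) : ℕ) : ℚ)⁻¹ • H (co n),
    sum_mem fun n _ => Submodule.smul_mem _ _ (hH' (hco n)), ?_⟩
  rw [map_sum]
  have h3 : ∀ n, 𝓓 (((n + (p + 1) : ℕ) : ℚ)⁻¹ • H (co n)) = co n := fun n => by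
    rw [map_smul, he, smul_smul, inv_mul_cancel₀ (by positivity), one_smul]
  simp_rw [h3]
  funext A
  rw [Finset.sum_apply]
  have h4 := sum_homogeneousComponent (w A)
  rw [← h4]
  refine (Finset.sum_subset (Finset.range_subset_range.mpr (hN A)) fun n _ hn => ?_).symm.trans ?_
  · refine homogeneousComponent_eq_zero _ _ ?_
    simpa [Nat.lt_succ_iff] using hn
  · rw [h4]

/-- The full model is exact in positive degrees. -/
theorem exists_gDiff_eq_of_gGr {p : ℕ} {z : 𝓖} (hz : z ∈ gGr ι κ (p + 1)) (h0 : gDiff ι κ z = 0) :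
    ∃ y ∈ gGr ι κ (p + 2), gDiff ι κ y = z :=
  exists_gDiff_eq (U := fun _ => fockGr ι κ (p + 1)) (V := fun _ => fockGr ι κ (p + 2))
    (fun _ _ hw h => exists_koszul_eq hw h) (fun _ _ hy => koszul_mem_fockGr hy)
    (fun _ v _ hy => fockI_mem_fockGr v hy) hz h0

end FullModel

section Pairing

variable {ι κ : Type*} [Fintype ι] [Fintype κ] [DecidableEq ι] [DecidableEq κ]

local notation "𝓢" => MvPolynomial (ι × κ) ℚ
local notation "𝓦" => Finset (ι × κ) → MvPolynomial (ι × κ) ℚ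
local notation "𝓖" => (ι × κ →₀ ℕ) →₀ Finset (ι × κ) → MvPolynomial (ι × κ) ℚ

/-- Signed factorials of multi-indices. -/
noncomputable def signFact {σ : Type*} [Fintype σ] (α : σ →₀ ℕ) : ℚ :=
  ∏ v, (-1) ^ α v * ((α v).factorial : ℚ)

theorem signFact_ne_zero {σ : Type*} [Fintype σ] (α : σ →₀ ℕ) : signFact α ≠ 0 :=
  Finset.prod_ne_zero_iff.mpr fun _ _ => mul_ne_zero (pow_ne_zero _ (by norm_num))
    (Nat.cast_ne_zero.mpr (Nat.factorial_ne_zero _))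

theorem signFact_add_single {σ : Type*} [Fintype σ] [DecidableEq σ] (α : σ →₀ ℕ) (v : σ) :
    signFact (α + Finsupp.single v 1) = -((α v + 1 : ℚ) * signFact α) := by
  rw [signFact, signFact, ← Finset.mul_prod_erase _ _ (Finset.mem_univ v),
    ← Finset.mul_prod_erase _ (fun w => (-1) ^ α w * ((α w).factorial : ℚ)) (Finset.mem_univ v)]
  rw [Finset.prod_congr rfl fun w hw => by
    rw [Finsupp.add_apply, Finsupp.single_eq_of_ne (Finset.ne_of_mem_erase hw), add_zero]]
  rw [Finsupp.add_apply, Finsupp.single_eq_same, Nat.factorial_succ, pow_succ]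
  push_cast
  ring

/-- The pairing of the model with polynomials identifying its zeroth homology with the inverse
system of the polynomial ring. -/
noncomputable def gPair (ι κ : Type*) [Fintype ι] [Fintype κ] :
    ((ι × κ →₀ ℕ) →₀ Finset (ι × κ) → MvPolynomial (ι × κ) ℚ) →ₗ[ℚ]
      MvPolynomial (ι × κ) ℚ →ₗ[ℚ] ℚ :=
  Finsupp.lsum ℚ fun α => signFact α •
    (((LinearMap.mul ℚ (MvPolynomial (ι × κ) ℚ)).compr₂ (lcoeff ℚ α)) ∘ₗ LinearMap.proj ∅)

theorem gPair_single (α : ι × κ →₀ ℕ) (f : 𝓦) (g : 𝓢) :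
    gPair ι κ (Finsupp.single α f) g = signFact α * coeff α (f ∅ * g) := by
  simp [gPair]

theorem gPair_smul (f : 𝓢) (z : 𝓖) (g : 𝓢) : gPair ι κ (f • z) g = gPair ι κ z (f * g) := by
  induction z using Finsupp.induction_linear with
  | zero => simp
  | add u v hu hv => rw [smul_add, map_add, LinearMap.add_apply, hu, hv, map_add, LinearMap.add_apply]
  | single α u =>
    rw [Finsupp.smul_single, gPair_single, gPair_single, Pi.smul_apply, smul_eq_mul]
    ring_nf

theorem gY_single (v : ι × κ) (α : ι × κ →₀ ℕ) (f : 𝓦) :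
    gY v (Finsupp.single α f : 𝓖) = Finsupp.single α (fX v.1 v.2 f)
      + Finsupp.single (α - Finsupp.single v 1) ((α v : ℚ) • f) := by
  rw [gY, LinearMap.add_apply, gX, xiMap_single, xiDer_single]

theorem gPair_gY (v : ι × κ) (z : 𝓖) : gPair ι κ (gY v z) = 0 := by
  refine LinearMap.ext fun g => ?_
  rw [LinearMap.zero_apply]
  induction z using Finsupp.induction_linear with
  | zero => rw [map_zero, map_zero, LinearMap.zero_apply]
  | add u w hu hw => rw [map_add, map_add, LinearMap.add_apply, hu, hw, add_zero]
  | single α u =>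
    rw [gY_single, map_add, LinearMap.add_apply, gPair_single, gPair_single]
    have h1 : fX v.1 v.2 u ∅ = X v * u ∅ := rfl
    rw [h1, mul_assoc, coeff_X_mul']
    split_ifs with h
    · obtain ⟨β, rfl⟩ : ∃ β, α = β + Finsupp.single v 1 := by
        refine ⟨α - Finsupp.single v 1, (tsub_add_cancel_of_le ?_).symm⟩
        rw [Finsupp.single_le_iff]
        exact Nat.one_le_iff_ne_zero.mpr (Finsupp.mem_support_iff.mp h)
      rw [add_tsub_cancel_right, signFact_add_single, Pi.smul_apply, smul_mul_assoc, coeff_smul]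
      simp
      ring
    · have h2 : α v = 0 := by simpa using h
      rw [h2]
      simp

theorem gPair_gDiff (z : 𝓖) : gPair ι κ (gDiff ι κ z) = 0 := by
  rw [gDiff, LinearMap.sum_apply, map_sum]
  exact Finset.sum_eq_zero fun v _ => gPair_gY v _

/-- The elements of the model without polynomial variables. -/
noncomputable def gConst (ι κ : Type*) [Fintype ι] [Fintype κ] [DecidableEq ι] [DecidableEq κ] :
    ((ι × κ →₀ ℕ) →₀ ℚ) →ₗ[ℚ] (ι × κ →₀ ℕ) →₀ Finset (ι × κ) → MvPolynomial (ι × κ) ℚ :=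
  Finsupp.mapRange.linearMap
    (LinearMap.single ℚ (fun _ : Finset (ι × κ) => MvPolynomial (ι × κ) ℚ) ∅ ∘ₗ Algebra.linearMap ℚ _)

theorem gConst_single (β : ι × κ →₀ ℕ) (c : ℚ) :
    gConst ι κ (Finsupp.single β c) = Finsupp.single β (Pi.single ∅ (C c) : 𝓦) := by
  simp [gConst]

theorem gConst_mem_gGr (c : (ι × κ →₀ ℕ) →₀ ℚ) : gConst ι κ c ∈ gGr ι κ 0 := fun α A hA => by
  have : A ≠ ∅ := by rintro rfl; exact hA rfl
  simp [gConst, this]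

theorem gPair_gConst (c : (ι × κ →₀ ℕ) →₀ ℚ) (γ : ι × κ →₀ ℕ) :
    gPair ι κ (gConst ι κ c) (monomial γ 1) = c γ * signFact γ := by
  induction c using Finsupp.induction_linear with
  | zero => simp
  | add u w hu hw => rw [map_add, map_add, LinearMap.add_apply, hu, hw, Finsupp.add_apply, add_mul]
  | single α u =>
    rw [gConst_single, gPair_single, Pi.single_eq_same, coeff_C_mul, coeff_monomial, Finsupp.single_apply]
    by_cases h : α = γ
    · subst h; simp [mul_comm]
    · simp [h, Ne.symm h]

theorem gI_gE_of_gGr (v w : ι × κ) {y : 𝓖} (hy : y ∈ gGr ι κ 0) :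
    gI w (gE v y) = if w = v then y else 0 := by
  have h1 := LinearMap.congr_fun ((superWeyl_g (ι := ι) (κ := κ)).fermi.je w v) y
  rw [Module.End.mul_apply (gI w)] at h1
  rw [h1, LinearMap.sub_apply, Module.End.mul_apply (gE v)]
  have h2 : gI w y = 0 := Finsupp.ext fun α => funext fun A => by
    rw [gI, xiMap_apply, fockI_apply]
    split_ifs with h
    · rfl
    · rw [hy α _ (by rw [Finset.card_insert_of_notMem h]; omega), smul_zero]
      rfl
  rw [h2, map_zero, sub_zero]
  split_ifs <;> rfl

/-- Modulo boundaries, elements of degree zero are constant. -/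
theorem exists_gConst {z : 𝓖} (hz : z ∈ gGr ι κ 0) :
    ∃ c, ∃ y ∈ gGr ι κ 1, z = gConst ι κ c + gDiff ι κ y := by
  let Q : Submodule ℚ 𝓖 := (gConst ι κ).range ⊔ (gGr ι κ 1).map (gDiff ι κ)
  have hY : ∀ v, ∀ y ∈ gGr ι κ 0, gY v y ∈ Q := fun v y hy => by
    refine Submodule.mem_sup_right ⟨gE v y, gE_mem_gGr 0 v hy, ?_⟩
    rw [gDiff, LinearMap.sum_apply]
    simp_rw [Module.End.mul_apply (gY (_ : ι × κ)), gI_gE_of_gGr v _ hy]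
    rw [Finset.sum_eq_single v (fun w _ h => by rw [if_neg h, map_zero]) (fun h => absurd (Finset.mem_univ v) h),
      if_pos rfl]
  have hs : ∀ f : 𝓢, ∀ α, (Finsupp.single α (Pi.single ∅ f) : 𝓖) ∈ Q := fun f => by
    induction f using MvPolynomial.induction_on with
    | C a => exact fun α => Submodule.mem_sup_left ⟨Finsupp.single α a, gConst_single α a⟩
    | add f g hf hg =>
      intro α
      rw [Pi.single_add, Finsupp.single_add]
      exact add_mem (hf α) (hg α)
    | mul_X f v hf =>
      intro α
      have h1 := gY_single v α (Pi.single ∅ f : 𝓦)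
      have h2 : (fX v.1 v.2 (Pi.single ∅ f) : 𝓦) = Pi.single ∅ (f * X v) := funext fun A => by
        have : (fX v.1 v.2 (Pi.single ∅ f : 𝓦) : 𝓦) A = X v * (Pi.single ∅ f : 𝓦) A := rfl
        rw [this, Pi.single_apply, Pi.single_apply]
        split_ifs
        · ring
        · ring
      rw [h2] at h1
      rw [← sub_eq_iff_eq_add.mpr h1, ← Finsupp.smul_single]
      refine sub_mem (hY v _ fun β A hA => ?_) (Submodule.smul_mem _ _ (hf _))
      have : A ≠ ∅ := by rintro rfl; exact hA rfl
      simp only [Finsupp.single_apply]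
      split_ifs
      · simp [this]
      · rfl
  have hzQ : z ∈ Q := by
    rw [← Finsupp.sum_single z]
    refine sum_mem fun α _ => ?_
    have : z α = Pi.single ∅ (z α ∅) := funext fun A => by
      by_cases hA : A = ∅
      · subst hA; simp
      · rw [Pi.single_eq_of_ne hA, hz α A (by simpa using hA)]
    rw [this]
    exact hs _ α
  obtain ⟨_, ⟨c, rfl⟩, _, ⟨y, hy, rfl⟩, h⟩ := Submodule.mem_sup.mp hzQ
  exact ⟨c, y, hy, h.symm⟩

/-- The kernel of the pairing consists of boundaries. -/
theorem exists_gDiff_eq_of_gPair {z : 𝓖} (hz : z ∈ gGr ι κ 0) (h : gPair ι κ z = 0) :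
    ∃ y ∈ gGr ι κ 1, gDiff ι κ y = z := by
  obtain ⟨c, y, hy, rfl⟩ := exists_gConst hz
  rw [map_add, gPair_gDiff, add_zero] at h
  have : c = 0 := Finsupp.ext fun γ => by
    have h1 := gPair_gConst c γ
    rw [h, LinearMap.zero_apply] at h1
    exact (mul_eq_zero.mp h1.symm).resolve_right (signFact_ne_zero γ)
  exact ⟨y, hy, by rw [this, map_zero, zero_add]⟩

theorem exists_gPair_eq_zero (z : 𝓖) : ∃ k, ∀ g ∈ idealOfVars (ι × κ) ℚ ^ k, gPair ι κ z g = 0 := by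
  obtain ⟨k, hk⟩ : ∃ k, ∀ α ∈ z.support, α.degree < k :=
    ⟨z.support.sup Finsupp.degree + 1, fun α hα => Nat.lt_succ_of_le (Finset.le_sup hα)⟩
  refine ⟨k, fun g hg => ?_⟩
  rw [← Finsupp.sum_single z, Finsupp.sum, map_sum, LinearMap.sum_apply]
  refine Finset.sum_eq_zero fun α hα => ?_
  rw [gPair_single, (mem_pow_idealOfVars_iff' k _).mp (Ideal.mul_mem_left _ _ hg) α (hk α hα), mul_zero]

/-- Every functional vanishing on a power of the irrelevant ideal is represented. -/
theorem exists_gPair_eq {k : ℕ} {f : 𝓢 →ₗ[ℚ] ℚ} (hf : ∀ g ∈ idealOfVars (ι × κ) ℚ ^ k, f g = 0) :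
    ∃ z ∈ gGr ι κ 0, gPair ι κ z = f := by
  have hfin : {γ : ι × κ →₀ ℕ | γ.degree < k}.Finite := by
    refine (Set.finite_Iic (Finsupp.equivFunOnFinite.symm fun _ => k)).subset fun γ hγ v => ?_
    exact (Finsupp.le_degree v γ).trans (le_of_lt hγ)
  let c : (ι × κ →₀ ℕ) →₀ ℚ := Finsupp.onFinset hfin.toFinset
    (fun γ => f (monomial γ 1) * (signFact γ)⁻¹) fun γ hγ => by
      rw [Set.Finite.mem_toFinset]
      by_contra h
      refine hγ ?_
      rw [hf _ ((mem_pow_idealOfVars_iff' k _).mpr fun x hx => ?_), zero_mul]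
      rw [coeff_monomial, if_neg]
      rintro rfl
      exact h hx
  refine ⟨gConst ι κ c, gConst_mem_gGr c, MvPolynomial.linearMap_ext fun γ => LinearMap.ext_ring ?_⟩
  change gPair ι κ (gConst ι κ c) (monomial γ 1) = f (monomial γ 1)
  rw [gPair_gConst]
  change f (monomial γ 1) * (signFact γ)⁻¹ * signFact γ = _
  rw [mul_assoc, inv_mul_cancel₀ (signFact_ne_zero γ), mul_one]

end Pairing

section Bicomplex

/-- A first quadrant double complex with exact rows augmented to `Y` and with columns exact in
positive degrees, given by submodules of the ambient modules `W q`. -/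
structure IsResolvedBicomplex {k : Type*} [Ring k] {W : ℕ → Type*} [∀ q, AddCommGroup (W q)]
    [∀ q, Module k (W q)] {V : Type*} [AddCommGroup V] [Module k V]
    (X : ∀ q, ℕ → Submodule k (W q)) (dh : ∀ q, W (q + 1) →ₗ[k] W q) (dv : ∀ q, W q →ₗ[k] W q)
    (a : W 0 →ₗ[k] V) (Y : ℕ → Submodule k V) (dY : V →ₗ[k] V) : Prop where
  dh_mem : ∀ {q p u}, u ∈ X (q + 1) p → dh q u ∈ X q p
  dv_mem : ∀ {q p u}, u ∈ X q (p + 1) → dv q u ∈ X q p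
  comm : ∀ q u, dh q (dv (q + 1) u) = dv q (dh q u)
  dh_dh : ∀ q u, dh q (dh (q + 1) u) = 0
  dv_dv : ∀ q u, dv q (dv q u) = 0
  row : ∀ {q p u}, u ∈ X (q + 1) p → dh q u = 0 → ∃ c ∈ X (q + 2) p, dh (q + 1) c = u
  row_zero : ∀ {p u}, u ∈ X 0 p → a u = 0 → ∃ c ∈ X 1 p, dh 0 c = u
  col : ∀ {q p u}, u ∈ X q (p + 1) → dv q u = 0 → ∃ e ∈ X q (p + 2), dv q e = u
  a_dh : ∀ u, a (dh 0 u) = 0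
  a_mem : ∀ {p u}, u ∈ X 0 p → a u ∈ Y p
  a_surj : ∀ {p y}, y ∈ Y p → ∃ u ∈ X 0 p, a u = y
  a_dv : ∀ u, a (dv 0 u) = dY (a u)

namespace IsResolvedBicomplex

variable {k : Type*} [Ring k] {W : ℕ → Type*} [∀ q, AddCommGroup (W q)]
  [∀ q, Module k (W q)] {V : Type*} [AddCommGroup V] [Module k V]
  {X : ∀ q, ℕ → Submodule k (W q)} {dh : ∀ q, W (q + 1) →ₗ[k] W q} {dv : ∀ q, W q →ₗ[k] W q}
  {a : W 0 →ₗ[k] V} {Y : ℕ → Submodule k V} {dY : V →ₗ[k] V}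

/-- If `s` annihilates the homology of the bottom row modulo boundaries in degree `j`, then it
annihilates the homology of `Y` in degree `j`. -/
theorem mem_boundaries (h : IsResolvedBicomplex X dh dv a Y dY) {s : ∀ q, W q →ₗ[k] W q}
    {t : V →ₗ[k] V} (hsX : ∀ {q p u}, u ∈ X q p → s q u ∈ X q p)
    (hsh : ∀ q u, dh q (s (q + 1) u) = s q (dh q u)) (hsv : ∀ q u, dv q (s q u) = s q (dv q u))
    (hst : ∀ u, a (s 0 u) = t (a u)) {j : ℕ}
    (H : ∀ u ∈ X (j + 1) 0, (∃ e ∈ X j 1, dh j u = dv j e) →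
      ∃ c ∈ X (j + 2) 0, ∃ e ∈ X (j + 1) 1, s (j + 1) u = dh (j + 1) c + dv (j + 1) e)
    {y : V} (hy : y ∈ Y (j + 1)) (hy0 : dY y = 0) : ∃ y' ∈ Y (j + 2), t y = dY y' := by
  have claim : ∀ p q, q + p = j → ∀ u ∈ X (q + 1) p, (∃ e ∈ X q (p + 1), dh q u = dv q e) →
      ∃ c ∈ X (q + 2) p, ∃ e ∈ X (q + 1) (p + 1), s (q + 1) u = dh (q + 1) c + dv (q + 1) e := by
    intro p
    induction p with
    | zero =>
      rintro q rfl u hu hd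
      exact H u hu hd
    | succ p ih =>
      rintro q hq u hu ⟨w, hw, hd⟩
      obtain ⟨c, hc, hcu⟩ := h.row (h.dv_mem hu) (by rw [h.comm, hd, h.dv_dv])
      obtain ⟨c', hc', e, he, hce⟩ := ih (q + 1) (by omega) c hc ⟨u, hu, hcu⟩
      obtain ⟨e', he', hde⟩ := h.col (u := s (q + 1) u - dh (q + 1) e)
        (sub_mem (hsX hu) (h.dh_mem he)) (by
          rw [map_sub, hsv, ← h.comm, ← hcu, ← hsh, ← map_sub, hce, add_sub_cancel_right, h.dh_dh])
      exact ⟨e, he, e', he', by rw [hde]; abel⟩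
  obtain ⟨u, hu, rfl⟩ := h.a_surj hy
  obtain ⟨c, hc, hcu⟩ := h.row_zero (h.dv_mem hu) (by rw [h.a_dv, hy0])
  obtain ⟨c', hc', e, he, hce⟩ := claim j 0 (by omega) c hc ⟨u, hu, hcu⟩
  obtain ⟨e', he', hde⟩ := h.col (u := s 0 u - dh 0 e) (sub_mem (hsX hu) (h.dh_mem he)) (by
    rw [map_sub, hsv, ← h.comm, ← hcu, ← hsh, ← map_sub, hce, add_sub_cancel_right, h.dh_dh])
  refine ⟨a e', h.a_mem he', ?_⟩
  rw [← h.a_dv, hde, map_sub, h.a_dh, sub_zero, hst]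

/-- If `Y` has no homology in degree `j`, then neither has the bottom row modulo boundaries. -/
theorem exists_bottom (h : IsResolvedBicomplex X dh dv a Y dY) {j : ℕ}
    (H : ∀ y ∈ Y (j + 1), dY y = 0 → ∃ y' ∈ Y (j + 2), y = dY y')
    {u : W (j + 1)} (hu : u ∈ X (j + 1) 0) (hd : ∃ e ∈ X j 1, dh j u = dv j e) :
    ∃ c ∈ X (j + 2) 0, ∃ e ∈ X (j + 1) 1, u = dh (j + 1) c + dv (j + 1) e := by
  have claim : ∀ q p, q + p = j → ∀ u ∈ X q (p + 1), (∃ e ∈ X (q + 1) p, dv q u = dh q e) →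
      ∃ c ∈ X (q + 1) (p + 1), ∃ e ∈ X q (p + 2), u = dh q c + dv q e := by
    clear hd hu u
    intro q
    induction q with
    | zero =>
      rintro p hp u hu ⟨w, hw, hd⟩
      obtain rfl : p = j := by omega
      obtain ⟨y', hy', hay⟩ := H (a u) (h.a_mem hu) (by rw [← h.a_dv, hd, h.a_dh])
      obtain ⟨e, he, rfl⟩ := h.a_surj hy'
      obtain ⟨c, hc, hcu⟩ := h.row_zero (u := u - dv 0 e) (sub_mem hu (h.dv_mem he)) (by
        rw [map_sub, h.a_dv, hay, sub_self])
      exact ⟨c, hc, e, he, by rw [hcu]; abel⟩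
    | succ q ih =>
      rintro p hp u hu ⟨w, hw, hd⟩
      obtain ⟨c, hc, hcu⟩ := h.col (h.dh_mem hu) (by rw [← h.comm, hd, h.dh_dh])
      obtain ⟨c', hc', e, he, hce⟩ := ih (p + 1) (by omega) c hc ⟨u, hu, hcu⟩
      obtain ⟨e', he', hde⟩ := h.row (u := u - dv (q + 1) c') (sub_mem hu (h.dv_mem hc')) (by
        rw [map_sub, h.comm, ← hcu, ← map_sub, hce, add_sub_cancel_left, h.dv_dv])
      exact ⟨e', he', c', hc', by rw [hde]; abel⟩
  obtain ⟨e, he, hue⟩ := hd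
  obtain ⟨c', hc', e', he', hce⟩ := claim j 0 (by omega) e he ⟨u, hu, hue.symm⟩
  obtain ⟨c, hc, hcu⟩ := h.row (u := u - dv (j + 1) c') (sub_mem hu (h.dv_mem hc')) (by
    rw [map_sub, h.comm, hue, ← map_sub, hce, add_sub_cancel_left, h.dv_dv])
  exact ⟨c, hc, c', hc', by rw [hcu]; abel⟩

end IsResolvedBicomplex

end Bicomplex

section MatRes

/-- The action of a matrix on vectors with entries in a module. -/
def matAct {R N l m : Type*} [CommRing R] [AddCommGroup N] [Module R N] [Fintype m]
    (A : Matrix l m R) : (m → N) →ₗ[R] (l → N) where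
  toFun z i := ∑ j, A i j • z j
  map_add' z w := by ext i; simp [Finset.sum_add_distrib]
  map_smul' c z := by ext i; simp [Finset.smul_sum, smul_comm c]

variable {R N l m n : Type*} [CommRing R] [AddCommGroup N] [Module R N] [Fintype m]
  [Fintype n]

theorem matAct_apply (A : Matrix l m R) (z : m → N) (i : l) :
    matAct A z i = ∑ j, A i j • z j := rfl

theorem matAct_mul (A : Matrix l m R) (B : Matrix m n R) (z : n → N) :
    matAct (A * B) z = matAct A (matAct B z) := by
  ext i
  simp only [matAct_apply, Matrix.mul_apply, Finset.sum_smul, Finset.smul_sum, mul_smul]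
  exact Finset.sum_comm

theorem matAct_zero (z : m → N) : matAct (0 : Matrix l m R) z = 0 := by
  ext i
  simp [matAct_apply]

/-- Exactness of a pair of matrices persists with coefficients in a flat module. -/
theorem exists_matAct_eq_of_flat [Fintype l] [Module.Flat R N] {A : Matrix l m R} {B : Matrix m n R}
    (h : ∀ z : m → R, matAct A z = 0 → ∃ w : n → R, matAct B w = z) {z : m → N}
    (hz : matAct A z = 0) : ∃ w : n → N, matAct B w = z := by
  classical
  obtain ⟨k, a, y, hx, ha⟩ := Module.Flat.exists_factorization_of_comp_eq_zero_of_free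
    (f := (matAct A.transpose : (l → R) →ₗ[R] (m → R)))
    (x := Fintype.linearCombination R z) (by
      refine LinearMap.pi_ext' fun i => LinearMap.ext_ring ?_
      simp only [LinearMap.comp_apply, LinearMap.single_apply, LinearMap.zero_apply,
        Fintype.linearCombination_apply, matAct_apply, Matrix.transpose_apply, smul_eq_mul,
        Pi.single_apply, mul_ite, mul_one, mul_zero, Finset.sum_ite_eq', Finset.mem_univ, if_true]
      exact congrFun hz i)
  have hv : ∀ t, matAct A (fun j => a (Pi.single j 1) t) = 0 := fun t => by
    ext i
    have h1 : (matAct A.transpose (Pi.single i 1) : m → R) = ∑ j, A i j • Pi.single j 1 := by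
      ext j
      simp [matAct_apply, Pi.single_apply]
    have := congrArg (fun u => u t) (LinearMap.congr_fun ha (Pi.single i 1))
    rw [LinearMap.comp_apply, h1, map_sum] at this
    simpa [matAct_apply, Finsupp.finsetSum_apply] using this
  choose w hw using fun t => h _ (hv t)
  refine ⟨fun p => ∑ t, w t p • y (Finsupp.single t 1), ?_⟩
  ext j
  have hj := LinearMap.congr_fun hx (Pi.single j 1)
  rw [Fintype.linearCombination_apply_single, one_smul, LinearMap.comp_apply] at hj
  have h2 : ∀ e : Fin k →₀ R, y e = ∑ t, e t • y (Finsupp.single t 1) := fun e => by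
    conv_lhs => rw [← Finsupp.univ_sum_single e]
    simp only [map_sum, ← map_smul, Finsupp.smul_single, smul_eq_mul, mul_one]
  rw [hj, h2, matAct_apply]
  simp only [Finset.smul_sum, ← mul_smul]
  rw [Finset.sum_comm]
  refine Finset.sum_congr rfl fun t _ => ?_
  rw [← Finset.sum_smul]
  exact congrArg (· • _) (congrFun (hw t) j)

theorem matAct_map {T : Type*} [CommRing T] [Algebra R T] (A : Matrix l m R) (z : m → T) :
    matAct (A.map (algebraMap R T)) z = matAct A z := by
  ext i
  simp [matAct_apply, Algebra.smul_def]

/-- A resolution of an ideal by free modules of finite rank, given by matrices. -/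
structure MatRes (R : Type*) [CommRing R] (J : Ideal R) where
  /-- The ranks of the free modules. -/
  rk : ℕ → ℕ
  /-- The generators of the ideal, as a row. -/
  gen : Matrix Unit (Fin (rk 0)) R
  /-- The matrices of the differentials. -/
  mat : ∀ q, Matrix (Fin (rk q)) (Fin (rk (q + 1))) R
  span_gen : Ideal.span (Set.range (gen ())) = J
  gen_mat : gen * mat 0 = 0
  mat_mat : ∀ q, mat q * mat (q + 1) = 0
  exact_gen : ∀ z : Fin (rk 0) → R, matAct gen z = 0 → ∃ w : Fin (rk 1) → R, matAct (mat 0) w = z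
  exact : ∀ q (z : Fin (rk (q + 1)) → R), matAct (mat q) z = 0 →
    ∃ w : Fin (rk (q + 2)) → R, matAct (mat (q + 1)) w = z

theorem exists_matrix_of_isNoetherianRing [IsNoetherianRing R] (A : Matrix l m R) :
    ∃ (n : ℕ) (B : Matrix m (Fin n) R), A * B = 0 ∧
      ∀ z : m → R, matAct A z = 0 → ∃ w : Fin n → R, matAct B w = z := by
  obtain ⟨n, s, hs⟩ := Submodule.fg_iff_exists_fin_generating_family.mp
    (IsNoetherian.noetherian (LinearMap.ker (matAct A : (m → R) →ₗ[R] (l → R))))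
  refine ⟨n, Matrix.of fun i j => s j i, ?_, fun z hz => ?_⟩
  · ext i j
    have : s j ∈ LinearMap.ker (matAct A : (m → R) →ₗ[R] (l → R)) :=
      hs ▸ Submodule.subset_span ⟨j, rfl⟩
    exact congrFun (LinearMap.mem_ker.mp this) i
  · have : z ∈ Submodule.span R (Set.range s) := hs ▸ LinearMap.mem_ker.mpr hz
    obtain ⟨c, hc⟩ := (Submodule.mem_span_range_iff_exists_fun R).mp this
    refine ⟨c, ?_⟩
    rw [← hc]
    ext i
    simp [matAct_apply, mul_comm]

namespace MatRes

/-- Ideals of Noetherian rings have resolutions by free modules of finite rank. -/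
theorem nonempty_of_isNoetherianRing [IsNoetherianRing R] (J : Ideal R) :
    Nonempty (MatRes R J) := by
  obtain ⟨n₀, g, hg⟩ := Submodule.fg_iff_exists_fin_generating_family.mp
    (IsNoetherian.noetherian J)
  obtain ⟨n₁, A₀, hA₀, hA₀'⟩ := exists_matrix_of_isNoetherianRing
    (Matrix.of fun (_ : Unit) i => g i)
  choose f B hB hB' using fun s : Σ a b : ℕ, Matrix (Fin a) (Fin b) R =>
    exists_matrix_of_isNoetherianRing s.2.2
  let q : ℕ → Σ a b : ℕ, Matrix (Fin a) (Fin b) R := fun n =>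
    Nat.rec ⟨n₀, n₁, A₀⟩ (fun _ s => ⟨s.2.1, f s, B s⟩) n
  exact ⟨{
    rk := fun n => (q n).1
    gen := Matrix.of fun (_ : Unit) i => g i
    mat := fun n => (q n).2.2
    span_gen := hg
    gen_mat := hA₀
    mat_mat := fun n => hB (q n)
    exact_gen := hA₀'
    exact := fun n => hB' (q n) }⟩

variable {J : Ideal R} (F : MatRes R J)

theorem exact_gen_of_flat [Module.Flat R N] {z : Fin (F.rk 0) → N} (hz : matAct F.gen z = 0) :
    ∃ w : Fin (F.rk 1) → N, matAct (F.mat 0) w = z :=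
  exists_matAct_eq_of_flat F.exact_gen hz

theorem exact_of_flat [Module.Flat R N] {q : ℕ} {z : Fin (F.rk (q + 1)) → N}
    (hz : matAct (F.mat q) z = 0) : ∃ w : Fin (F.rk (q + 2)) → N, matAct (F.mat (q + 1)) w = z :=
  exists_matAct_eq_of_flat (F.exact q) hz

/-- Base change of a resolution along a flat algebra. -/
def baseChange (T : Type*) [CommRing T] [Algebra R T] [Module.Flat R T] :
    MatRes T (J.map (algebraMap R T)) where
  rk := F.rk
  gen := F.gen.map (algebraMap R T)
  mat q := (F.mat q).map (algebraMap R T)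
  span_gen := by
    have h := congrArg (Ideal.map (algebraMap R T)) F.span_gen
    rw [Ideal.map_span, ← Set.range_comp] at h
    exact h
  gen_mat := by rw [← Matrix.map_mul, F.gen_mat, Matrix.map_zero _ (map_zero _)]
  mat_mat q := by rw [← Matrix.map_mul, F.mat_mat, Matrix.map_zero _ (map_zero _)]
  exact_gen z hz := by
    rw [matAct_map] at hz
    simp only [matAct_map]
    exact F.exact_gen_of_flat hz
  exact q z hz := by
    rw [matAct_map] at hz
    simp only [matAct_map]
    exact F.exact_of_flat hz

/-- Vanishing of the cohomology in degree `k + 1` of the dual of the resolution. -/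
def Vanish (k : ℕ) : Prop :=
  ∀ φ : Fin (F.rk (k + 1)) → R, matAct (F.mat (k + 1)).transpose φ = 0 →
    ∃ ψ : Fin (F.rk k) → R, matAct (F.mat k).transpose ψ = φ

theorem Vanish.baseChange {F : MatRes R J} {k : ℕ} (h : F.Vanish k) (T : Type*) [CommRing T]
    [Algebra R T] [Module.Flat R T] : (F.baseChange T).Vanish k := fun φ hφ => by
  obtain ⟨ψ, hψ⟩ := exists_matAct_eq_of_flat h
    ((matAct_map (T := T) (F.mat (k + 1)).transpose φ).symm.trans hφ)
  exact ⟨ψ, (matAct_map (T := T) (F.mat k).transpose ψ).trans hψ⟩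

end MatRes

end MatRes

section ModelResolution

variable {ι κ : Type*} [Fintype ι] [Fintype κ] [DecidableEq ι] [DecidableEq κ]

local notation "𝓢" => MvPolynomial (ι × κ) ℚ
local notation "𝓦" => Finset (ι × κ) → MvPolynomial (ι × κ) ℚ
local notation "𝓖" => (ι × κ →₀ ℕ) →₀ Finset (ι × κ) → MvPolynomial (ι × κ) ℚ

theorem gX_apply_eq_smul (i : ι) (a : κ) (z : 𝓖) : gX i a z = (X (i, a) : 𝓢) • z := by
  rw [← varMul_eq_gX, varMul_apply]

theorem gDiff_smul (f : 𝓢) (z : 𝓖) : gDiff ι κ (f • z) = f • gDiff ι κ z := by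
  induction f using MvPolynomial.induction_on generalizing z with
  | C c => rw [← algebraMap_eq, algebraMap_smul, algebraMap_smul, map_smul]
  | add f g hf hg => rw [add_smul, map_add, hf, hg, add_smul]
  | mul_X f v hf =>
    rw [mul_smul, hf, mul_smul, ← gX_apply_eq_smul v.1 v.2, ← gX_apply_eq_smul v.1 v.2]
    exact congrArg (f • ·) (LinearMap.congr_fun (commute_gDiff_gX v.1 v.2) z)

theorem smul_mem_gGr {p : ℕ} (f : 𝓢) {z : 𝓖} (hz : z ∈ gGr ι κ p) : f • z ∈ gGr ι κ p :=
  fun α A hA => by rw [Finsupp.smul_apply, Pi.smul_apply, hz α A hA, smul_zero]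

/-- The projection onto the part of exterior degree `p`. -/
noncomputable def gPart (ι κ : Type*) (p : ℕ) :
    ((ι × κ →₀ ℕ) →₀ Finset (ι × κ) → MvPolynomial (ι × κ) ℚ) →ₗ[MvPolynomial (ι × κ) ℚ]
      (ι × κ →₀ ℕ) →₀ Finset (ι × κ) → MvPolynomial (ι × κ) ℚ :=
  Finsupp.mapRange.linearMap (LinearMap.pi fun A => if A.card = p then LinearMap.proj A else 0)

theorem gPart_apply (p : ℕ) (z : 𝓖) (α : ι × κ →₀ ℕ) (A : Finset (ι × κ)) :
    gPart ι κ p z α A = if A.card = p then z α A else 0 := by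
  simp only [gPart, Finsupp.mapRange.linearMap_apply, Finsupp.mapRange_apply, LinearMap.pi_apply]
  split_ifs <;> rfl

theorem gPart_mem_gGr (p : ℕ) (z : 𝓖) : gPart ι κ p z ∈ gGr ι κ p := fun α A hA => by
  rw [gPart_apply, if_neg hA]

theorem gPart_eq_self {p : ℕ} {z : 𝓖} (hz : z ∈ gGr ι κ p) : gPart ι κ p z = z := by
  refine Finsupp.ext fun α => _root_.funext fun A => ?_
  rw [gPart_apply]
  split_ifs with h
  · rfl
  · exact (hz α A h).symm

variable {d : ℕ} (F : MatRes (MvPolynomial (ι × κ) ℚ) (maxMinors (genMat ι κ ℚ) ^ d))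

/-- Vectors of elements of the model of exterior degree `p`. -/
noncomputable def gVec (n p : ℕ) : Submodule ℚ (Fin n → 𝓖) := Submodule.pi Set.univ fun _ => gGr ι κ p

theorem mem_gVec {n p : ℕ} {u : Fin n → 𝓖} : u ∈ gVec n p ↔ ∀ i, u i ∈ gGr ι κ p := by
  simp [gVec]

theorem matAct_mem_gVec {n m p : ℕ} (A : Matrix (Fin n) (Fin m) 𝓢) {u : Fin m → 𝓖}
    (hu : u ∈ gVec m p) : matAct A u ∈ gVec n p :=
  mem_gVec.mpr fun _ => sum_mem fun j _ => smul_mem_gGr _ (mem_gVec.mp hu j)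

theorem exists_matAct_eq_of_gVec {l : Type*} {n m p : ℕ} {A : Matrix l (Fin n) 𝓢}
    {B : Matrix (Fin n) (Fin m) 𝓢}
    (h : ∀ z : Fin n → 𝓖, matAct A z = 0 → ∃ w : Fin m → 𝓖, matAct B w = z) {u : Fin n → 𝓖}
    (hu : u ∈ gVec n p) (h0 : matAct A u = 0) : ∃ c ∈ gVec m p, matAct B c = u := by
  obtain ⟨w, rfl⟩ := h u h0
  refine ⟨fun i => gPart ι κ p (w i), mem_gVec.mpr fun i => gPart_mem_gGr p _, ?_⟩
  ext1 i
  rw [← gPart_eq_self (mem_gVec.mp hu i), matAct_apply, matAct_apply, map_sum]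
  simp only [map_smul]

theorem matAct_gen_mem {u : Fin (F.rk 0) → 𝓖} : matAct F.gen u () ∈ gMinor ι κ d := by
  rw [mem_gMinor_iff_mem_minorSub, matAct_apply]
  exact sum_mem fun i _ => smul_mem_minorSub d (F.span_gen.le (Ideal.subset_span ⟨i, rfl⟩)) _

theorem exists_matAct_gen {y : 𝓖} (hy : y ∈ gMinor ι κ d) :
    ∃ u : Fin (F.rk 0) → 𝓖, matAct F.gen u () = y := by
  rw [mem_gMinor_iff_mem_minorSub] at hy
  refine Submodule.smul_induction_on hy (fun f hf h _ => ?_) ?_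
  · rw [← F.span_gen] at hf
    obtain ⟨c, rfl⟩ := (Submodule.mem_span_range_iff_exists_fun 𝓢).mp hf
    refine ⟨fun i => c i • h, ?_⟩
    rw [matAct_apply, Finset.sum_smul]
    simp only [← mul_smul, smul_eq_mul, mul_comm]
  · rintro _ _ ⟨u, rfl⟩ ⟨v, rfl⟩
    exact ⟨u + v, by rw [map_add, Pi.add_apply]⟩

theorem gDiff_matAct {l : Type*} {n : ℕ} (A : Matrix l (Fin n) 𝓢) (u : Fin n → 𝓖) (i : l) :
    matAct A (fun j => gDiff ι κ (u j)) i = gDiff ι κ (matAct A u i) := by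
  simp only [matAct_apply, map_sum, gDiff_smul]

/-- The double complex of a resolution of a power of the ideal of maximal minors with coefficients
in the model. -/
theorem isResolvedBicomplex_gVec :
    IsResolvedBicomplex (k := ℚ) (W := fun q => Fin (F.rk q) → 𝓖) (fun q p => gVec (F.rk q) p)
      (fun q => (matAct (F.mat q)).restrictScalars ℚ)
      (fun q => (gDiff ι κ).compLeft (Fin (F.rk q)))
      (LinearMap.proj () ∘ₗ (matAct F.gen).restrictScalars ℚ)
      (fun p => gMinor ι κ d ⊓ gGr ι κ p) (gDiff ι κ) where
  dh_mem hu := matAct_mem_gVec _ hu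
  dv_mem {q p u} hu := mem_gVec.mpr fun i => gDiff_mem_gGr p (mem_gVec.mp hu i)
  comm q u := _root_.funext fun i => gDiff_matAct _ u i
  dh_dh q u := by
    change matAct (F.mat q) (matAct (F.mat (q + 1)) u) = 0
    rw [← matAct_mul, F.mat_mat, matAct_zero]
  dv_dv q u := _root_.funext fun i => LinearMap.congr_fun (gDiff_mul_self (ι := ι) (κ := κ)) (u i)
  row hu h0 := exists_matAct_eq_of_gVec (fun z hz => F.exact_of_flat hz) hu h0
  row_zero {p u} hu h0 := exists_matAct_eq_of_gVec (A := F.gen) (fun z hz => F.exact_gen_of_flat hz) hu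
    (_root_.funext fun _ => h0)
  col {q p u} hu h0 := by
    choose e he h using fun i => exists_gDiff_eq_of_gGr (mem_gVec.mp hu i) (congrFun h0 i)
    exact ⟨e, mem_gVec.mpr he, _root_.funext h⟩
  a_dh u := by
    change matAct F.gen (matAct (F.mat 0) u) () = 0
    rw [← matAct_mul, F.gen_mat, matAct_zero]
    rfl
  a_mem {p u} hu := by
    have h : ∑ j, F.gen () j • u j ∈ gGr ι κ p :=
      sum_mem fun j _ => smul_mem_gGr _ (mem_gVec.mp hu j)
    exact ⟨matAct_gen_mem F, h⟩
  a_surj {p y} hy := by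
    obtain ⟨u, rfl⟩ := exists_matAct_gen F hy.1
    refine ⟨fun i => gPart ι κ p (u i), mem_gVec.mpr fun i => gPart_mem_gGr p _, ?_⟩
    refine Eq.trans ?_ (gPart_eq_self hy.2)
    change matAct F.gen _ () = _
    rw [matAct_apply, matAct_apply, map_sum]
    simp only [map_smul]
  a_dv u := gDiff_matAct _ u ()

end ModelResolution

section ModelDuality

variable {ι κ : Type*} [Fintype ι] [Fintype κ] [DecidableEq ι] [DecidableEq κ]

local notation "𝓢" => MvPolynomial (ι × κ) ℚ
local notation "𝓖" => (ι × κ →₀ ℕ) →₀ Finset (ι × κ) → MvPolynomial (ι × κ) ℚ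
local notation "𝔪" => idealOfVars (ι × κ) ℚ

/-- The pairing of vectors of elements of the model with vectors of polynomials. -/
noncomputable def gVecPair {n : ℕ} :
    (Fin n → 𝓖) →ₗ[ℚ] (Fin n → 𝓢) →ₗ[ℚ] ℚ :=
  ∑ i, (LinearMap.lcomp ℚ ℚ (LinearMap.proj i)) ∘ₗ gPair ι κ ∘ₗ LinearMap.proj i

theorem gVecPair_apply {n : ℕ} (u : Fin n → 𝓖) (φ : Fin n → 𝓢) :
    gVecPair u φ = ∑ i, gPair ι κ (u i) (φ i) := by
  simp [gVecPair]

theorem gVecPair_matAct {n m : ℕ} (A : Matrix (Fin n) (Fin m) 𝓢) (u : Fin m → 𝓖) (φ : Fin n → 𝓢) :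
    gVecPair (matAct A u) φ = gVecPair u (matAct A.transpose φ) := by
  simp only [gVecPair_apply, matAct_apply, map_sum, LinearMap.sum_apply, gPair_smul,
    Matrix.transpose_apply, smul_eq_mul]
  exact Finset.sum_comm

theorem gVecPair_smul {n : ℕ} (f : 𝓢) (u : Fin n → 𝓖) (φ : Fin n → 𝓢) :
    gVecPair (f • u) φ = gVecPair u (f • φ) := by
  simp only [gVecPair_apply, Pi.smul_apply, gPair_smul, smul_eq_mul]

theorem gVecPair_gDiff {n : ℕ} (u : Fin n → 𝓖) :
    gVecPair (fun i => gDiff ι κ (u i)) = 0 := by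
  refine LinearMap.ext fun φ => ?_
  rw [gVecPair_apply]
  exact Finset.sum_eq_zero fun i _ => by rw [gPair_gDiff, LinearMap.zero_apply]

theorem exists_gDiff_eq_of_gVecPair {n : ℕ} {u : Fin n → 𝓖} (hu : u ∈ gVec n 0)
    (h : gVecPair u = 0) : ∃ e ∈ gVec n 1, (gDiff ι κ).compLeft (Fin n) e = u := by
  choose e he h using fun i => exists_gDiff_eq_of_gPair (mem_gVec.mp hu i) (by
    refine LinearMap.ext fun g => ?_
    have := LinearMap.congr_fun h (Pi.single i g)
    rw [gVecPair_apply, Finset.sum_eq_single i] at this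
    · simpa using this
    · intro j _ hj
      rw [Pi.single_eq_of_ne hj, map_zero]
    · simp)
  exact ⟨e, mem_gVec.mpr he, _root_.funext h⟩

theorem exists_gVecPair_eq_zero {n : ℕ} (u : Fin n → 𝓖) :
    ∃ k, ∀ φ ∈ 𝔪 ^ k • (⊤ : Submodule 𝓢 (Fin n → 𝓢)), gVecPair u φ = 0 := by
  choose k hk using fun i => exists_gPair_eq_zero (u i)
  refine ⟨Finset.univ.sup k, fun φ hφ => ?_⟩
  rw [gVecPair_apply]
  refine Finset.sum_eq_zero fun i _ => hk i _ ?_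
  refine Submodule.smul_induction_on hφ (fun f hf g _ => ?_) fun f g hf hg => add_mem hf hg
  exact Ideal.mul_mem_right _ _ (Ideal.pow_le_pow_right (Finset.le_sup (Finset.mem_univ i)) hf)

theorem exists_gVecPair_eq {n k : ℕ} {f : (Fin n → 𝓢) →ₗ[ℚ] ℚ}
    (hf : ∀ φ ∈ 𝔪 ^ k • (⊤ : Submodule 𝓢 (Fin n → 𝓢)), f φ = 0) :
    ∃ u ∈ gVec n 0, gVecPair u = f := by
  choose u hu h using fun i => exists_gPair_eq (ι := ι) (κ := κ) (k := k)
    (f := f ∘ₗ LinearMap.single ℚ (fun _ => 𝓢) i) fun g hg => by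
      refine hf _ ?_
      have : (Pi.single i g : Fin n → 𝓢) = g • Pi.single i 1 := by
        rw [← Pi.single_smul, smul_eq_mul, mul_one]
      rw [LinearMap.single_apply, this]
      exact Submodule.smul_mem_smul hg trivial
  refine ⟨u, mem_gVec.mpr hu, LinearMap.ext fun φ => ?_⟩
  rw [gVecPair_apply]
  simp only [h, LinearMap.comp_apply, ← map_sum]
  exact congrArg f (Finset.univ_sum_single φ)

theorem exists_pow_smul_inf_le {R M : Type*} [CommRing R] [IsNoetherianRing R] [AddCommGroup M]
    [Module R M] [Module.Finite R M] (I : Ideal R) (N : Submodule R M) (l : ℕ) :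
    ∃ L, I ^ L • ⊤ ⊓ N ≤ I ^ l • N := by
  obtain ⟨k, hk⟩ := Ideal.exists_pow_inf_eq_pow_smul I N
  refine ⟨l + k, ?_⟩
  rw [hk (l + k) (Nat.le_add_left k l), Nat.add_sub_cancel]
  exact Submodule.smul_mono le_rfl inf_le_right

variable {d : ℕ} (F : MatRes (MvPolynomial (ι × κ) ℚ) (maxMinors (genMat ι κ ℚ) ^ d))

theorem exists_bottom_of_smul {k : ℕ} {f : 𝓢}
    (hf : ∀ φ : Fin (F.rk (k + 1)) → 𝓢, matAct (F.mat (k + 1)).transpose φ = 0 →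
      ∃ ψ : Fin (F.rk k) → 𝓢, matAct (F.mat k).transpose ψ = f • φ)
    {u : Fin (F.rk (k + 1)) → 𝓖} (hu : u ∈ gVec _ 0)
    (he : ∃ e ∈ gVec (F.rk k) 1, matAct (F.mat k) u = (gDiff ι κ).compLeft _ e) :
    ∃ c ∈ gVec (F.rk (k + 2)) 0, ∃ e ∈ gVec (F.rk (k + 1)) 1,
      f • u = matAct (F.mat (k + 1)) c + (gDiff ι κ).compLeft _ e := by
  obtain ⟨e, -, he⟩ := he
  let B : (Fin (F.rk (k + 1)) → 𝓢) →ₗ[𝓢] (Fin (F.rk (k + 2)) → 𝓢) :=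
    matAct (F.mat (k + 1)).transpose
  have hC : ∀ φ, B φ = 0 → gVecPair (f • u) φ = 0 := fun φ hφ => by
    obtain ⟨ψ, hψ⟩ := hf φ hφ
    rw [gVecPair_smul, ← hψ, ← gVecPair_matAct, he]
    exact LinearMap.congr_fun (gVecPair_gDiff e) ψ
  obtain ⟨l, hl⟩ := exists_gVecPair_eq_zero (f • u)
  obtain ⟨L, hL⟩ := exists_pow_smul_inf_le 𝔪 (LinearMap.range B) l
  let T : (Fin (F.rk (k + 1)) → 𝓢) →ₗ[ℚ] _ :=
    ((𝔪 ^ L • (⊤ : Submodule 𝓢 (Fin (F.rk (k + 2)) → 𝓢))).mkQ ∘ₗ B).restrictScalars ℚ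
  have hT : gVecPair (f • u) ∈ LinearMap.range T.dualMap := by
    rw [LinearMap.range_dualMap_eq_dualAnnihilator_ker, Submodule.mem_dualAnnihilator]
    intro φ hφ
    have h1 : B φ ∈ 𝔪 ^ L • (⊤ : Submodule 𝓢 (Fin (F.rk (k + 2)) → 𝓢)) :=
      (Submodule.Quotient.mk_eq_zero _).mp hφ
    have h2 := hL ⟨h1, φ, rfl⟩
    rw [LinearMap.range_eq_map, ← Submodule.map_smul''] at h2
    obtain ⟨φ', h3, h4⟩ := h2
    have h5 := hC (φ - φ') (by rw [map_sub, h4, sub_self])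
    rwa [map_sub, hl φ' h3, sub_zero] at h5
  obtain ⟨μ, hμ⟩ := hT
  obtain ⟨c, hc, h⟩ := exists_gVecPair_eq (k := L)
    (f := μ ∘ₗ (𝔪 ^ L • (⊤ : Submodule 𝓢 (Fin (F.rk (k + 2)) → 𝓢))).mkQ.restrictScalars ℚ)
    fun φ hφ => by
      have : (𝔪 ^ L • (⊤ : Submodule 𝓢 (Fin (F.rk (k + 2)) → 𝓢))).mkQ φ = 0 :=
        (Submodule.Quotient.mk_eq_zero _).mpr hφ
      rw [LinearMap.comp_apply, LinearMap.restrictScalars_apply, this, map_zero]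
  obtain ⟨e', he', h'⟩ := exists_gDiff_eq_of_gVecPair (u := f • u - matAct (F.mat (k + 1)) c)
    (sub_mem (mem_gVec.mpr fun i => smul_mem_gGr f (mem_gVec.mp hu i)) (matAct_mem_gVec _ hc)) (by
      refine LinearMap.ext fun φ => ?_
      rw [map_sub, LinearMap.sub_apply, gVecPair_matAct, h, ← hμ]
      exact sub_self _)
  exact ⟨c, hc, e', he', by rw [h']; abel⟩

/-- A polynomial annihilating the cohomology of the dual of the resolution annihilates the homology
of the model. -/
theorem smul_mem_gBdr {k : ℕ} {f : 𝓢}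
    (hf : ∀ φ : Fin (F.rk (k + 1)) → 𝓢, matAct (F.mat (k + 1)).transpose φ = 0 →
      ∃ ψ : Fin (F.rk k) → 𝓢, matAct (F.mat k).transpose ψ = f • φ)
    {z : 𝓖} (hz : z ∈ gCyc ι κ d (k + 1)) : f • z ∈ gBdr ι κ d (k + 1) := by
  obtain ⟨y, hy, h⟩ := (isResolvedBicomplex_gVec F).mem_boundaries
    (s := fun q => (LinearMap.lsmul 𝓢 (Fin (F.rk q) → 𝓖) f).restrictScalars ℚ)
    (t := (LinearMap.lsmul 𝓢 𝓖 f).restrictScalars ℚ) (j := k)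
    (fun hu => mem_gVec.mpr fun i => smul_mem_gGr f (mem_gVec.mp hu i))
    (fun q u => map_smul (matAct (F.mat q)) f u)
    (fun q u => _root_.funext fun i => gDiff_smul f (u i))
    (fun u => congrFun (map_smul (matAct F.gen) f u) ())
    (fun u hu he => exists_bottom_of_smul F hf hu he) hz.1 hz.2
  exact mem_gBdr.mpr ⟨y, hy, h.symm⟩

/-- If the model has no homology and the cohomology of the dual of the resolution is annihilated by
a power of the irrelevant ideal, then this cohomology vanishes. -/
theorem vanish_of_gCyc_le_gBdr {k K : ℕ} (h : gCyc ι κ d (k + 1) ≤ gBdr ι κ d (k + 1))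
    (hK : ∀ f ∈ 𝔪 ^ K, ∀ φ : Fin (F.rk (k + 1)) → 𝓢, matAct (F.mat (k + 1)).transpose φ = 0 →
      ∃ ψ : Fin (F.rk k) → 𝓢, matAct (F.mat k).transpose ψ = f • φ) : F.Vanish k := by
  intro φ hφ
  let B : (Fin (F.rk (k + 1)) → 𝓢) →ₗ[𝓢] (Fin (F.rk (k + 2)) → 𝓢) :=
    matAct (F.mat (k + 1)).transpose
  let A : (Fin (F.rk k) → 𝓢) →ₗ[𝓢] (Fin (F.rk (k + 1)) → 𝓢) := matAct (F.mat k).transpose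
  have hBA : ∀ ψ, B (A ψ) = 0 := fun ψ => by
    change matAct _ (matAct _ ψ) = 0
    rw [← matAct_mul, ← Matrix.transpose_mul, F.mat_mat, Matrix.transpose_zero, matAct_zero]
  obtain ⟨L, hL⟩ := exists_pow_smul_inf_le 𝔪 (LinearMap.ker B) K
  have hL' : 𝔪 ^ K • LinearMap.ker B ≤ LinearMap.range A :=
    Submodule.smul_le.mpr fun f hf φ hφ => hK f hf φ hφ
  by_contra hA
  have hn : φ ∉ (LinearMap.range A ⊔ 𝔪 ^ L • ⊤).restrictScalars ℚ := fun hs => by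
    obtain ⟨_, ⟨ψ, rfl⟩, e, he, rfl⟩ := Submodule.mem_sup.mp hs
    have h1 : B e = 0 := by
      have h2 : B (A ψ + e) = 0 := hφ
      rwa [map_add, hBA, zero_add] at h2
    obtain ⟨ψ', h3⟩ := hL' (hL ⟨he, h1⟩)
    exact hA ⟨ψ + ψ', by rw [← h3]; exact map_add A ψ ψ'⟩
  obtain ⟨f, hf, hf0⟩ := Submodule.exists_dual_map_eq_bot_of_notMem hn inferInstance
  have hf0 : ∀ x ∈ LinearMap.range A ⊔ 𝔪 ^ L • ⊤, f x = 0 := fun x hx =>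
    (Submodule.mem_bot ℚ).mp (hf0 ▸ Submodule.mem_map_of_mem hx)
  obtain ⟨u, hu, rfl⟩ := exists_gVecPair_eq fun φ hφ => hf0 φ (Submodule.mem_sup_right hφ)
  obtain ⟨e, he, h1⟩ := exists_gDiff_eq_of_gVecPair (matAct_mem_gVec (F.mat k) hu) (by
    refine LinearMap.ext fun ψ => ?_
    rw [gVecPair_matAct]
    exact hf0 _ (Submodule.mem_sup_left ⟨ψ, rfl⟩))
  obtain ⟨c, hc, e', he', h2⟩ := (isResolvedBicomplex_gVec F).exists_bottom (j := k)
    (fun y hy h0 => by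
      obtain ⟨y', hy', h3⟩ := mem_gBdr.mp (h (mem_gCyc.mpr ⟨hy, h0⟩))
      exact ⟨y', hy', h3.symm⟩) hu ⟨e, he, h1.symm⟩
  refine hf ?_
  rw [h2, map_add, LinearMap.add_apply]
  refine (congrArg₂ (· + ·) ?_ (LinearMap.congr_fun (gVecPair_gDiff e') φ)).trans (add_zero 0)
  exact (gVecPair_matAct _ c φ).trans (by rw [hφ, map_zero])

end ModelDuality

section LocalVanishing

/-- Clearing denominators in a vanishing statement over a localization. -/
theorem MatRes.exists_pow_of_vanish_away {R : Type*} [CommRing R] [IsDomain R] [IsNoetherianRing R]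
    {J : Ideal R} (F : MatRes R J) {x : R} (hx : x ≠ 0) {k : ℕ}
    (h : (F.baseChange (Localization.Away x)).Vanish k) :
    ∃ N : ℕ, ∀ φ : Fin (F.rk (k + 1)) → R, matAct (F.mat (k + 1)).transpose φ = 0 →
      ∃ ψ : Fin (F.rk k) → R, matAct (F.mat k).transpose ψ = x ^ N • φ := by
  have hinj : Function.Injective (algebraMap R (Localization.Away x)) :=
    IsLocalization.injective _ (powers_le_nonZeroDivisors_of_noZeroDivisors hx)
  have hmap : ∀ {n m : ℕ} (A : Matrix (Fin n) (Fin m) R) (z : Fin m → R),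
      matAct (A.map (algebraMap R (Localization.Away x))) (fun i => algebraMap R _ (z i))
        = fun i => algebraMap R (Localization.Away x) (matAct A z i) := fun A z => by
    ext i
    simp [matAct_apply]
  have h' : ∀ φ : Fin (F.rk (k + 1)) → Localization.Away x,
      matAct ((F.mat (k + 1)).transpose.map (algebraMap R (Localization.Away x))) φ = 0 →
      ∃ ψ : Fin (F.rk k) → Localization.Away x,
        matAct ((F.mat k).transpose.map (algebraMap R (Localization.Away x))) ψ = φ := h
  have key : ∀ φ : Fin (F.rk (k + 1)) → R, matAct (F.mat (k + 1)).transpose φ = 0 →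
      ∃ (N : ℕ) (ψ : Fin (F.rk k) → R), matAct (F.mat k).transpose ψ = x ^ N • φ := fun φ hφ => by
    obtain ⟨ψ, hψ⟩ := h' (fun i => algebraMap R _ (φ i)) ((hmap _ φ).trans (by
      rw [hφ]
      ext i
      simp))
    obtain ⟨⟨_, N, rfl⟩, hb⟩ := IsLocalization.exist_integer_multiples_of_finite
      (Submonoid.powers x) ψ
    choose ψ' hψ' using hb
    refine ⟨N, ψ', ?_⟩
    ext i
    refine hinj ?_
    have h1 := congrFun (hmap (F.mat k).transpose ψ') i
    refine h1.symm.trans ?_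
    have h2 : (fun i => algebraMap R (Localization.Away x) (ψ' i)) = x ^ N • ψ :=
      _root_.funext hψ'
    rw [h2, matAct_map, map_smul, ← matAct_map, hψ]
    simp [Algebra.smul_def]
  obtain ⟨n, s, hs⟩ := Submodule.fg_iff_exists_fin_generating_family.mp
    (IsNoetherian.noetherian (LinearMap.ker (matAct (F.mat (k + 1)).transpose :
      (Fin (F.rk (k + 1)) → R) →ₗ[R] (Fin (F.rk (k + 2)) → R))))
  have hker : ∀ i, matAct (F.mat (k + 1)).transpose (s i) = 0 := fun i =>
    LinearMap.mem_ker.mp (hs.le (Submodule.subset_span ⟨i, rfl⟩))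
  choose N ψ hψ using fun i => key (s i) (hker i)
  refine ⟨Finset.univ.sup N, fun φ hφ => ?_⟩
  have hle : LinearMap.ker (matAct (F.mat (k + 1)).transpose :
      (Fin (F.rk (k + 1)) → R) →ₗ[R] (Fin (F.rk (k + 2)) → R)) ≤
      (LinearMap.range (matAct (F.mat k).transpose :
        (Fin (F.rk k) → R) →ₗ[R] (Fin (F.rk (k + 1)) → R))).comap
          (LinearMap.lsmul R _ (x ^ Finset.univ.sup N)) := by
    rw [← hs, Submodule.span_le]
    rintro _ ⟨i, rfl⟩
    refine ⟨x ^ (Finset.univ.sup N - N i) • ψ i, ?_⟩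
    rw [map_smul, hψ, ← mul_smul, ← pow_add, Nat.sub_add_cancel (Finset.le_sup (Finset.mem_univ i))]
    rfl
  exact hle hφ

variable {ι κ : Type*} [Fintype ι] [Fintype κ] [DecidableEq ι] [DecidableEq κ]

/-- Vanishing follows from vanishing after inverting each of the variables. -/
theorem vanish_of_vanish_away {d δ k : ℕ} (hδ : Fintype.card ι = Fintype.card κ + δ) (h0 : 0 < δ)
    (hd : Fintype.card κ ≤ d) (hd0 : 0 < d) (hk : k + 1 ≠ Fintype.card κ * δ)
    (F : MatRes (MvPolynomial (ι × κ) ℚ) (maxMinors (genMat ι κ ℚ) ^ d))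
    (h : ∀ v, (F.baseChange (Localization.Away (X v : MvPolynomial (ι × κ) ℚ))).Vanish k) :
    F.Vanish k := by
  choose N hN using fun v => F.exists_pow_of_vanish_away (X_ne_zero v) (h v)
  have h1 : gCyc ι κ d (k + 1) ≤ gBdr ι κ d (k + 1) :=
    gCyc_le_gBdr hδ h0 hd hd0 hk fun i b => ⟨N (i, b), fun z hz => by
      have h2 : ∀ n : ℕ, (gX i b ^ n : Module.End ℚ _) z
          = (X (i, b) ^ n : MvPolynomial (ι × κ) ℚ) • z := fun n => by
        induction n with
        | zero => rw [pow_zero, pow_zero, one_smul, Module.End.one_apply]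
        | succ n ih => rw [pow_succ', Module.End.mul_apply, ih, gX_apply_eq_smul, ← mul_smul, ← pow_succ']
      rw [h2]
      exact smul_mem_gBdr F (hN (i, b)) hz⟩
  let Q : Ideal (MvPolynomial (ι × κ) ℚ) :=
    { carrier := {f | ∀ φ : Fin (F.rk (k + 1)) → MvPolynomial (ι × κ) ℚ,
        matAct (F.mat (k + 1)).transpose φ = 0 →
          ∃ ψ : Fin (F.rk k) → MvPolynomial (ι × κ) ℚ, matAct (F.mat k).transpose ψ = f • φ}
      add_mem' := fun {f g} hf hg φ hφ => by
        obtain ⟨ψ, hψ⟩ := hf φ hφ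
        obtain ⟨ψ', hψ'⟩ := hg φ hφ
        exact ⟨ψ + ψ', by rw [map_add, hψ, hψ', add_smul]⟩
      zero_mem' := fun φ _ => ⟨0, by rw [map_zero, zero_smul]⟩
      smul_mem' := fun c f hf φ hφ => by
        obtain ⟨ψ, hψ⟩ := hf φ hφ
        exact ⟨c • ψ, by rw [map_smul, hψ, smul_eq_mul, mul_smul]⟩ }
  obtain ⟨K, hK⟩ := Ideal.exists_pow_le_of_le_radical_of_fg
    (I := idealOfVars (ι × κ) ℚ) (J := Q) (by
      rw [idealOfVars, Ideal.span_le]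
      rintro _ ⟨v, rfl⟩
      exact ⟨N v, hN v⟩) (idealOfVars_fg (ι × κ) ℚ)
  exact vanish_of_gCyc_le_gBdr F h1 fun f hf => hK hf

end LocalVanishing

section ExtLink

open CategoryTheory Limits

universe u

namespace MatRes

variable {R : Type u} [CommRing R] {J : Ideal R} (F : MatRes R J)

/-- The chain complex of a resolution by matrices. -/
noncomputable def complex : ChainComplex (ModuleCat.{u} R) ℕ :=
  ChainComplex.of (fun n => ModuleCat.of R (Fin (F.rk n) → R))
    (fun n => ModuleCat.ofHom (matAct (F.mat n))) fun n => by
      ext z i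
      change matAct (F.mat n) (matAct (F.mat (n + 1)) _) i = 0
      rw [← matAct_mul, F.mat_mat, matAct_zero, Pi.zero_apply]

theorem complex_d (n : ℕ) :
    F.complex.d (n + 1) n = ModuleCat.ofHom (matAct (F.mat n)) :=
  ChainComplex.of_d (V := ModuleCat.{u} R) (fun n => ModuleCat.of R (Fin (F.rk n) → R))
    (fun n => ModuleCat.ofHom (matAct (F.mat n))) n

/-- The augmentation of a resolution. -/
def aug : (Fin (F.rk 0) → R) →ₗ[R] J :=
  (LinearMap.proj () ∘ₗ matAct F.gen).codRestrict J fun z => by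
    have h : ∑ i, F.gen () i * z i ∈ J := sum_mem fun i _ =>
      Ideal.mul_mem_right _ _ (F.span_gen.le (Ideal.subset_span ⟨i, rfl⟩))
    exact h

theorem aug_surjective : Function.Surjective F.aug := fun ⟨y, hy⟩ => by
  obtain ⟨c, hc⟩ := (Submodule.mem_span_range_iff_exists_fun R).mp (F.span_gen.ge hy)
  have h : ∑ i, F.gen () i * c i = y :=
    (Finset.sum_congr rfl fun i _ => mul_comm _ _).trans hc
  exact ⟨c, Subtype.ext h⟩

theorem aug_eq_zero_iff (z : Fin (F.rk 0) → R) : F.aug z = 0 ↔ matAct F.gen z = 0 :=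
  ⟨fun h => funext fun _ => congrArg Subtype.val h, fun h => Subtype.ext (congrFun h ())⟩

theorem aug_matAct (z : Fin (F.rk 1) → R) : F.aug (matAct (F.mat 0) z) = 0 := by
  rw [aug_eq_zero_iff, ← matAct_mul, F.gen_mat, matAct_zero]

theorem ofHom_comp_aug :
    ModuleCat.ofHom (matAct (F.mat 0)) ≫ ModuleCat.ofHom F.aug = 0 := by
  ext z
  exact congrArg Subtype.val (F.aug_matAct _)

theorem exact_and_epi_aug :
    (ShortComplex.mk _ _ F.ofHom_comp_aug).Exact ∧ Epi (ModuleCat.ofHom F.aug) := by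
  refine ⟨?_, (ModuleCat.epi_iff_surjective _).mpr F.aug_surjective⟩
  rw [ShortComplex.moduleCat_exact_iff]
  intro z hz
  exact F.exact_gen z ((F.aug_eq_zero_iff z).mp hz)

theorem complex_exactAt_succ (n : ℕ) : F.complex.ExactAt (n + 1) := by
  rw [HomologicalComplex.exactAt_iff' _ (n + 1 + 1) (n + 1) n (by simp) (by simp),
    ShortComplex.moduleCat_exact_iff]
  intro z hz
  change F.complex.d (n + 1) n z = 0 at hz
  rw [F.complex_d] at hz
  change ∃ w, F.complex.d (n + 1 + 1) (n + 1) w = z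
  rw [F.complex_d]
  exact F.exact n z hz

/-- The augmentation of a resolution, as a morphism of complexes. -/
noncomputable def augHom :
    F.complex ⟶ (ChainComplex.single₀ (ModuleCat.{u} R)).obj (ModuleCat.of R J) :=
  (ChainComplex.toSingle₀Equiv F.complex (ModuleCat.of R J)).symm
    ⟨ModuleCat.ofHom F.aug, by rw [F.complex_d 0]; exact F.ofHom_comp_aug⟩

theorem augHom_f_zero : F.augHom.f 0 = ModuleCat.ofHom F.aug :=
  ChainComplex.toSingle₀Equiv_symm_apply_f_zero (C := F.complex) (X := ModuleCat.of R J)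
    (ModuleCat.ofHom F.aug) (by rw [F.complex_d 0]; exact F.ofHom_comp_aug)

/-- The projective resolution given by matrices. -/
noncomputable def projectiveResolution : ProjectiveResolution (ModuleCat.of R J) where
  complex := F.complex
  projective n := by
    change Projective (ModuleCat.of R (Fin (F.rk n) → R))
    exact ModuleCat.projective_of_free (Pi.basisFun R (Fin (F.rk n)))
  π := F.augHom
  quasiIso := ⟨fun n => by
    cases n with
    | zero =>
      rw [ChainComplex.quasiIsoAt₀_iff, ShortComplex.quasiIso_iff_of_zeros']
      · refine (ShortComplex.exact_and_epi_g_iff_of_iso ?_).2 F.exact_and_epi_aug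
        exact ShortComplex.isoMk (Iso.refl _) (Iso.refl _) (Iso.refl _)
          ((Category.id_comp _).trans ((F.complex_d 0).symm.trans (Category.comp_id _).symm))
          ((Category.id_comp _).trans (Eq.trans F.augHom_f_zero.symm (Category.comp_id _).symm))
      all_goals rfl
    | succ n =>
      rw [quasiIsoAt_iff_exactAt']
      · exact F.complex_exactAt_succ n
      · apply ChainComplex.exactAt_succ_single_obj⟩

theorem exactAt_linearYonedaObj_iff (k : ℕ) :
    (F.complex.linearYonedaObj R (ModuleCat.of R R)).ExactAt (k + 1) ↔ F.Vanish k := by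
  rw [HomologicalComplex.exactAt_iff' _ k (k + 1) (k + 2) (by simp) (by simp),
    ShortComplex.moduleCat_exact_iff]
  change (∀ x : F.complex.X (k + 1) ⟶ ModuleCat.of R R, F.complex.d (k + 2) (k + 1) ≫ x = 0 →
    ∃ y : F.complex.X k ⟶ ModuleCat.of R R, F.complex.d (k + 1) k ≫ y = x) ↔ _
  rw [F.complex_d, F.complex_d]
  change (∀ x : ModuleCat.of R (Fin (F.rk (k + 1)) → R) ⟶ ModuleCat.of R R, _ = 0 →
    ∃ y : ModuleCat.of R (Fin (F.rk k) → R) ⟶ ModuleCat.of R R, _ = x) ↔ _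
  have key {a b : ℕ} (A : Matrix (Fin a) (Fin b) R) (φ : Fin a → R) :
      Fintype.linearCombination R φ ∘ₗ matAct A =
        Fintype.linearCombination R (matAct A.transpose φ) := by
    refine LinearMap.ext fun z => ?_
    simp only [LinearMap.comp_apply, Fintype.linearCombination_apply, matAct_apply,
      Matrix.transpose_apply, smul_eq_mul, Finset.sum_mul, Finset.mul_sum]
    rw [Finset.sum_comm]
    exact Finset.sum_congr rfl fun _ _ => Finset.sum_congr rfl fun _ _ => by ring
  have inj {a : ℕ} {φ ψ : Fin a → R}
      (h : Fintype.linearCombination R φ = Fintype.linearCombination R ψ) : φ = ψ :=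
    funext fun i => by simpa [Fintype.linearCombination_apply_single] using
      LinearMap.congr_fun h (Pi.single i 1)
  have surj {a : ℕ} (f : (Fin a → R) →ₗ[R] R) : ∃ φ, Fintype.linearCombination R φ = f :=
    ⟨fun i => f (Pi.single i 1), LinearMap.pi_ext' fun i => LinearMap.ext_ring (by simp [Fintype.linearCombination_apply_single])⟩
  have lin0 {a : ℕ} : Fintype.linearCombination R (0 : Fin a → R) = 0 :=
    LinearMap.ext fun z => by simp [Fintype.linearCombination_apply]
  constructor
  · intro h φ hφ
    obtain ⟨y, hy⟩ := h (ModuleCat.ofHom (Fintype.linearCombination R φ)) (by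
      refine ModuleCat.hom_ext ((key _ _).trans ?_)
      rw [hφ, lin0]; rfl)
    obtain ⟨ψ, hψ⟩ := surj y.hom
    refine ⟨ψ, inj ?_⟩
    rw [← key, hψ]
    exact congrArg ModuleCat.Hom.hom hy
  · intro h x hx
    obtain ⟨φ, hφ⟩ := surj x.hom
    have h0 : Fintype.linearCombination R φ ∘ₗ matAct (F.mat (k + 1)) = 0 := by
      rw [hφ]; exact congrArg ModuleCat.Hom.hom hx
    obtain ⟨ψ, hψ⟩ := h φ (inj (by rw [← key, h0, lin0]))
    refine ⟨ModuleCat.ofHom (Fintype.linearCombination R ψ), ModuleCat.hom_ext ?_⟩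
    exact (key _ _).trans ((congrArg _ hψ).trans hφ)

theorem subsingleton_ext_iff (k : ℕ) :
    Subsingleton (((Ext R (ModuleCat.{u} R) (k + 1)).obj (Opposite.op (ModuleCat.of R J))).obj
      (ModuleCat.of R R)) ↔ F.Vanish k := by
  rw [← ModuleCat.isZero_iff_subsingleton,
    (F.projectiveResolution.isoExt (k + 1) (ModuleCat.of R R)).isZero_iff,
    ← HomologicalComplex.exactAt_iff_isZero_homology]
  exact F.exactAt_linearYonedaObj_iff k

theorem Vanish.of_matRes {F : MatRes R J} {k : ℕ} (h : F.Vanish k) {J' : Ideal R} (hJ : J = J')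
    (F' : MatRes R J') : F'.Vanish k := by
  subst hJ
  exact (F'.subsingleton_ext_iff k).mp ((F.subsingleton_ext_iff k).mpr h)

theorem vanish_of_eq_top (hJ : J = ⊤) (k : ℕ) : F.Vanish k := by
  subst hJ
  rw [← subsingleton_ext_iff, ← ModuleCat.isZero_iff_subsingleton]
  have : Module.Free R (⊤ : Ideal R) := Module.Free.of_equiv (Submodule.topEquiv (R := R)).symm
  have : Projective (ModuleCat.of R (⊤ : Ideal R)) :=
    (IsProjective.iff_projective (⊤ : Ideal R)).mp inferInstance
  exact isZero_Ext_succ_of_projective _ _ k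

end MatRes

end ExtLink

section Pivot

variable {ι κ R T : Type*} [Fintype κ] [DecidableEq κ] [CommRing R] [CommRing T]

theorem det_submatrix_mem_maxMinors (M : Matrix ι κ R) (g : κ → ι) :
    (M.submatrix g id).det ∈ maxMinors M := Ideal.subset_span ⟨g, rfl⟩

theorem maxMinors_map (M : Matrix ι κ R) (f : R →+* T) :
    maxMinors (M.map f) = (maxMinors M).map f := by
  rw [maxMinors, maxMinors, Ideal.map_span, ← Set.range_comp]
  refine congrArg _ (congrArg _ (funext fun g => ?_))
  exact (f.map_det (M.submatrix g id)).symm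

theorem maxMinors_mul_le {l : Type*} [Fintype ι] [DecidableEq ι] (L : Matrix l ι R)
    (M : Matrix ι κ R) : maxMinors (L * M) ≤ maxMinors M := by
  refine Ideal.span_le.mpr ?_
  rintro _ ⟨g, rfl⟩
  have h : ((L * M).submatrix g id) = fun a => ∑ i, L (g a) i • M i := by
    ext a b
    simp [Matrix.mul_apply, Finset.sum_apply]
  have h' : ((L * M).submatrix g id).det =
      ∑ r : κ → ι, (∏ a, L (g a) (r a)) • (M.submatrix r id).det := by
    rw [h]
    refine ((Matrix.detRowAlternating (R := R) (n := κ)).toMultilinearMap.map_sum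
      (fun a i => L (g a) i • M i)).trans ?_
    exact Finset.sum_congr rfl fun r _ => MultilinearMap.map_smul_univ _ _ _
  change ((L * M).submatrix g id).det ∈ maxMinors M
  rw [h']
  exact sum_mem fun r _ => Ideal.mul_mem_left _ _ (det_submatrix_mem_maxMinors M r)

theorem Matrix.det_eq_mul_of_column (B : Matrix κ κ R) (a₀ : κ)
    (h : ∀ a, a ≠ a₀ → B a a₀ = 0) :
    B.det = B a₀ a₀ * (B.submatrix (Subtype.val : {a // a ≠ a₀} → κ) Subtype.val).det := by
  refine (B.twoBlockTriangular_det (· = a₀) fun a ha b hb => by rw [hb]; exact h a ha).trans ?_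
  congr 1
  convert Matrix.det_eq_elem_of_subsingleton _ (⟨a₀, rfl⟩ : {a // a = a₀})
  rfl

theorem maxMinors_eq_of_column {M : Matrix ι κ R} {i₀ : ι} {a₀ : κ} {u : R}
    (hu : u * M i₀ a₀ = 1) (h : ∀ i, i ≠ i₀ → M i a₀ = 0) :
    maxMinors M = maxMinors (M.submatrix (Subtype.val : {i // i ≠ i₀} → ι)
      (Subtype.val : {a // a ≠ a₀} → κ)) := by
  classical
  have key (g : κ → ι) (g' : {a // a ≠ a₀} → {i // i ≠ i₀}) (h₀ : g a₀ = i₀)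
      (hg : ∀ a, g a.1 = (g' a).1) : (M.submatrix g id).det =
        M i₀ a₀ * ((M.submatrix (Subtype.val : {i // i ≠ i₀} → ι)
          (Subtype.val : {a // a ≠ a₀} → κ)).submatrix g' id).det := by
    rw [Matrix.det_eq_mul_of_column _ a₀ fun a ha => ?_]
    · congr 1
      · simp [h₀]
      · congr 1
        ext a b
        simp [hg]
    · have := hg ⟨a, ha⟩
      exact h _ fun h1 => (g' ⟨a, ha⟩).2 (this.symm.trans h1)
  refine le_antisymm (Ideal.span_le.mpr ?_) (Ideal.span_le.mpr ?_)
  · rintro _ ⟨g, rfl⟩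
    change (M.submatrix g id).det ∈ maxMinors _
    by_cases hg : Function.Injective g
    · by_cases h1 : ∃ a, g a = i₀
      · obtain ⟨a₁, ha₁⟩ := h1
        have h2 : (M.submatrix g id).det = Equiv.Perm.sign (Equiv.swap a₀ a₁) *
            (M.submatrix (g ∘ Equiv.swap a₀ a₁) id).det := by
          have := Matrix.det_permute (Equiv.swap a₀ a₁) (M.submatrix (g ∘ Equiv.swap a₀ a₁) id)
          rw [← this]
          congr 1
          ext a b
          simp
        have h3 : g (Equiv.swap a₀ a₁ a₀) = i₀ := by simp [ha₁]
        rw [h2, key (g ∘ Equiv.swap a₀ a₁)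
          (fun a => ⟨g (Equiv.swap a₀ a₁ a), fun h4 => a.2 ((Equiv.swap a₀ a₁).injective
            (hg (h4.trans h3.symm)))⟩) h3 fun a => rfl]
        exact Ideal.mul_mem_left _ _ (Ideal.mul_mem_left _ _ (det_submatrix_mem_maxMinors _ _))
      · rw [Matrix.det_eq_zero_of_column_eq_zero (A := M.submatrix g id) a₀ fun a =>
          h _ fun h2 => h1 ⟨a, h2⟩]
        exact zero_mem _
    · obtain ⟨a, b, hab, hne⟩ : ∃ a b, g a = g b ∧ a ≠ b := by
        simpa [Function.Injective] using hg
      rw [Matrix.det_zero_of_row_eq hne (by ext c; simp [hab])]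
      exact zero_mem _
  · rintro _ ⟨g', rfl⟩
    change _ ∈ maxMinors _
    have h1 := key (fun a => if h : a = a₀ then i₀ else (g' ⟨a, h⟩).1) g' (by simp)
      fun a => by simp [a.2]
    have h2 := Ideal.mul_mem_left _ u (det_submatrix_mem_maxMinors M
      (fun a => if h : a = a₀ then i₀ else (g' ⟨a, h⟩).1))
    rwa [h1, ← mul_assoc, hu, one_mul] at h2

/-- The Schur complement of an invertible entry `x` with inverse `u`. -/
def schurCompl (M : Matrix ι κ R) (i₀ : ι) (a₀ : κ) (u : R) :
    Matrix {i // i ≠ i₀} {a // a ≠ a₀} R :=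
  Matrix.of fun i a => M i a - M i a₀ * u * M i₀ a

theorem maxMinors_schurCompl [Fintype ι] [DecidableEq ι] {M : Matrix ι κ R} {i₀ : ι} {a₀ : κ}
    {u : R} (hu : u * M i₀ a₀ = 1) : maxMinors (schurCompl M i₀ a₀ u) = maxMinors M := by
  let E (s : R) : Matrix ι ι R :=
    1 + Matrix.of fun i j => if j = i₀ then (if i = i₀ then 0 else s * (M i a₀ * u)) else 0
  have hE (s : R) (N : Matrix ι κ R) (i : ι) (a : κ) :
      (E s * N) i a = N i a + (if i = i₀ then 0 else s * (M i a₀ * u)) * N i₀ a := by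
    rw [Matrix.add_mul, Matrix.one_mul, Matrix.add_apply, Matrix.mul_apply]
    simp [ite_mul]
  have h1 : E 1 * (E (-1) * M) = M := by
    ext i a
    rw [hE, hE, hE]
    by_cases hi : i = i₀ <;> simp [hi]
  have h2 : maxMinors (E (-1) * M) = maxMinors M :=
    le_antisymm (maxMinors_mul_le _ _) (by
      conv_lhs => rw [← h1]
      exact maxMinors_mul_le _ _)
  rw [← h2, maxMinors_eq_of_column (M := E (-1) * M) (i₀ := i₀) (a₀ := a₀) (u := u)]
  · congr 1
    ext i a
    simp only [Matrix.submatrix_apply, hE, if_neg i.2, schurCompl, Matrix.of_apply]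
    ring
  · rw [hE]
    simp [hu]
  · intro i hi
    rw [hE, if_neg hi]
    linear_combination (- M i a₀) * hu

end Pivot

section PivotFlat

theorem MvPolynomial.flat_rename {R σ τ : Type*} [CommRing R] {f : τ → σ}
    (hf : Function.Injective f) : (rename f : MvPolynomial τ R →ₐ[R] _).toRingHom.Flat := by
  classical
  let e : ↥(Set.range f)ᶜ ⊕ τ ≃ σ := (Equiv.sumComm _ _).trans
    (((Equiv.ofInjective f hf).sumCongr (Equiv.refl _)).trans (Equiv.Set.sumCompl (Set.range f)))
  have h : (rename f : MvPolynomial τ R →ₐ[R] _).toRingHom =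
      ((renameEquiv R e).toRingEquiv.toRingHom.comp
        (sumAlgEquiv R ↥(Set.range f)ᶜ τ).symm.toRingEquiv.toRingHom).comp
        (algebraMap (MvPolynomial τ R) (MvPolynomial ↥(Set.range f)ᶜ (MvPolynomial τ R))) := by
    refine MvPolynomial.ringHom_ext (fun r => ?_) fun t => ?_
    · simp [algebraMap_eq]
    · simp [algebraMap_eq, e]
  rw [h]
  exact RingHom.Flat.comp ((RingHom.flat_algebraMap_iff).mpr inferInstance)
    (RingHom.Flat.comp (.of_bijective (sumAlgEquiv R ↥(Set.range f)ᶜ τ).symm.bijective)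
      (.of_bijective (renameEquiv R e).bijective))

variable {ι κ : Type*} (i₀ : ι) (a₀ : κ) (T : Type*) [CommRing T]
  [Algebra (MvPolynomial (ι × κ) ℚ) T] [IsLocalization.Away (X (i₀, a₀) : MvPolynomial (ι × κ) ℚ) T]

/-- The variables in the localization. -/
noncomputable def pivotVar (w : ι × κ) : T := algebraMap (MvPolynomial (ι × κ) ℚ) T (X w)

/-- The inverse of the pivot. -/
noncomputable def pivotInv : T :=
  IsLocalization.Away.invSelf (X (i₀, a₀) : MvPolynomial (ι × κ) ℚ)

theorem pivotInv_mul : pivotInv i₀ a₀ T * pivotVar T (i₀, a₀) = 1 := by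
  rw [mul_comm]
  exact IsLocalization.Away.mul_invSelf _

open Classical in
/-- The substitution adding a multiple of the rank one part to the entries outside of the row and
column of the pivot. -/
noncomputable def pivotHom (s : ℤ) : MvPolynomial (ι × κ) ℚ →+* T :=
  eval₂Hom ((algebraMap (MvPolynomial (ι × κ) ℚ) T).comp C) fun w : ι × κ =>
    pivotVar T w + if w.1 = i₀ ∨ w.2 = a₀ then 0 else
      s * (pivotVar T (w.1, a₀) * pivotInv i₀ a₀ T * pivotVar T (i₀, w.2))

open Classical in
theorem pivotHom_X (s : ℤ) (w : ι × κ) : pivotHom i₀ a₀ T s (X w) =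
    pivotVar T w + if w.1 = i₀ ∨ w.2 = a₀ then 0 else
      s * (pivotVar T (w.1, a₀) * pivotInv i₀ a₀ T * pivotVar T (i₀, w.2)) :=
  eval₂Hom_X' _ _ _

theorem isUnit_pivotHom (s : ℤ) : IsUnit (pivotHom i₀ a₀ T s (X (i₀, a₀))) := by
  rw [pivotHom_X, if_pos (Or.inl rfl), add_zero]
  exact IsUnit.of_mul_eq_one_right _ (pivotInv_mul i₀ a₀ T)

/-- The substitution on the localization. -/
noncomputable def pivotEnd (s : ℤ) : T →+* T :=
  IsLocalization.Away.lift (X (i₀, a₀) : MvPolynomial (ι × κ) ℚ) (isUnit_pivotHom i₀ a₀ T s)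

open Classical in
theorem pivotEnd_var (s : ℤ) (w : ι × κ) : pivotEnd i₀ a₀ T s (pivotVar T w) =
    pivotVar T w + if w.1 = i₀ ∨ w.2 = a₀ then 0 else
      s * (pivotVar T (w.1, a₀) * pivotInv i₀ a₀ T * pivotVar T (i₀, w.2)) :=
  (IsLocalization.Away.lift_eq _ _ _).trans (pivotHom_X i₀ a₀ T s w)

theorem pivotEnd_inv (s : ℤ) : pivotEnd i₀ a₀ T s (pivotInv i₀ a₀ T) = pivotInv i₀ a₀ T := by
  have h := congrArg (pivotEnd i₀ a₀ T s) (pivotInv_mul i₀ a₀ T)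
  rw [map_mul, pivotEnd_var, if_pos (Or.inl rfl), add_zero, map_one] at h
  linear_combination pivotInv i₀ a₀ T * h -
    pivotEnd i₀ a₀ T s (pivotInv i₀ a₀ T) * pivotInv_mul i₀ a₀ T

theorem pivotEnd_pivotEnd (s : ℤ) (z : T) :
    pivotEnd i₀ a₀ T s (pivotEnd i₀ a₀ T (-s) z) = z := by
  classical
  have h : (pivotEnd i₀ a₀ T s).comp (pivotEnd i₀ a₀ T (-s)) = RingHom.id _ := by
    refine IsLocalization.ringHom_ext (Submonoid.powers (X (i₀, a₀) : MvPolynomial (ι × κ) ℚ))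
      (MvPolynomial.ringHom_ext (fun r => ?_) fun w => ?_)
    · exact RingHom.congr_fun (Subsingleton.elim ((((pivotEnd i₀ a₀ T s).comp
        (pivotEnd i₀ a₀ T (-s))).comp (algebraMap (MvPolynomial (ι × κ) ℚ) T)).comp C)
          (((RingHom.id T).comp (algebraMap (MvPolynomial (ι × κ) ℚ) T)).comp C)) r
    · change pivotEnd i₀ a₀ T s (pivotEnd i₀ a₀ T (-s) (pivotVar T w)) = pivotVar T w
      by_cases hw : w.1 = i₀ ∨ w.2 = a₀
      · simp only [pivotEnd_var, if_pos hw, add_zero]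
      · rw [pivotEnd_var, if_neg hw, map_add, map_mul, map_intCast, map_mul, map_mul, pivotEnd_inv,
          pivotEnd_var, pivotEnd_var, pivotEnd_var, if_neg hw, if_pos (Or.inr rfl),
          if_pos (Or.inl rfl), add_zero, add_zero]
        push_cast
        ring
  exact RingHom.congr_fun h z

/-- The substitution of the entries of the Schur complement. -/
noncomputable def pivotMap :
    MvPolynomial ({i // i ≠ i₀} × {a // a ≠ a₀}) ℚ →+* T :=
  ((pivotEnd i₀ a₀ T (-1)).comp (algebraMap (MvPolynomial (ι × κ) ℚ) T)).comp
    (rename (R := ℚ) (Prod.map Subtype.val Subtype.val)).toRingHom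

theorem flat_pivotMap : (pivotMap i₀ a₀ T).Flat := by
  refine RingHom.Flat.comp (MvPolynomial.flat_rename
    (Subtype.val_injective.prodMap Subtype.val_injective))
    (RingHom.Flat.comp (RingHom.flat_algebraMap_iff.mpr
      (IsLocalization.flat T (Submonoid.powers (X (i₀, a₀) : MvPolynomial (ι × κ) ℚ))))
      (.of_bijective ⟨?_, fun z => ⟨_, pivotEnd_pivotEnd i₀ a₀ T (-1) z⟩⟩))
  refine Function.LeftInverse.injective (g := pivotEnd i₀ a₀ T 1) fun z => ?_
  exact pivotEnd_pivotEnd i₀ a₀ T 1 z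

theorem genMat_map_pivotMap : (genMat {i // i ≠ i₀} {a // a ≠ a₀} ℚ).map (pivotMap i₀ a₀ T) =
    schurCompl ((genMat ι κ ℚ).map (algebraMap _ T)) i₀ a₀ (pivotInv i₀ a₀ T) := by
  ext i a
  have h : pivotMap i₀ a₀ T (X (i, a)) = pivotEnd i₀ a₀ T (-1) (pivotVar T (i.1, a.1)) := by
    simp [pivotMap, pivotVar]
  refine h.trans ?_
  rw [pivotEnd_var, if_neg (not_or.mpr ⟨i.2, a.2⟩), Int.cast_neg, Int.cast_one,
    neg_one_mul, ← sub_eq_add_neg]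
  rfl

theorem maxMinors_map_pivotMap [Fintype ι] [DecidableEq ι] [Fintype κ] [DecidableEq κ] (d : ℕ) :
    (maxMinors (genMat {i // i ≠ i₀} {a // a ≠ a₀} ℚ) ^ d).map (pivotMap i₀ a₀ T) =
      (maxMinors (genMat ι κ ℚ) ^ d).map (algebraMap _ T) := by
  rw [Ideal.map_pow, Ideal.map_pow, ← maxMinors_map, ← maxMinors_map, genMat_map_pivotMap,
    maxMinors_schurCompl]
  exact pivotInv_mul i₀ a₀ T

end PivotFlat

section Induction

theorem MatRes.Vanish.of_flat {R T : Type*} [CommRing R] [CommRing T] {J : Ideal R} {J' : Ideal T}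
    {F : MatRes R J} {k : ℕ} (h : F.Vanish k) {f : R →+* T} (hf : f.Flat) (hJ : J.map f = J')
    (F' : MatRes T J') : F'.Vanish k := by
  let _ : Algebra R T := f.toAlgebra
  have : Module.Flat R T := hf
  exact (h.baseChange T).of_matRes hJ F'

/-- The dual of a resolution of a power of the ideal of maximal minors is exact in the degrees
which are not among the multiples `n' * δ` with `n' ≤ card κ`. -/
theorem vanish_genMat {d δ k : ℕ} (h0 : 0 < δ) (n : ℕ) : ∀ {ι κ : Type} [Fintype ι] [Fintype κ]
    [DecidableEq ι] [DecidableEq κ], Fintype.card κ = n → Fintype.card ι = n + δ → n ≤ d →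
    (∀ n' ≤ n, k + 1 ≠ n' * δ) →
    ∀ F : MatRes (MvPolynomial (ι × κ) ℚ) (maxMinors (genMat ι κ ℚ) ^ d), F.Vanish k := by
  induction n with
  | zero =>
    intro ι κ _ _ _ _ hκ _ _ _ F
    have : IsEmpty κ := Fintype.card_eq_zero_iff.mp hκ
    refine F.vanish_of_eq_top ?_ k
    have h1 : maxMinors (genMat ι κ ℚ) = ⊤ := (Ideal.eq_top_iff_one _).mpr
      (by simpa using det_submatrix_mem_maxMinors (genMat ι κ ℚ) isEmptyElim)
    rw [h1, Ideal.top_pow]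
  | succ n ih =>
    intro ι κ _ _ _ _ hκ hι hd hk F
    refine vanish_of_vanish_away (by rw [hκ, hι]) h0 (by omega) (by omega)
      (by rw [hκ]; exact hk _ le_rfl) F fun ⟨i₀, a₀⟩ => ?_
    obtain ⟨F'⟩ := MatRes.nonempty_of_isNoetherianRing
      (maxMinors (genMat {i // i ≠ i₀} {a // a ≠ a₀} ℚ) ^ d)
    have h' : F'.Vanish k := ih (by simp [hκ]) (by simp [hι]) (by omega)
      (fun n' hn' => hk n' (by omega)) F'
    exact h'.of_flat (flat_pivotMap i₀ a₀ _) (maxMinors_map_pivotMap i₀ a₀ _ d) _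

end Induction

section Main

theorem MvPolynomial.flat_map {σ A B : Type*} [CommRing A] [CommRing B] [Algebra A B]
    [Module.Flat A B] : (map (algebraMap A B) : MvPolynomial σ A →+* MvPolynomial σ B).Flat := by
  let _ : Algebra (MvPolynomial σ A) (MvPolynomial σ B) := algebraMvPolynomial
  have h : Module.Flat (MvPolynomial σ A) (MvPolynomial σ B) :=
    Module.Flat.isBaseChange A (MvPolynomial σ A) B _ (Algebra.IsPushout.out
      (R := A) (S := MvPolynomial σ A) (R' := B) (S' := MvPolynomial σ B))
  exact RingHom.flat_algebraMap_iff.mpr h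

theorem span_strictMono_minors {m n : ℕ} {R : Type*} [CommRing R] (M : Matrix (Fin m) (Fin n) R) :
    Ideal.span {p | ∃ g : Fin n → Fin m, StrictMono g ∧ p = (M.submatrix g id).det} =
      maxMinors M := by
  refine le_antisymm (Ideal.span_mono ?_) (Ideal.span_le.mpr ?_)
  · rintro _ ⟨g, -, rfl⟩
    exact ⟨g, rfl⟩
  · rintro _ ⟨g, rfl⟩
    change (M.submatrix g id).det ∈ Ideal.span _
    by_cases hg : Function.Injective g
    · have h : (M.submatrix g id).det = Equiv.Perm.sign (Tuple.sort g)⁻¹ *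
          (M.submatrix (g ∘ Tuple.sort g) id).det := by
        rw [← Matrix.det_permute]
        congr 1
        ext a b
        simp
      rw [h]
      exact Ideal.mul_mem_left _ _ (Ideal.subset_span ⟨_, (Tuple.monotone_sort g).strictMono_of_injective
        (hg.comp (Equiv.injective _)), rfl⟩)
    · obtain ⟨a, b, hab, hne⟩ : ∃ a b, g a = g b ∧ a ≠ b := by
        simpa [Function.Injective] using hg
      rw [Matrix.det_zero_of_row_eq hne (by ext c; simp [hab])]
      exact zero_mem _

end Main

/-- For `d ≥ n`, the modules `Ext^j_S(I^d, S)` vanish when `j` is not divisible by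
`m - n` or when `j > n * (m - n)`, where `I` is the ideal of maximal minors of the
generic `m × n` matrix. -/
theorem ext_powers_maximal_minors_vanishing
    (K : Type) [Field K] [CharZero K] (m n : ℕ) (hn : 1 ≤ n) (hmn : n < m)
    (X : Matrix (Fin m) (Fin n) (MvPolynomial (Fin m × Fin n) K))
    (hX : ∀ i j, X i j = MvPolynomial.X (i, j))
    (I : Ideal (MvPolynomial (Fin m × Fin n) K))
    (hI : I = Ideal.span {p | ∃ g : Fin n → Fin m, StrictMono g ∧
      p = (X.submatrix g id).det})
    (d : ℕ) (hd : n ≤ d) (j : ℕ) (hj : ¬ (m - n) ∣ j ∨ n * (m - n) < j) :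
    Subsingleton
      (((Ext (MvPolynomial (Fin m × Fin n) K) (ModuleCat (MvPolynomial (Fin m × Fin n) K)) j).obj
          (Opposite.op (ModuleCat.of (MvPolynomial (Fin m × Fin n) K) (↥(I ^ d))))).obj
        (ModuleCat.of (MvPolynomial (Fin m × Fin n) K) (MvPolynomial (Fin m × Fin n) K))) := by
  obtain ⟨k, rfl⟩ : ∃ k, j = k + 1 := Nat.exists_eq_succ_of_ne_zero fun h => by simp [h] at hj
  have hk : ∀ n' ≤ n, k + 1 ≠ n' * (m - n) := fun n' hn' h => by
    rcases hj with hj | hj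
    · exact hj ⟨n', h.trans (mul_comm _ _)⟩
    · exact absurd (Nat.mul_le_mul_right (m - n) hn') (by omega)
  have hIX : (maxMinors (genMat (Fin m) (Fin n) ℚ) ^ d).map (map (algebraMap ℚ K)) = I ^ d := by
    rw [Ideal.map_pow, ← maxMinors_map, hI, span_strictMono_minors]
    congr 2
    ext1 i j
    rw [hX]
    exact map_X _ _
  obtain ⟨F⟩ := MatRes.nonempty_of_isNoetherianRing (maxMinors (genMat (Fin m) (Fin n) ℚ) ^ d)
  obtain ⟨F'⟩ := MatRes.nonempty_of_isNoetherianRing (I ^ d)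
  have h : F.Vanish k := vanish_genMat (Nat.sub_pos_of_lt hmn) n (Fintype.card_fin n)
    ((Fintype.card_fin m).trans (by omega)) hd hk F
  exact (F'.subsingleton_ext_iff k).mpr (h.of_flat MvPolynomial.flat_map hIX F')
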